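/- Let G be a finite group with integer-valued character table and let p be a prime. Then the proportion of entries of the character table of the wreath product G ≀ S_N that are divisible by p tends to 1 as N → ∞. That is, if c(N) = p_k(N)² is the total number of entries and z(N) is the number of pairs (λ, μ) of k-multipartitions with p ∣ χ^λ(μ), then z(N)/c(N) → 1. -/

import Mathlib

open CategoryTheory Filter

/-- The wreath product `G ≀ S_N`, as the semidirect product `G^N ⋊ S_N` where `S_N`
permutes the coordinates (equivalently, `N×N` permutation matrices with entries in `G`). -/
abbrev WreathProduct (G : Type) [Group G] (N : ℕ) : Type :=
  (Fin N → G) ⋊[mulAutArrow] Equiv.Perm (Fin N)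

/-- The set of complex irreducible characters of a group `H`.  Its cardinality equals the
number of rows of the character table. -/
def IrrChar (H : Type) [Group H] : Type :=
  { f : H → ℂ // ∃ V : FDRep ℂ H, Simple V ∧ V.character = f }

/-- An entry of the character table (given by an irreducible character and a conjugacy
class) is divisible by `p` if its value on the class is `p` times an integer. -/
def EntryDivisible {H : Type} [Group H] (p : ℕ)
    (χ : IrrChar H) (c : ConjClasses H) : Prop :=
  ∃ g ∈ c.carrier, ∃ m : ℤ, χ.1 g = (p : ℂ) * m

section Completeness

variable {H : Type} [Group H]

theorem simple_of_isIrreducible [Finite H] {V : Type} [AddCommGroup V] [Module ℂ V]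
    [FiniteDimensional ℂ V] (ρ : Representation ℂ H V) [ρ.IsIrreducible] :
    Simple (FDRep.of ρ) := by
  have := Fintype.ofFinite H
  have : Invertible (Nat.card H : ℂ) := invertibleOfNonzero (by simp)
  rw [FDRep.simple_iff_char_is_norm_one]
  have h := Representation.char_orthonormal ρ ρ
  rw [if_pos ⟨Representation.Equiv.refl ρ⟩, inv_mul_eq_one₀ (by simp)] at h
  exact h.symm

/-- A class function orthogonal to every irreducible character acts as zero in every
irreducible representation. -/
theorem sum_smul_eq_zero_of_isIrreducible [Fintype H] {V : Type} [AddCommGroup V] [Module ℂ V]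
    [FiniteDimensional ℂ V] (ρ : Representation ℂ H V) [ρ.IsIrreducible] (f : H → ℂ)
    (hf : ∀ g h, f (h * g * h⁻¹) = f g) (h0 : ∑ g, f g * ρ.character g = 0) :
    ∑ g, f g • ρ g = 0 := by
  set T : V →ₗ[ℂ] V := ∑ g, f g • ρ g with hT
  have hcomm : ∀ h : H, T ∘ₗ ρ h = ρ h ∘ₗ T := by
    intro h
    change T * ρ h = ρ h * T
    rw [hT, Finset.sum_mul, Finset.mul_sum]
    refine Fintype.sum_equiv (MulAut.conj h⁻¹).toEquiv _ _ fun g => ?_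
    simp only [MulEquiv.toEquiv_eq_coe, MulEquiv.coe_toEquiv, MulAut.conj_apply, inv_inv]
    have : f (h⁻¹ * g * h) = f g := by simpa using hf g h⁻¹
    rw [this, smul_mul_assoc, mul_smul_comm, ← map_mul, ← map_mul]
    congr 2
    group
  obtain ⟨c, hc⟩ :=
    (Representation.IsIrreducible.algebraMap_intertwiningMap_bijective_of_isAlgClosed
    (ρ := ρ)).2 ⟨T, hcomm⟩
  have hTc : T = c • LinearMap.id := by
    have h := congrArg Representation.IntertwiningMap.toLinearMap hc
    exact h.symm.trans rfl
  have htr : LinearMap.trace ℂ V T = 0 := by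
    rw [hT, map_sum, ← h0]
    simp [Representation.character]
  rw [hTc, map_smul, LinearMap.trace_id, smul_eq_mul, mul_eq_zero] at htr
  rcases htr with h | h
  · rw [hTc, h, zero_smul]
  · have : Subsingleton V := Module.finrank_zero_iff.1 (by exact_mod_cast h)
    exact Subsingleton.elim _ _

theorem sum_single_smul_eq_zero_of_isSimpleModule [Fintype H] {M : Type} [AddCommGroup M]
    [Module (MonoidAlgebra ℂ H) M] [IsSimpleModule (MonoidAlgebra ℂ H) M] (f : H → ℂ)
    (hf : ∀ g h, f (h * g * h⁻¹) = f g) (h0 : ∀ χ : IrrChar H, ∑ g, f g * χ.1 g = 0) (m : M) :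
    (∑ g, MonoidAlgebra.single g (f g)) • m = 0 := by
  let : Module ℂ M := Module.compHom M (algebraMap ℂ (MonoidAlgebra ℂ H))
  have : IsScalarTower ℂ (MonoidAlgebra ℂ H) M :=
    ⟨fun x y z => by rw [Algebra.smul_def, mul_smul]; rfl⟩
  have hfin : FiniteDimensional ℂ M := Module.Finite.trans (MonoidAlgebra ℂ H) _
  let ρ : Representation ℂ H M := Representation.ofModule M
  have hρ : ρ.IsIrreducible :=
    (Representation.isSimpleModule_iff_irreducible_ofModule (k := ℂ) M).1 inferInstance
  have h1 := sum_smul_eq_zero_of_isIrreducible ρ f hf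
    (h0 ⟨_, FDRep.of ρ, simple_of_isIrreducible ρ, rfl⟩)
  have h2 : ρ.asAlgebraHom (∑ g, MonoidAlgebra.single g (f g)) = 0 := by
    rw [map_sum, ← h1]
    simp
  have h3 := LinearMap.congr_fun h2 m
  exact (Representation.ofModule_asAlgebraHom_apply_apply (k := ℂ) (G := H) M _ _).symm.trans h3

/-- A class function orthogonal to all irreducible characters vanishes. -/
theorem eq_zero_of_orthogonal_irrChar [Fintype H] (f : H → ℂ)
    (hf : ∀ g h, f (h * g * h⁻¹) = f g) (h0 : ∀ χ : IrrChar H, ∑ g, f g * χ.1 g = 0) :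
    f = 0 := by
  set T : MonoidAlgebra ℂ H := ∑ g, MonoidAlgebra.single g (f g) with hT
  have key : T ∈ Ring.jacobson (MonoidAlgebra ℂ H) := by
    rw [Ring.jacobson, Module.jacobson, Submodule.mem_sInf]
    intro I hI
    have : IsSimpleModule (MonoidAlgebra ℂ H) (MonoidAlgebra ℂ H ⧸ I) :=
      isSimpleModule_iff_isCoatom.2 hI
    have h := sum_single_smul_eq_zero_of_isSimpleModule f hf h0
      (Submodule.Quotient.mk 1 : MonoidAlgebra ℂ H ⧸ I)
    rwa [← Submodule.Quotient.mk_smul, Submodule.Quotient.mk_eq_zero, smul_eq_mul, mul_one] at h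
  rw [IsSemisimpleRing.jacobson_eq_bot, Submodule.mem_bot] at key
  funext g
  have h : T.coeff g = 0 := by rw [key]; rfl
  classical
  rw [hT, MonoidAlgebra.coeff_sum, Finsupp.finsetSum_apply] at h
  simpa [MonoidAlgebra.coeff_single, Finsupp.single_apply] using h

end Completeness

section CharacterTable

variable {H : Type} [Group H]

theorem irrChar_conj (χ : IrrChar H) (g h : H) : χ.1 (h * g * h⁻¹) = χ.1 g := by
  obtain ⟨V, -, hV⟩ := χ.2
  rw [← hV, FDRep.char_conj]

theorem irrChar_eq_of_isConj (χ : IrrChar H) {g h : H} (hc : IsConj g h) : χ.1 g = χ.1 h := by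
  obtain ⟨c, rfl⟩ := isConj_iff.1 hc
  exact (irrChar_conj χ g c).symm

theorem sum_irrChar_mul_irrChar_inv [Fintype H] [DecidableEq (IrrChar H)] (χ ψ : IrrChar H) :
    ∑ g, χ.1 g * ψ.1 g⁻¹ = if χ = ψ then (Nat.card H : ℂ) else 0 := by
  obtain ⟨_, V, hV, rfl⟩ := χ
  obtain ⟨_, W, hW, rfl⟩ := ψ
  have hH : (Nat.card H : ℂ) ≠ 0 := by simp
  have : Invertible (Nat.card H : ℂ) := invertibleOfNonzero hH
  split_ifs with he
  · have hVW : V.character = W.character := congrArg Subtype.val he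
    have h := FDRep.char_orthonormal V V
    rw [if_pos ⟨Iso.refl _⟩, inv_mul_eq_one₀ hH] at h
    change ∑ g, V.character g * W.character g⁻¹ = _
    rw [← hVW]
    exact h.symm
  · have h := FDRep.char_orthonormal V W
    rw [if_neg, mul_eq_zero_iff_left (inv_ne_zero hH)] at h
    · exact h
    · rintro ⟨i⟩
      exact he (Subtype.ext (FDRep.char_iso i))

/-- The number of `t` conjugating `x` to `h`. -/
def conjCount [Fintype H] [DecidableEq H] (x h : H) : ℕ :=
  (Finset.univ.filter fun t : H => t * x * t⁻¹ = h).card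

theorem conjCount_conj [Fintype H] [DecidableEq H] (x h c : H) :
    conjCount x (c * h * c⁻¹) = conjCount x h := by
  refine Finset.card_bij' (fun t _ => c⁻¹ * t) (fun t _ => c * t) ?_ ?_ ?_ ?_
  · intro t ht
    rw [Finset.mem_filter_univ] at ht ⊢
    rw [mul_inv_rev, inv_inv, show c⁻¹ * t * x * (t⁻¹ * c) = c⁻¹ * (t * x * t⁻¹) * c by group, ht]
    group
  · intro t ht
    rw [Finset.mem_filter_univ] at ht ⊢
    rw [mul_inv_rev, ← ht]
    group
  · simp
  · simp

theorem sum_conjCount_mul [Fintype H] [DecidableEq H] (x : H) (χ : IrrChar H) :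
    ∑ h, (conjCount x h : ℂ) * χ.1 h = Nat.card H * χ.1 x := by
  simp only [conjCount, Finset.card_filter, Nat.cast_sum, Finset.sum_mul]
  rw [Finset.sum_comm]
  simp [irrChar_conj]

/-- Irreducible characters separate conjugacy classes. -/
theorem isConj_of_irrChar_eq [Finite H] {x y : H} (h : ∀ χ : IrrChar H, χ.1 x = χ.1 y) :
    IsConj x y := by
  classical
  have := Fintype.ofFinite H
  have h0 := eq_zero_of_orthogonal_irrChar
    (fun h => (conjCount x h : ℂ) - conjCount y h) (by simp [conjCount_conj])
    fun χ => by simp only [sub_mul, Finset.sum_sub_distrib, sum_conjCount_mul, h, sub_self]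
  have h1 := congrFun h0 y
  simp only [Pi.zero_apply, sub_eq_zero, Nat.cast_inj] at h1
  have h2 : 0 < conjCount x y := by
    rw [h1]
    exact Finset.card_pos.2 ⟨1, by simp⟩
  obtain ⟨t, ht⟩ := Finset.card_pos.1 h2
  exact isConj_iff.2 ⟨t, by simpa using ht⟩

/-- Column orthogonality for the character table. -/
theorem sum_irrChar_mul_irrChar_inv_self [Fintype H] [Fintype (IrrChar H)] [DecidableEq H] (g : H) :
    ∑ χ : IrrChar H, χ.1 g * χ.1 g⁻¹ = (conjCount g g : ℂ) := by
  classical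
  have h0 := eq_zero_of_orthogonal_irrChar
    (fun h => (conjCount g h : ℂ) - ∑ χ : IrrChar H, χ.1 g * χ.1 h⁻¹)
    (fun h c => by
      have hc : (c * h * c⁻¹)⁻¹ = c * h⁻¹ * c⁻¹ := by group
      simp only [conjCount_conj, hc, irrChar_conj])
    fun ψ => by
      simp only [sub_mul, Finset.sum_sub_distrib, sum_conjCount_mul, sub_eq_zero, Finset.sum_mul]
      rw [Finset.sum_comm]
      simp only [mul_assoc, ← Finset.mul_sum]
      simp only [mul_comm _ (ψ.1 _), sum_irrChar_mul_irrChar_inv]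
      simp
  exact (sub_eq_zero.1 (congrFun h0 g)).symm

theorem linearIndependent_irrChar [Finite H] :
    LinearIndependent ℂ (fun χ : IrrChar H => fun c : ConjClasses H =>
      Quotient.lift χ.1 (fun _ _ h => irrChar_eq_of_isConj χ h) c) := by
  classical
  have := Fintype.ofFinite H
  rw [linearIndependent_iff']
  intro s a ha χ hχ
  have h1 : ∀ g : H, ∑ ψ ∈ s, a ψ * ψ.1 g = 0 := fun g => by
    have h := congrFun ha (ConjClasses.mk g)
    rw [Finset.sum_apply] at h
    exact h
  have h2 : ∑ g : H, (∑ ψ ∈ s, a ψ * ψ.1 g) * χ.1 g⁻¹ = 0 := by simp [h1]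
  simp only [Finset.sum_mul, mul_assoc] at h2
  rw [Finset.sum_comm] at h2
  simpa [← Finset.mul_sum, sum_irrChar_mul_irrChar_inv, hχ] using h2

instance finite_irrChar [Finite H] : Finite (IrrChar H) :=
  linearIndependent_irrChar.finite

theorem card_irrChar [Finite H] : Nat.card (IrrChar H) = Nat.card (ConjClasses H) := by
  classical
  have := Fintype.ofFinite H
  have := Fintype.ofFinite (IrrChar H)
  have := Fintype.ofFinite (ConjClasses H)
  simp only [Nat.card_eq_fintype_card]
  apply le_antisymm
  · simpa using (linearIndependent_irrChar (H := H)).fintype_card_le_finrank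
  · let L : (ConjClasses H → ℂ) →ₗ[ℂ] (IrrChar H → ℂ) :=
      { toFun f χ := ∑ g, f (ConjClasses.mk g) * χ.1 g
        map_add' _ _ := by ext; simp [add_mul, Finset.sum_add_distrib]
        map_smul' _ _ := by ext; simp [mul_assoc, Finset.mul_sum] }
    have hL : Function.Injective L := by
      rw [injective_iff_map_eq_zero]
      intro f hf
      have h := eq_zero_of_orthogonal_irrChar (fun g => f (ConjClasses.mk g))
        (fun g h => by
          congr 1
          exact ConjClasses.mk_eq_mk_iff_isConj.2 (isConj_iff.2 ⟨h, rfl⟩).symm)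
        (fun χ => congrFun hf χ)
      ext c
      obtain ⟨g, rfl⟩ := ConjClasses.mk_surjective c
      exact congrFun h g
    simpa using LinearMap.finrank_le_finrank_of_injective hL

end CharacterTable

section RootsOfUnity

/-- The trace of `c ^ j * P`, for `P` an idempotent commuting with the finite-order operator `c`,
is a nonnegative integral combination of `j`-th powers of roots of unity. -/
theorem exists_trace_pow_mul_eq_sum {V : Type} [AddCommGroup V] [Module ℂ V]
    [FiniteDimensional ℂ V] {c P : Module.End ℂ V} {n : ℕ} (hn : 0 < n) (hc : c ^ n = 1)
    (hP : P * P = P) (hcP : c * P = P * c) {ζ : ℂ} (hζ : IsPrimitiveRoot ζ n) :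
    ∃ a : ℕ → ℕ, ∀ j : ℕ, LinearMap.trace ℂ V (c ^ j * P) =
      ∑ i ∈ Finset.range n, (a i : ℂ) * ζ ^ (i * j) := by
  have hζ0 : ζ ≠ 0 := hζ.ne_zero hn.ne'
  have hn0 : (n : ℂ) ≠ 0 := by exact_mod_cast hn.ne'
  let E : ℕ → Module.End ℂ V := fun i =>
    (n : ℂ)⁻¹ • ∑ j ∈ Finset.range n, (ζ⁻¹ ^ i) ^ j • c ^ j
  have hcE : ∀ i, c * E i = ζ ^ i • E i := by
    intro i
    have h : ∑ j ∈ Finset.range n, (ζ⁻¹ ^ i) ^ (j + 1) • c ^ (j + 1) =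
        ∑ j ∈ Finset.range n, (ζ⁻¹ ^ i) ^ j • c ^ j := by
      have h1 := Finset.sum_range_succ (fun j => (ζ⁻¹ ^ i) ^ j • c ^ j) n
      have h2 : (ζ⁻¹ ^ i) ^ n = 1 := by
        rw [← pow_mul, mul_comm, pow_mul, inv_pow, hζ.pow_eq_one]
        simp
      rw [Finset.sum_range_succ', hc, h2] at h1
      simpa using h1
    simp only [E]
    rw [smul_comm (ζ ^ i), mul_smul_comm, Finset.mul_sum]
    congr 1
    conv_rhs => rw [← h, Finset.smul_sum]
    refine Finset.sum_congr rfl fun j _ => ?_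
    rw [smul_smul, mul_smul_comm, ← pow_succ', pow_succ (ζ⁻¹ ^ i) j, mul_left_comm, ← mul_pow,
      mul_inv_cancel₀ hζ0, one_pow, mul_one]
  have hcjE : ∀ i j, c ^ j * E i = ζ ^ (i * j) • E i := by
    intro i j
    induction j with
    | zero => simp
    | succ j ih =>
      rw [pow_succ, mul_assoc, hcE, mul_smul_comm, ih, smul_smul, mul_add, mul_one, pow_add,
        mul_comm]
  have hEE : ∀ i, E i * E i = E i := by
    intro i
    conv_lhs => lhs; simp only [E]
    rw [smul_mul_assoc, Finset.sum_mul]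
    have : ∀ j ∈ Finset.range n, (ζ⁻¹ ^ i) ^ j • c ^ j * E i = E i := fun j _ => by
      rw [smul_mul_assoc, hcjE, smul_smul, ← pow_mul, ← mul_pow, inv_mul_cancel₀ hζ0, one_pow,
        one_smul]
    rw [Finset.sum_congr rfl this, Finset.sum_const, Finset.card_range, ← Nat.cast_smul_eq_nsmul ℂ,
      smul_smul, inv_mul_cancel₀ hn0, one_smul]
  have hsum : ∑ i ∈ Finset.range n, E i = 1 := by
    simp only [E]
    rw [← Finset.smul_sum, Finset.sum_comm, inv_smul_eq_iff₀ hn0]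
    simp only [← Finset.sum_smul]
    rw [Finset.sum_eq_single_of_mem 0 (Finset.mem_range.2 hn)]
    · simp
    · intro j hj hj0
      have h1 : ζ⁻¹ ^ j ≠ 1 := by
        rw [inv_pow, inv_ne_one, Ne, hζ.pow_eq_one_iff_dvd]
        exact fun h => (Nat.le_of_dvd (Nat.pos_of_ne_zero hj0) h).not_gt (Finset.mem_range.1 hj)
      have h2 : ∑ i ∈ Finset.range n, (ζ⁻¹ ^ i) ^ j = 0 := by
        simp only [← pow_mul, mul_comm _ j]
        simp only [pow_mul]
        rw [geom_sum_eq h1, ← pow_mul, mul_comm j n, pow_mul, inv_pow, hζ.pow_eq_one]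
        simp
      rw [h2, zero_smul]
  have hcomm : ∀ i, E i * P = P * E i := by
    intro i
    simp only [E, smul_mul_assoc, mul_smul_comm, Finset.sum_mul, Finset.mul_sum]
    congr 1
    refine Finset.sum_congr rfl fun j _ => ?_
    rw [(show Commute c P from hcP).pow_left j]
  have hidem : ∀ i, IsIdempotentElem (E i * P) := by
    intro i
    rw [IsIdempotentElem, mul_assoc, ← mul_assoc P, ← hcomm, mul_assoc (E i) P P, hP, ← mul_assoc,
      hEE]
  refine ⟨fun i => Module.finrank ℂ (LinearMap.range (E i * P)), fun j => ?_⟩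
  have h : c ^ j * P = ∑ i ∈ Finset.range n, ζ ^ (i * j) • (E i * P) := by
    conv_lhs => rw [← mul_one (c ^ j), ← hsum, Finset.mul_sum, Finset.sum_mul]
    refine Finset.sum_congr rfl fun i _ => ?_
    rw [hcjE, smul_mul_assoc]
  rw [h, map_sum]
  refine Finset.sum_congr rfl fun i _ => ?_
  rw [map_smul, (LinearMap.IsIdempotentElem.isProj_range _ (hidem i)).trace, smul_eq_mul, mul_comm]

open Polynomial in
theorem exists_trace_pow_mul_eq_aeval {V : Type} [AddCommGroup V] [Module ℂ V]
    [FiniteDimensional ℂ V] {c P : Module.End ℂ V} {n : ℕ} (hn : 0 < n) (hc : c ^ n = 1)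
    (hP : P * P = P) (hcP : c * P = P * c) {ζ : ℂ} (hζ : IsPrimitiveRoot ζ n) :
    ∃ F : ℤ[X], ∀ j : ℕ, LinearMap.trace ℂ V (c ^ j * P) = aeval (ζ ^ j) F := by
  obtain ⟨a, ha⟩ := exists_trace_pow_mul_eq_sum hn hc hP hcP hζ
  refine ⟨∑ i ∈ Finset.range n, C (a i : ℤ) * X ^ i, fun j => ?_⟩
  rw [ha, map_sum]
  refine Finset.sum_congr rfl fun i _ => ?_
  simp [← pow_mul, mul_comm]

open Polynomial in
theorem aeval_pow_eq_of_coprime {n : ℕ} (hn : 0 < n) {ζ : ℂ} (hζ : IsPrimitiveRoot ζ n)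
    {F : ℤ[X]} {m : ℤ} (hF : aeval ζ F = m) {j : ℕ} (hj : j.Coprime n) :
    aeval (ζ ^ j) F = m := by
  have h : minpoly ℤ ζ ∣ F - C m :=
    minpoly.isIntegrallyClosed_dvd (hζ.isIntegral hn) (by simp [hF])
  rw [hζ.minpoly_eq_pow_coprime hj] at h
  obtain ⟨Q, hQ⟩ := h
  have := congrArg (aeval (ζ ^ j)) hQ
  rw [map_mul, minpoly.aeval, zero_mul, map_sub, sub_eq_zero] at this
  simpa using this

open Polynomial in
theorem exists_int_eq_aeval_of_forall_coprime {n : ℕ} [NeZero n] {ζ : ℂ}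
    (hζ : IsPrimitiveRoot ζ n) {F : ℤ[X]}
    (hF : ∀ j : ℕ, j.Coprime n → aeval (ζ ^ j) F = aeval ζ F) : ∃ m : ℤ, aeval ζ F = m := by
  have hn : 0 < n := NeZero.pos n
  have hmon : (cyclotomic n ℤ).Monic := cyclotomic.monic n ℤ
  set R := F %ₘ cyclotomic n ℤ with hR
  have hmod : ∀ ξ : ℂ, IsPrimitiveRoot ξ n → aeval ξ R = aeval ξ F := by
    intro ξ hξ
    have h0 : aeval ξ (cyclotomic n ℤ) = 0 := by
      rw [aeval_def, ← Polynomial.eval_map, map_cyclotomic]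
      exact hξ.isRoot_cyclotomic hn
    conv_rhs => rw [← modByMonic_add_div F (cyclotomic n ℤ)]
    simp [h0, hR]
  have hdeg : R.degree < (Nat.totient n : WithBot ℕ) := by
    rw [← degree_cyclotomic n ℤ]
    exact degree_modByMonic_lt _ hmon
  have hR0 : R.map (Int.castRingHom ℂ) - C (aeval ζ F) = 0 := by
    refine Polynomial.eq_zero_of_degree_lt_of_eval_finset_eq_zero (primitiveRoots n ℂ) ?_ ?_
    · rw [hζ.card_primitiveRoots]
      refine (degree_sub_le _ _).trans_lt (max_lt (degree_map_le.trans_lt hdeg) ?_)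
      refine degree_C_le.trans_lt ?_
      exact_mod_cast Nat.totient_pos.2 hn
    · intro ξ hξ
      have hξ' : IsPrimitiveRoot ξ n := (mem_primitiveRoots hn).1 hξ
      obtain ⟨j, -, hj, rfl⟩ := hζ.isPrimitiveRoot_iff.1 hξ'
      have h1 : eval (ζ ^ j) (R.map (Int.castRingHom ℂ)) = aeval (ζ ^ j) R := by
        rw [aeval_def, Polynomial.eval_map]; rfl
      rw [eval_sub, eval_C, h1, hmod _ hξ', hF j hj, sub_self]
  refine ⟨R.coeff 0, ?_⟩
  have := congrArg (fun q => Polynomial.coeff q 0) hR0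
  simp only [coeff_sub, coeff_map, coeff_C_zero, coeff_zero, sub_eq_zero] at this
  rw [← this]; simp

theorem int_dvd_of_isIntegral {a p : ℤ} {z : ℂ} (hz : IsIntegral ℤ z) (h : (a : ℂ) = p * z) :
    p ∣ a := by
  rcases eq_or_ne p 0 with rfl | hp
  · simp at h; simp [h]
  have hp' : (p : ℂ) ≠ 0 := by exact_mod_cast hp
  have hz' : z = algebraMap ℚ ℂ (a / p) := by
    rw [eq_comm, map_div₀]
    simp only [map_intCast]
    rw [div_eq_iff hp', h, mul_comm]
  rw [hz'] at hz
  have hq : IsIntegral ℤ ((a : ℚ) / p) :=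
    (isIntegral_algebraMap_iff (algebraMap ℚ ℂ).injective).1 hz
  obtain ⟨b, hb⟩ := IsIntegrallyClosed.isIntegral_iff.1 hq
  refine ⟨b, ?_⟩
  have hp'' : (p : ℚ) ≠ 0 := by exact_mod_cast hp
  rw [eq_div_iff hp''] at hb
  simp only [eq_intCast] at hb
  exact_mod_cast (hb.symm.trans (mul_comm _ _))

open Polynomial in
theorem exists_aeval_pow_prime_pow_eq {p : ℕ} [Fact p.Prime] (e : ℕ) (F : ℤ[X]) :
    ∃ Q : ℤ[X], F ^ p ^ e = expand ℤ (p ^ e) F + C (p : ℤ) * Q := by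
  have h : C (p : ℤ) ∣ F ^ p ^ e - expand ℤ (p ^ e) F := by
    have h1 : (F ^ p ^ e - expand ℤ (p ^ e) F).map (Int.castRingHom (ZMod p)) = 0 := by
      rw [Polynomial.map_sub, Polynomial.map_pow, map_expand, sub_eq_zero]
      induction e with
      | zero => simp
      | succ e ih => rw [pow_succ, pow_mul, ih, mul_comm, expand_mul, ZMod.expand_card]
    rw [C_dvd_iff_dvd_coeff]
    intro i
    have h2 := congrArg (fun q => Polynomial.coeff q i) h1
    simp only [coeff_map, coeff_zero, eq_intCast] at h2
    exact (ZMod.intCast_zmod_eq_zero_iff_dvd _ _).1 h2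
  obtain ⟨Q, hQ⟩ := h
  exact ⟨Q, by rw [← hQ]; ring⟩

open Polynomial in
theorem isIntegral_aeval_of_isIntegral {z : ℂ} (hz : IsIntegral ℤ z) (Q : ℤ[X]) :
    IsIntegral ℤ (aeval z Q) :=
  (aeval_subalgebra_coe Q (integralClosure ℤ ℂ) ⟨z, hz⟩) ▸
    (aeval (⟨z, hz⟩ : integralClosure ℤ ℂ) Q).2

open Polynomial in
theorem int_modEq_of_aeval_pow_eq {p : ℕ} [Fact p.Prime] {n e : ℕ} (hn : 0 < n) {ζ : ℂ}
    (hζ : IsPrimitiveRoot ζ n) {F₁ F₂ : ℤ[X]} {m₁ m₂ : ℤ} (h₁ : aeval ζ F₁ = m₁)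
    (h₂ : aeval ζ F₂ = m₂) (h : aeval (ζ ^ p ^ e) F₁ = aeval (ζ ^ p ^ e) F₂) :
    (p : ℤ) ∣ m₁ - m₂ := by
  obtain ⟨Q₁, hQ₁⟩ := exists_aeval_pow_prime_pow_eq (p := p) e F₁
  obtain ⟨Q₂, hQ₂⟩ := exists_aeval_pow_prime_pow_eq (p := p) e F₂
  have e₁ := congrArg (aeval ζ) hQ₁
  have e₂ := congrArg (aeval ζ) hQ₂
  simp only [map_pow, map_add, map_mul, expand_aeval, h₁, h₂] at e₁ e₂
  have hd : (p : ℤ) ∣ m₁ ^ p ^ e - m₂ ^ p ^ e := by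
    refine int_dvd_of_isIntegral (z := aeval ζ (Q₁ - Q₂)) ?_ ?_
    · exact isIntegral_aeval_of_isIntegral (hζ.isIntegral hn) _
    · push_cast
      rw [e₁, e₂, h, map_sub]
      simp
      ring
  rw [← ZMod.intCast_zmod_eq_zero_iff_dvd] at hd ⊢
  push_cast at hd ⊢
  simpa [ZMod.pow_card_pow] using hd

end RootsOfUnity

section RationalGroups

variable {H : Type} [Group H]

/-- Every element is conjugate to each of its powers with exponent coprime to the group order. -/
def IsRationalGroup (H : Type) [Group H] : Prop :=
  ∀ x : H, ∀ j : ℕ, j.Coprime (Nat.card H) → IsConj (x ^ j) x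

theorem FDRep.ρ_pow_natCard [Finite H] (V : FDRep ℂ H) (x : H) :
    (V.ρ x : Module.End ℂ V) ^ Nat.card H = 1 := by
  rw [← map_pow, pow_card_eq_one', map_one]

open Polynomial in
theorem exists_character_pow_eq_aeval [Finite H] (V : FDRep ℂ H) (x : H) {ζ : ℂ}
    (hζ : IsPrimitiveRoot ζ (Nat.card H)) :
    ∃ F : ℤ[X], ∀ j : ℕ, V.character (x ^ j) = aeval (ζ ^ j) F := by
  obtain ⟨F, hF⟩ := exists_trace_pow_mul_eq_aeval (P := (1 : Module.End ℂ V)) Nat.card_pos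
    (FDRep.ρ_pow_natCard V x) (one_mul 1) (by simp) hζ
  refine ⟨F, fun j => ?_⟩
  rw [← hF, mul_one, ← map_pow]
  rfl

theorem isPrimitiveRoot_exp_natCard (H : Type) [Group H] [Finite H] :
    IsPrimitiveRoot (Complex.exp (2 * Real.pi * Complex.I / (Nat.card H : ℕ))) (Nat.card H) :=
  Complex.isPrimitiveRoot_exp _ Nat.card_pos.ne'

theorem isRationalGroup_of_integral [Finite H]
    (hint : ∀ V : FDRep ℂ H, Simple V → ∀ g : H, ∃ n : ℤ, V.character g = n) :
    IsRationalGroup H := by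
  intro x j hj
  refine isConj_of_irrChar_eq fun χ => ?_
  obtain ⟨_, V, hV, rfl⟩ := χ
  change V.character (x ^ j) = V.character x
  obtain ⟨m, hm⟩ := hint V hV x
  have hζ := isPrimitiveRoot_exp_natCard H
  obtain ⟨F, hF⟩ := exists_character_pow_eq_aeval V x hζ
  have h1 := hF 1
  rw [pow_one, pow_one, hm] at h1
  rw [hF, hm, aeval_pow_eq_of_coprime Nat.card_pos hζ h1.symm hj]

theorem IsRationalGroup.exists_int_eq [Finite H] (hH : IsRationalGroup H) (V : FDRep ℂ H)
    (x : H) : ∃ m : ℤ, V.character x = m := by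
  have hζ := isPrimitiveRoot_exp_natCard H
  obtain ⟨F, hF⟩ := exists_character_pow_eq_aeval V x hζ
  have : NeZero (Nat.card H) := ⟨Nat.card_pos.ne'⟩
  obtain ⟨m, hm⟩ := exists_int_eq_aeval_of_forall_coprime hζ (F := F) fun j hj => by
    have h1 := hF 1
    rw [pow_one, pow_one] at h1
    rw [← hF, ← h1]
    obtain ⟨c, hc⟩ := isConj_iff.1 (hH x j hj)
    rw [← FDRep.char_conj V _ c, hc]
  refine ⟨m, ?_⟩
  have h1 := hF 1
  rw [pow_one, pow_one] at h1
  rw [h1, hm]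

theorem IsRationalGroup.isConj_inv [Finite H] (hH : IsRationalGroup H) (x : H) :
    IsConj x⁻¹ x := by
  have h := hH x (Nat.card H - 1) (by
    rw [Nat.coprime_self_sub_left Nat.card_pos]
    exact Nat.coprime_one_left _)
  have h2 : x ^ (Nat.card H - 1) = x⁻¹ := by
    rw [eq_inv_iff_mul_eq_one, ← pow_succ, Nat.sub_add_cancel Nat.card_pos, pow_card_eq_one']
  rwa [h2] at h

theorem dvd_character_sub_of_isConj_pow [Finite H] {p : ℕ} [Fact p.Prime] {e : ℕ}
    (V : FDRep ℂ H) {x y : H} (hxy : IsConj (x ^ p ^ e) (y ^ p ^ e)) {a b : ℤ}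
    (ha : V.character x = a) (hb : V.character y = b) : (p : ℤ) ∣ a - b := by
  have hζ := isPrimitiveRoot_exp_natCard H
  obtain ⟨F, hF⟩ := exists_character_pow_eq_aeval V x hζ
  obtain ⟨F', hF'⟩ := exists_character_pow_eq_aeval V y hζ
  have h1 := hF 1
  have h1' := hF' 1
  rw [pow_one, pow_one] at h1 h1'
  refine int_modEq_of_aeval_pow_eq Nat.card_pos hζ (e := e) (h1.symm.trans ha)
    (h1'.symm.trans hb) ?_
  rw [← hF, ← hF']
  obtain ⟨c, hc⟩ := isConj_iff.1 hxy
  rw [← hc, FDRep.char_conj]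

/-- For a subgroup commuting with `c`, the sum over the coset of the squared values of
an integer-valued character is divisible by the order of the subgroup. -/
theorem natCard_dvd_sum_sq [Finite H] {K : Type} [Group K] [Fintype K] (ι : K →* H) (c : H)
    (hc : ∀ ρ, c * ι ρ = ι ρ * c) (V : FDRep ℂ H) (m : K → ℤ)
    (hm : ∀ ρ, V.character (c * ι ρ) = m ρ) : (Nat.card K : ℤ) ∣ ∑ ρ, m ρ ^ 2 := by
  have hK : (Nat.card K : ℂ) ≠ 0 := by simp
  let W : FDRep ℂ H := MonoidalCategory.tensorObj V V
  have hW : ∀ g, W.character g = V.character g ^ 2 := fun g => by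
    rw [sq, FDRep.char_tensor]; rfl
  let P : Module.End ℂ W := (Nat.card K : ℂ)⁻¹ • ∑ ρ, W.ρ (ι ρ)
  have hρP : ∀ ρ, W.ρ (ι ρ) * P = P := fun ρ => by
    simp only [P, mul_smul_comm, Finset.mul_sum, ← map_mul]
    congr 1
    exact (Group.mulLeft_bijective ρ).sum_comp fun σ => W.ρ (ι σ)
  have hPP : P * P = P := by
    conv_lhs => lhs; simp only [P]
    rw [smul_mul_assoc, Finset.sum_mul]
    simp only [hρP, Finset.sum_const, Finset.card_univ]
    rw [← Nat.cast_smul_eq_nsmul ℂ, smul_smul, ← Nat.card_eq_fintype_card, inv_mul_cancel₀ hK,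
      one_smul]
  have hcP : W.ρ c * P = P * W.ρ c := by
    simp only [P, mul_smul_comm, smul_mul_assoc, Finset.mul_sum, Finset.sum_mul, ← map_mul, hc]
  have hζ := isPrimitiveRoot_exp_natCard H
  obtain ⟨F, hF⟩ := exists_trace_pow_mul_eq_aeval Nat.card_pos (FDRep.ρ_pow_natCard W c) hPP hcP hζ
  have h1 := hF 1
  rw [pow_one, pow_one] at h1
  refine int_dvd_of_isIntegral (isIntegral_aeval_of_isIntegral (hζ.isIntegral Nat.card_pos) F) ?_
  rw [← h1]
  simp only [P, mul_smul_comm, Finset.mul_sum, ← map_mul, map_smul, map_sum]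
  have h2 : ∀ ρ, LinearMap.trace ℂ W (W.ρ (c * ι ρ)) = (m ρ : ℂ) ^ 2 := fun ρ => by
    rw [← hm, ← hW]; rfl
  simp only [h2, smul_eq_mul]
  push_cast
  rw [← Finset.mul_sum, inv_mul_cancel_left₀ hK]

/-- The number of irreducible characters not vanishing identically on the coset `c K` is at most
the average over `K` of the centralizer orders. -/
theorem card_irrChar_ne_zero_mul_card_le [Fintype H] [DecidableEq H] (hH : IsRationalGroup H)
    {K : Type} [Group K] [Fintype K] (ι : K →* H) (c : H) (hc : ∀ ρ, c * ι ρ = ι ρ * c) :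
    Nat.card {χ : IrrChar H // ∃ ρ, χ.1 (c * ι ρ) ≠ 0} * Nat.card K ≤
      ∑ ρ, conjCount (c * ι ρ) (c * ι ρ) := by
  classical
  have := Fintype.ofFinite (IrrChar H)
  have hm : ∀ χ : IrrChar H, ∀ g, ∃ m : ℤ, χ.1 g = m := by
    rintro ⟨_, V, hV, rfl⟩ g
    exact hH.exists_int_eq V g
  choose m hm using hm
  have hcol : ∀ g, ∑ χ, m χ g ^ 2 = (conjCount g g : ℤ) := fun g => by
    have h := sum_irrChar_mul_irrChar_inv_self g
    simp only [irrChar_eq_of_isConj _ (hH.isConj_inv g), hm, ← sq] at h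
    exact_mod_cast h
  have hdvd : ∀ χ, (Nat.card K : ℤ) ∣ ∑ ρ, m χ (c * ι ρ) ^ 2 := by
    intro χ
    obtain ⟨V, hV, hχ⟩ := χ.2
    exact natCard_dvd_sum_sq ι c hc V _ fun ρ => by rw [hχ, hm]
  have hle : ∀ χ, (if ∃ ρ, χ.1 (c * ι ρ) ≠ 0 then (Nat.card K : ℤ) else 0) ≤
      ∑ ρ, m χ (c * ι ρ) ^ 2 := by
    intro χ
    split_ifs with h
    · refine Int.le_of_dvd ?_ (hdvd χ)
      obtain ⟨ρ, hρ⟩ := h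
      refine Finset.sum_pos' (fun _ _ => sq_nonneg _) ⟨ρ, Finset.mem_univ _, ?_⟩
      rw [hm] at hρ
      have : m χ (c * ι ρ) ≠ 0 := by exact_mod_cast hρ
      positivity
    · exact Finset.sum_nonneg fun _ _ => sq_nonneg _
  have h := Finset.sum_le_sum fun χ (_ : χ ∈ Finset.univ) => hle χ
  rw [Finset.sum_comm] at h
  simp only [hcol] at h
  rw [← Finset.sum_filter, Finset.sum_const, nsmul_eq_mul] at h
  rw [Nat.card_eq_fintype_card, Fintype.card_subtype]
  exact_mod_cast h

end RationalGroups

section EquivariantEquiv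

/-- The points of a given type in a finite set with a group action, when all orbits of that
type have the same size. -/
theorem card_type_eq_mul_card_orbits {Γ X T : Type} [Group Γ] [MulAction Γ X] [Finite X]
    {t : X → T} (ht : ∀ (γ : Γ) x, t (γ • x) = t x) (τ : T) (s : ℕ)
    (hs : ∀ x, t x = τ → (MulAction.orbit Γ x).ncard = s) :
    Nat.card {x // t x = τ} =
      s * Nat.card {ω : MulAction.orbitRel.Quotient Γ X // ∃ x, Quotient.mk _ x = ω ∧ t x = τ} := by
  classical
  have := Fintype.ofFinite X
  have : Fintype (MulAction.orbitRel.Quotient Γ X) := Fintype.ofFinite _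
  simp only [Nat.card_eq_fintype_card, Fintype.card_subtype]
  rw [Finset.card_eq_sum_card_fiberwise
    (f := fun x => (Quotient.mk _ x : MulAction.orbitRel.Quotient Γ X))
    (t := Finset.univ.filter fun ω => ∃ x, Quotient.mk _ x = ω ∧ t x = τ)]
  · rw [Finset.sum_const_nat (m := s), mul_comm]
    intro ω hω
    obtain ⟨x, rfl, hx⟩ := (Finset.mem_filter_univ _).1 hω
    rw [← hs x hx, ← Set.ncard_coe_finset]
    congr 1
    ext y
    simp only [Finset.coe_filter, Finset.mem_filter, Finset.mem_univ, true_and, Set.mem_ofPred_eq]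
    constructor
    · rintro ⟨-, h⟩
      exact MulAction.orbitRel_apply.1 (Quotient.exact h)
    · rintro ⟨γ, rfl⟩
      exact ⟨(ht γ x).trans hx, Quotient.sound (MulAction.orbitRel_apply.2 ⟨γ, rfl⟩)⟩
  · intro x hx
    simp only [Finset.coe_filter, Finset.mem_univ, true_and, Set.mem_ofPred_eq] at hx ⊢
    exact ⟨x, rfl, hx⟩

theorem exists_equivariant_equiv {Γ X Y T : Type} [Group Γ] [MulAction Γ X] [MulAction Γ Y]
    [Finite X] [Finite Y] {tX : X → T} {tY : Y → T} (htX : ∀ (γ : Γ) x, tX (γ • x) = tX x)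
    (htY : ∀ (γ : Γ) y, tY (γ • y) = tY y)
    (hst : ∀ x y, tX x = tY y →
      ∃ γ : Γ, MulAction.stabilizer Γ x = MulAction.stabilizer Γ (γ • y))
    (hcard : ∀ τ, Nat.card {x // tX x = τ} = Nat.card {y // tY y = τ}) :
    ∃ e : X ≃ Y, ∀ (γ : Γ) x, e (γ • x) = γ • e x := by
  classical
  let qX : MulAction.orbitRel.Quotient Γ X → T := fun ω => Quotient.lift tX (fun a b h => by
    obtain ⟨γ, rfl⟩ := MulAction.orbitRel_apply.1 h
    exact htX γ b) ω
  let qY : MulAction.orbitRel.Quotient Γ Y → T := fun ω => Quotient.lift tY (fun a b h => by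
    obtain ⟨γ, rfl⟩ := MulAction.orbitRel_apply.1 h
    exact htY γ b) ω
  have hq : ∀ τ, Nonempty ({ω // qX ω = τ} ≃ {ω // qY ω = τ}) := by
    intro τ
    have eX : ∀ ω, (∃ x, Quotient.mk _ x = ω ∧ tX x = τ) ↔ qX ω = τ := by
      intro ω
      constructor
      · rintro ⟨x, rfl, h⟩; exact h
      · intro h
        induction ω using Quotient.inductionOn with | h x => exact ⟨x, rfl, h⟩
    have eY : ∀ ω, (∃ x, Quotient.mk _ x = ω ∧ tY x = τ) ↔ qY ω = τ := by
      intro ω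
      constructor
      · rintro ⟨x, rfl, h⟩; exact h
      · intro h
        induction ω using Quotient.inductionOn with | h x => exact ⟨x, rfl, h⟩
    have hXs := hcard τ
    rcases isEmpty_or_nonempty {x // tX x = τ} with hE | ⟨⟨x₀, hx₀⟩⟩
    · rw [Nat.card_of_isEmpty, eq_comm, Finite.card_eq_zero_iff] at hXs
      have h1 : IsEmpty {ω // qX ω = τ} := ⟨fun ω => by
        obtain ⟨x, -, hx⟩ := (eX ω.1).2 ω.2
        exact hE.false ⟨x, hx⟩⟩
      have h2 : IsEmpty {ω // qY ω = τ} := ⟨fun ω => by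
        obtain ⟨x, -, hx⟩ := (eY ω.1).2 ω.2
        exact hXs.false ⟨x, hx⟩⟩
      exact ⟨Equiv.equivOfIsEmpty _ _⟩
    · have hidx : ∀ y, tY y = τ → (MulAction.orbit Γ y).ncard = (MulAction.orbit Γ x₀).ncard := by
        intro y hy
        obtain ⟨γ, hγ⟩ := hst x₀ y (hx₀.trans hy.symm)
        rw [← MulAction.index_stabilizer, ← MulAction.index_stabilizer, hγ,
          MulAction.index_stabilizer, MulAction.index_stabilizer, MulAction.orbit_smul]
      have hy₀ : ∃ y, tY y = τ := by
        have : 0 < Nat.card {x // tX x = τ} := Nat.card_pos_iff.2 ⟨⟨x₀, hx₀⟩, inferInstance⟩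
        rw [hXs] at this
        obtain ⟨⟨y, hy⟩⟩ := (Nat.card_pos_iff.1 this).1
        exact ⟨y, hy⟩
      obtain ⟨y₀, hy₀⟩ := hy₀
      have hidx' : ∀ x, tX x = τ → (MulAction.orbit Γ x).ncard = (MulAction.orbit Γ x₀).ncard := by
        intro x hx
        obtain ⟨γ, hγ⟩ := hst x y₀ (hx.trans hy₀.symm)
        rw [← MulAction.index_stabilizer, hγ, MulAction.index_stabilizer, MulAction.orbit_smul,
          hidx y₀ hy₀]
      have h1 := card_type_eq_mul_card_orbits htX τ _ hidx'
      have h2 := card_type_eq_mul_card_orbits htY τ _ hidx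
      rw [h1, h2] at hXs
      have hpos : 0 < (MulAction.orbit Γ x₀).ncard :=
        (Set.ncard_pos (Set.toFinite _)).2 ⟨x₀, MulAction.mem_orbit_self x₀⟩
      have h3 := Nat.eq_of_mul_eq_mul_left hpos hXs
      simp only [eX, eY] at h3
      exact ⟨(Finite.equivFinOfCardEq h3).trans (Finite.equivFin _).symm⟩
  have E : ∀ τ, {ω // qX ω = τ} ≃ {ω // qY ω = τ} := fun τ => (hq τ).some
  let φ : MulAction.orbitRel.Quotient Γ X ≃ MulAction.orbitRel.Quotient Γ Y :=
    Equiv.ofFiberEquiv (f := qX) (g := qY) E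
  have hφ : ∀ ω, qY (φ ω) = qX ω := Equiv.ofFiberEquiv_map E
  have hbase : ∀ ω : MulAction.orbitRel.Quotient Γ X, ∃ x : X, ∃ y : Y, Quotient.mk _ x = ω ∧
      Quotient.mk _ y = φ ω ∧ MulAction.stabilizer Γ x = MulAction.stabilizer Γ y := by
    intro ω
    obtain ⟨x, hx⟩ := Quotient.exists_rep ω
    obtain ⟨y, hy⟩ := Quotient.exists_rep (φ ω)
    have h := hφ ω
    rw [← hx, ← hy.trans (congrArg φ hx).symm] at h
    obtain ⟨γ, hγ⟩ := hst x y h.symm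
    refine ⟨x, γ • y, hx, ?_, hγ⟩
    rw [← hy]
    exact Quotient.sound (MulAction.orbitRel_apply.2 ⟨γ, rfl⟩)
  choose bX bY hbX hbY hb using hbase
  have hX : ∀ x : X, ∃ γ : Γ, γ • bX (Quotient.mk _ x) = x := fun x =>
    MulAction.orbitRel_apply.1 (Quotient.exact (hbX (Quotient.mk _ x)).symm)
  have hY : ∀ y : Y, ∃ γ : Γ, γ • bY (φ.symm (Quotient.mk _ y)) = y := fun y =>
    MulAction.orbitRel_apply.1 (Quotient.exact (by rw [hbY, φ.apply_symm_apply]))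
  choose γX hγX using hX
  have key : ∀ ω (γ δ : Γ), γ • bX ω = δ • bX ω ↔ γ • bY ω = δ • bY ω := by
    intro ω γ δ
    have := congrArg (fun K : Subgroup Γ => δ⁻¹ * γ ∈ K) (hb ω)
    simp only [MulAction.mem_stabilizer_iff, mul_smul, inv_smul_eq_iff, eq_iff_iff] at this
    exact this
  let e : X → Y := fun x => γX x • bY (Quotient.mk _ x)
  have he : ∀ (ω : MulAction.orbitRel.Quotient Γ X) (γ : Γ), e (γ • bX ω) = γ • bY ω := by
    intro ω γ
    have hω : (Quotient.mk _ (γ • bX ω) : MulAction.orbitRel.Quotient Γ X) = ω := by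
      exact (Quotient.sound (MulAction.orbitRel_apply.2 ⟨γ, rfl⟩)).trans (hbX ω)
    change γX (γ • bX ω) • bY (Quotient.mk _ (γ • bX ω)) = γ • bY ω
    have h := hγX (γ • bX ω)
    rw [hω] at h ⊢
    exact (key ω _ _).1 h
  have heq : ∀ (γ : Γ) x, e (γ • x) = γ • e x := by
    intro γ x
    rw [← hγX x, ← mul_smul, he, he, mul_smul]
  refine ⟨Equiv.ofBijective e ⟨?_, ?_⟩, heq⟩
  · intro x x' hxx
    have hω : ∀ x,
        (Quotient.mk _ (e x) : MulAction.orbitRel.Quotient Γ Y) = φ (Quotient.mk _ x) := by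
      intro x
      rw [← hbY]
      exact Quotient.sound (MulAction.orbitRel_apply.2 ⟨γX x, rfl⟩)
    have h1 : (Quotient.mk _ x : MulAction.orbitRel.Quotient Γ X) = Quotient.mk _ x' :=
      φ.injective (by rw [← hω, ← hω, hxx])
    have h2 : γX x • bY (Quotient.mk _ x) = γX x' • bY (Quotient.mk _ x') := hxx
    have h3 := hγX x
    rw [← h1, ← key, h3] at h2
    rw [h2, h1]
    exact hγX x'
  · intro y
    obtain ⟨γ, hγ⟩ := hY y
    exact ⟨γ • bX _, by rw [he, hγ]⟩

end EquivariantEquiv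

section Wreath

/-- The wreath product of `G` with the symmetric group on an arbitrary index type. -/
abbrev Wr (G ι : Type) [Group G] : Type := (ι → G) ⋊[mulAutArrow] Equiv.Perm ι

variable {G : Type} [Group G] {ι ι' : Type}

namespace Wr

theorem mul_left_apply (x y : Wr G ι) (i : ι) :
    (x * y).left i = x.left i * y.left (x.right⁻¹ i) := rfl

theorem mul_left_right (x y : Wr G ι) (i : ι) :
    (x * y).left ((x * y).right i) = x.left (x.right (y.right i)) * y.left (y.right i) := by
  rw [mul_left_apply, SemidirectProduct.mul_right, Equiv.Perm.mul_apply,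
    ← Equiv.Perm.mul_apply x.right⁻¹, inv_mul_cancel, Equiv.Perm.one_apply]

theorem pow_right (x : Wr G ι) (k : ℕ) : (x ^ k).right = x.right ^ k :=
  map_pow SemidirectProduct.rightHom x k

theorem zpow_right (x : Wr G ι) (k : ℤ) : (x ^ k).right = x.right ^ k :=
  map_zpow SemidirectProduct.rightHom x k

/-- The faithful action of the wreath product on `ι × G`. -/
def act (x : Wr G ι) (ω : ι × G) : ι × G := (x.right ω.1, x.left (x.right ω.1) * ω.2)

theorem act_mul (x y : Wr G ι) (ω : ι × G) : act (x * y) ω = act x (act y ω) := by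
  refine Prod.ext rfl ?_
  change (x * y).left ((x * y).right ω.1) * ω.2 = x.left _ * (y.left _ * ω.2)
  rw [mul_left_right, mul_assoc]
  rfl

theorem act_one (ω : ι × G) : act (1 : Wr G ι) ω = ω := by
  simp [act]

theorem act_injective {x y : Wr G ι} (h : ∀ i, act x (i, 1) = act y (i, 1)) : x = y := by
  have hr : x.right = y.right := Equiv.ext fun i => congrArg Prod.fst (h i)
  refine SemidirectProduct.ext (funext fun i => ?_) hr
  have := congrArg Prod.snd (h (x.right⁻¹ i))
  simpa [act, ← hr] using this

/-- The cycle length and cycle-product class of the cycle of `x` through `i`. -/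
noncomputable def typ (x : Wr G ι) (i : ι) : ℕ × ConjClasses G :=
  (Function.minimalPeriod x.right i,
    ConjClasses.mk ((x ^ Function.minimalPeriod x.right i).left i))

theorem pow_semiconj {x : Wr G ι} {y : Wr G ι'} {τ : ι → ι'} {c : ι → G}
    (h1 : ∀ i, τ (x.right i) = y.right (τ i))
    (h2 : ∀ i, c (x.right i) * x.left (x.right i) = y.left (y.right (τ i)) * c i) (k : ℕ) (i : ι) :
    τ ((x ^ k).right i) = (y ^ k).right (τ i) ∧
      c ((x ^ k).right i) * (x ^ k).left ((x ^ k).right i) =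
        (y ^ k).left ((y ^ k).right (τ i)) * c i := by
  induction k with
  | zero => simp
  | succ k ih =>
    obtain ⟨ih1, ih2⟩ := ih
    rw [pow_succ' x, pow_succ' y, mul_left_right, mul_left_right]
    simp only [SemidirectProduct.mul_right, Equiv.Perm.mul_apply]
    rw [h1, ih1]
    refine ⟨rfl, ?_⟩
    rw [← mul_assoc, h2, mul_assoc, ih2, ih1, mul_assoc]

theorem typ_semiconj {x : Wr G ι} {y : Wr G ι'} {τ : ι → ι'} {c : ι → G}
    (hτ : Function.Injective τ) (h1 : ∀ i, τ (x.right i) = y.right (τ i))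
    (h2 : ∀ i, c (x.right i) * x.left (x.right i) = y.left (y.right (τ i)) * c i) (i : ι) :
    typ y (τ i) = typ x i := by
  have hk := fun k => pow_semiconj h1 h2 k i
  have hp : Function.minimalPeriod y.right (τ i) = Function.minimalPeriod x.right i := by
    rw [Function.minimalPeriod_eq_minimalPeriod_iff]
    intro n
    have := (hk n).1
    rw [pow_right, pow_right] at this
    rw [Function.IsPeriodicPt, Function.IsPeriodicPt, Function.IsFixedPt, Function.IsFixedPt,
      Equiv.Perm.iterate_eq_pow, Equiv.Perm.iterate_eq_pow, ← this, hτ.eq_iff]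
  rw [typ, typ, hp]
  refine Prod.ext rfl ?_
  set j := Function.minimalPeriod x.right i with hj
  have hfix : (x ^ j).right i = i := by
    rw [pow_right, ← Equiv.Perm.iterate_eq_pow]
    exact Function.iterate_minimalPeriod
  obtain ⟨h3, h4⟩ := hk j
  rw [← h3, hfix] at h4
  refine (ConjClasses.mk_eq_mk_iff_isConj.2 (isConj_iff.2 ⟨c i, ?_⟩)).symm
  rw [h4, mul_inv_cancel_right]

theorem typ_conj (w x : Wr G ι) (i : ι) : typ (w * x * w⁻¹) (w.right i) = typ x i := by
  refine typ_semiconj (c := fun i => w.left (w.right i)) w.right.injective ?_ ?_ i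
  · intro i; simp
  · intro i
    have h : ∀ y : Wr G ι, y * w = w * x → w.left (w.right (x.right i)) * x.left (x.right i) =
        y.left (y.right (w.right i)) * w.left (w.right i) := by
      intro y hy
      rw [← mul_left_right, ← mul_left_right, hy]
    exact h _ (by group)

theorem typ_of_commute {w x : Wr G ι} (h : w * x = x * w) (i : ι) :
    typ x (w.right i) = typ x i := by
  conv_lhs => rw [show x = w * x * w⁻¹ by rw [h, mul_inv_cancel_right]]
  exact typ_conj w x i

theorem left_pow_of_fix {z : Wr G ι} {i : ι} (h : z.right i = i) (k : ℕ) :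
    (z ^ k).right i = i ∧ (z ^ k).left i = z.left i ^ k := by
  induction k with
  | zero => simp
  | succ k ih =>
    rw [pow_succ']
    refine ⟨by simp [ih.1, h], ?_⟩
    rw [mul_left_apply, Equiv.Perm.inv_eq_iff_eq.2 h.symm, ih.2, pow_succ']

theorem left_zpow_of_fix {z : Wr G ι} {i : ι} (h : z.right i = i) (k : ℤ) :
    (z ^ k).right i = i ∧ (z ^ k).left i = z.left i ^ k := by
  cases k with
  | ofNat n => simpa using left_pow_of_fix h n
  | negSucc n =>
    obtain ⟨h1, h2⟩ := left_pow_of_fix h (n + 1)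
    have h3 : ((z ^ (n + 1))⁻¹).right i = i := by
      rw [SemidirectProduct.inv_right, Equiv.Perm.inv_eq_iff_eq, h1]
    rw [zpow_negSucc, zpow_negSucc]
    refine ⟨h3, ?_⟩
    have h4 : (z ^ (n + 1) * (z ^ (n + 1))⁻¹).left i = 1 := by rw [mul_inv_cancel]; rfl
    rw [mul_left_apply, Equiv.Perm.inv_eq_iff_eq.2 h1.symm, h2] at h4
    exact (inv_eq_of_mul_eq_one_right h4).symm

theorem right_pow_minimalPeriod (x : Wr G ι) (i : ι) :
    (x ^ Function.minimalPeriod x.right i).right i = i := by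
  rw [pow_right, ← Equiv.Perm.iterate_eq_pow]
  exact Function.iterate_minimalPeriod

theorem zpow_fix_iff (x : Wr G ι) (i : ι) (k : ℤ) (Q : G) :
    ((x ^ k).right i = i ∧ (x ^ k).left i = Q) ↔
      ∃ m : ℤ, k = (typ x i).1 * m ∧ Q = ((x ^ (typ x i).1).left i) ^ m := by
  have hfix : (x ^ (typ x i).1).right i = i := right_pow_minimalPeriod x i
  have hk : ∀ m : ℤ, x ^ (((typ x i).1 : ℤ) * m) = (x ^ (typ x i).1) ^ m := by
    intro m; rw [zpow_mul, zpow_natCast]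
  constructor
  · rintro ⟨h1, h2⟩
    have hdvd : ((typ x i).1 : ℤ) ∣ k := by
      rw [zpow_right] at h1
      have := MulAction.zpow_smul_eq_iff_minimalPeriod_dvd (a := x.right) (b := i) (n := k)
      exact this.1 h1
    obtain ⟨m, rfl⟩ := hdvd
    refine ⟨m, rfl, ?_⟩
    rw [← h2, hk, (left_zpow_of_fix hfix m).2]
  · rintro ⟨m, rfl, rfl⟩
    rw [hk]
    exact left_zpow_of_fix hfix m

/-- The power map on conjugacy classes. -/
def powConj (k : ℕ) (c : ConjClasses G) : ConjClasses G :=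
  Quotient.map' (s₁ := IsConj.setoid G) (s₂ := IsConj.setoid G)
    (fun g => g ^ k) (fun _ _ h => IsConj.pow _ h) c

theorem powConj_mk (k : ℕ) (g : G) : powConj k (ConjClasses.mk g) = ConjClasses.mk (g ^ k) := rfl

/-- The effect of taking `P`-th powers on cycle types. -/
def powTyp (P : ℕ) (T : ℕ × ConjClasses G) : ℕ × ConjClasses G :=
  (T.1 / T.1.gcd P, powConj (P / T.1.gcd P) T.2)

theorem typ_pow [Finite ι] (x : Wr G ι) {P : ℕ} (i : ι) :
    typ (x ^ P) i = powTyp P (typ x i) := by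
  have hpos : 0 < Function.minimalPeriod x.right i :=
    Function.minimalPeriod_pos_of_mem_periodicPts
      (Function.Injective.mem_periodicPts x.right.injective i)
  have hper : Function.minimalPeriod (x ^ P).right i =
      Function.minimalPeriod x.right i / (Function.minimalPeriod x.right i).gcd P := by
    rw [pow_right, ← Equiv.Perm.iterate_eq_pow]
    exact Function.minimalPeriod_iterate_eq_div_gcd' ((Function.mk_mem_periodicPts hpos
      (Function.isPeriodicPt_minimalPeriod _ _)))
  rw [typ, hper, powTyp, typ]
  refine Prod.ext rfl (congrArg ConjClasses.mk ?_)
  set j := Function.minimalPeriod x.right i with hj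
  have hfix : (x ^ j).right i = i := right_pow_minimalPeriod x i
  change _ = (x ^ j).left i ^ _
  rw [← (left_pow_of_fix hfix _).2, ← pow_mul, ← pow_mul]
  rw [← Nat.mul_div_assoc _ (Nat.gcd_dvd_left j P), ← Nat.mul_div_assoc _ (Nat.gcd_dvd_right j P),
    mul_comm]

/-- The number of indices of a given type. -/
noncomputable def cnt (x : Wr G ι) (T : ℕ × ConjClasses G) : ℕ := Nat.card {i // typ x i = T}

theorem cnt_conj [Finite ι] {x y : Wr G ι} (h : IsConj x y) : cnt x = cnt y := by
  obtain ⟨w, rfl⟩ := isConj_iff.1 h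
  funext T
  refine Nat.card_congr (w.right.subtypeEquiv fun i => ?_)
  rw [typ_conj]

theorem dvd_cnt [Finite ι] (x : Wr G ι) (T : ℕ × ConjClasses G) : T.1 ∣ cnt x T := by
  refine ⟨_, card_type_eq_mul_card_orbits (Γ := Subgroup.zpowers x.right) (t := typ x) ?_ T T.1 ?_⟩
  · rintro ⟨_, k, rfl⟩ i
    change typ x ((x.right ^ k) i) = _
    rw [← zpow_right]
    exact typ_of_commute (by group) i
  · rintro i rfl
    have : Fintype (MulAction.orbit (Subgroup.zpowers x.right) i) := Fintype.ofFinite _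
    rw [← Nat.card_coe_set_eq, Nat.card_eq_fintype_card]
    exact (MulAction.minimalPeriod_eq_card x.right i).symm

/-- `ι × G` with the commuting actions of a wreath product element and of `G`. -/
@[ext]
structure CycleSet (x : Wr G ι) where
  /-- The index. -/
  idx : ι
  /-- The group label. -/
  val : G

/-- The underlying product type. -/
def CycleSet.equivProd (x : Wr G ι) : CycleSet x ≃ ι × G where
  toFun ω := (ω.idx, ω.val)
  invFun ω := ⟨ω.1, ω.2⟩

instance (x : Wr G ι) [Finite ι] [Finite G] : Finite (CycleSet x) :=
  Finite.of_equiv _ (CycleSet.equivProd x).symm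

instance (x : Wr G ι) : SMul (Multiplicative ℤ × G) (CycleSet x) where
  smul γ ω := ⟨(x ^ γ.1.toAdd).right ω.idx,
    (x ^ γ.1.toAdd).left ((x ^ γ.1.toAdd).right ω.idx) * ω.val * γ.2⁻¹⟩

theorem smul_cycleSet_eq (x : Wr G ι) (γ : Multiplicative ℤ × G) (ω : CycleSet x) :
    γ • ω = ⟨(x ^ γ.1.toAdd).right ω.idx,
      (x ^ γ.1.toAdd).left ((x ^ γ.1.toAdd).right ω.idx) * ω.val * γ.2⁻¹⟩ := rfl

instance (x : Wr G ι) : MulAction (Multiplicative ℤ × G) (CycleSet x) where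
  one_smul ω := by
    rw [smul_cycleSet_eq]
    simp
  mul_smul γ δ ω := by
    simp only [smul_cycleSet_eq, Prod.fst_mul, Prod.snd_mul, toAdd_mul, zpow_add, mul_left_right]
    simp [mul_assoc]

theorem smul_cycleSet_eq_iff (x : Wr G ι) (γ : Multiplicative ℤ × G) (ω : CycleSet x) :
    γ • ω = ω ↔ ∃ m : ℤ, γ.1.toAdd = (typ x ω.idx).1 * m ∧
      ((x ^ (typ x ω.idx).1).left ω.idx) ^ m * ω.val * γ.2⁻¹ = ω.val := by
  obtain ⟨i, h⟩ := ω
  obtain ⟨k, g⟩ := γ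
  rw [smul_cycleSet_eq, CycleSet.ext_iff]
  dsimp only
  have := zpow_fix_iff x i k.toAdd (h * g * h⁻¹)
  constructor
  · rintro ⟨h1, h2⟩
    rw [h1] at h2
    obtain ⟨m, hm, hQ⟩ := this.1 ⟨h1, by rw [eq_mul_inv_iff_mul_eq, ← mul_inv_eq_iff_eq_mul, h2]⟩
    exact ⟨m, hm, by rw [← hQ]; group⟩
  · rintro ⟨m, hm, hQ⟩
    obtain ⟨h1, h2⟩ := this.2 ⟨m, hm, by
      rw [mul_inv_eq_iff_eq_mul, ← mul_inv_eq_iff_eq_mul.1 hQ]⟩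
    refine ⟨h1, ?_⟩
    rw [h1, h2]; group

theorem isConj_of_cnt_eq [Finite ι] [Finite G] {x y : Wr G ι} (h : cnt x = cnt y) :
    IsConj x y := by
  have hinv : ∀ (z : Wr G ι) (γ : Multiplicative ℤ × G) (ω : CycleSet z),
      typ z (γ • ω).idx = typ z ω.idx := fun z γ ω =>
    typ_of_commute (w := z ^ γ.1.toAdd) (by group) ω.idx
  have hc : ∀ (z : Wr G ι) T,
      Nat.card {ω : CycleSet z // typ z ω.idx = T} = cnt z T * Nat.card G := by
    intro z T
    rw [cnt, ← Nat.card_prod]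
    exact Nat.card_congr
      { toFun := fun ω => (⟨ω.1.idx, ω.2⟩, ω.1.val)
        invFun := fun ω => ⟨⟨ω.1.1, ω.2⟩, ω.1.2⟩
        left_inv := fun _ => rfl
        right_inv := fun _ => rfl }
  obtain ⟨e, he⟩ := exists_equivariant_equiv (Γ := Multiplicative ℤ × G) (X := CycleSet x)
    (Y := CycleSet y) (tX := fun ω => typ x ω.idx) (tY := fun ω => typ y ω.idx) (hinv x) (hinv y)
    (by
      rintro ⟨i, g⟩ ⟨i', g'⟩ (ht : typ x i = typ y i')
      have h2 := congrArg Prod.snd ht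
      obtain ⟨u, hu⟩ := isConj_iff.1 (ConjClasses.mk_eq_mk_iff_isConj.1 h2)
      refine ⟨(Multiplicative.ofAdd 0, (u * g)⁻¹ * g'), Subgroup.ext ?_⟩
      intro γ
      have hz : ((Multiplicative.ofAdd 0, (u * g)⁻¹ * g') : Multiplicative ℤ × G) •
          (⟨i', g'⟩ : CycleSet y) = ⟨i', u * g⟩ := by
        rw [smul_cycleSet_eq]
        ext
        · simp
        · simp
      rw [hz, MulAction.mem_stabilizer_iff, MulAction.mem_stabilizer_iff, smul_cycleSet_eq_iff,
        smul_cycleSet_eq_iff]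
      refine exists_congr fun m => ?_
      dsimp only
      rw [← ht]
      refine and_congr_right fun _ => ?_
      have hu' : (y ^ (typ x i).1).left i' = u * (x ^ (typ x i).1).left i * u⁻¹ := by
        rw [ht]; exact (hu.trans rfl).symm.trans (by rw [← ht]; rfl)
      rw [hu', conj_zpow]
      constructor
      · intro h3
        calc u * (x ^ (typ x i).1).left i ^ m * u⁻¹ * (u * g) * γ.2⁻¹
          = u * ((x ^ (typ x i).1).left i ^ m * g * γ.2⁻¹) := by group
          _ = _ := by rw [h3]
      · intro h3
        refine mul_left_cancel (a := u) ?_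
        rw [← h3]; group)
    (by intro T; rw [hc, hc, h])
  have hG : ∀ i g, e ⟨i, g⟩ = ⟨(e ⟨i, 1⟩).idx, (e ⟨i, 1⟩).val * g⟩ := by
    intro i g
    have := he (Multiplicative.ofAdd 0, g⁻¹) ⟨i, 1⟩
    simpa [smul_cycleSet_eq] using this
  have hX : ∀ i g, e ⟨x.right i, x.left (x.right i) * g⟩ = ⟨y.right (e ⟨i, g⟩).idx,
      y.left (y.right (e ⟨i, g⟩).idx) * (e ⟨i, g⟩).val⟩ := by
    intro i g
    have := he (Multiplicative.ofAdd 1, 1) ⟨i, g⟩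
    simpa [smul_cycleSet_eq] using this
  have hinj : Function.Injective fun i : ι => (e ⟨i, 1⟩).idx := by
    intro i i' hii
    have : e ⟨i, 1⟩ = e ⟨i', (e ⟨i', 1⟩).val⁻¹ * (e ⟨i, 1⟩).val⟩ := by
      rw [hG i']
      exact CycleSet.ext hii (by simp)
    exact congrArg CycleSet.idx (e.injective this)
  let τ : Equiv.Perm ι := Equiv.ofBijective _ (Finite.injective_iff_bijective.1 hinj)
  let w : Wr G ι := ⟨fun i => (e ⟨τ.symm i, 1⟩).val, τ⟩
  have hτ : ∀ i, w.right i = (e ⟨i, 1⟩).idx := fun _ => rfl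
  have hw : ∀ i, w.left (w.right i) = (e ⟨i, 1⟩).val := fun i => by
    change (e ⟨τ.symm (τ i), 1⟩).val = _
    rw [Equiv.symm_apply_apply]
  have hwx : w * x = y * w := act_injective fun i => by
    have h1 := hX i 1
    rw [hG, CycleSet.ext_iff] at h1
    refine Prod.ext h1.1 ?_
    simp only [act, mul_left_right, hw, mul_one] at h1 ⊢
    exact h1.2
  exact isConj_iff.2 ⟨w, by rw [hwx, mul_inv_cancel_right]⟩

end Wr

end Wreath

section WreathData

variable {G : Type} [Group G] {ι ι' : Type}

/-- The weight of a multiset of labelled parts, given by its multiplicities. -/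
def wt {κ : Type} (f : ℕ × κ →₀ ℕ) : ℕ := f.sum fun T a => T.1 * a

namespace Wr

theorem isRationalGroup [Finite ι] [Finite G] (hG : IsRationalGroup G) :
    IsRationalGroup (Wr G ι) := by
  intro x j hj
  refine isConj_of_cnt_eq ?_
  have hcard : Nat.card (Wr G ι) = Nat.card G ^ Nat.card ι * Nat.card (Equiv.Perm ι) := by
    rw [Nat.card_congr SemidirectProduct.equivProd, Nat.card_prod, Nat.card_fun]
  funext T
  refine Nat.card_congr (Equiv.subtypeEquivRight fun i => ?_)
  rw [typ_pow]
  suffices h : powTyp j (typ x i) = typ x i by rw [h]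
  have h1 : (typ x i).1.gcd j = 1 := by
    refine Nat.Coprime.coprime_dvd_left ?_ hj.symm
    rw [hcard]
    refine Dvd.dvd.mul_left (dvd_trans ?_ (orderOf_dvd_natCard x.right)) _
    refine Function.IsPeriodicPt.minimalPeriod_dvd ?_
    rw [Function.IsPeriodicPt, Function.IsFixedPt, Equiv.Perm.iterate_eq_pow, pow_orderOf_eq_one]
    rfl
  rw [powTyp, h1]
  refine Prod.ext (Nat.div_one _) ?_
  dsimp only
  obtain ⟨g, hg⟩ := ConjClasses.mk_surjective (typ x i).2
  rw [← hg, powConj_mk, Nat.div_one]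
  refine ConjClasses.mk_eq_mk_iff_isConj.2 ?_
  refine hG g j (Nat.Coprime.coprime_dvd_right ?_ hj)
  rw [hcard]
  have : Nonempty ι := ⟨i⟩
  exact Dvd.dvd.mul_right (dvd_pow_self _ Nat.card_pos.ne') _

/-- Block sum of elements of wreath products. -/
def sumHom : Wr G ι × Wr G ι' →* Wr G (ι ⊕ ι') where
  toFun x := ⟨Sum.elim x.1.left x.2.left, Equiv.sumCongr x.1.right x.2.right⟩
  map_one' := by
    refine SemidirectProduct.ext (funext fun i => ?_) (Equiv.ext fun i => ?_) <;> cases i <;> rfl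
  map_mul' x y := by
    refine SemidirectProduct.ext (funext fun i => ?_) (Equiv.ext fun i => ?_) <;> cases i <;> rfl

theorem typ_sumHom_inl (x : Wr G ι × Wr G ι') (i : ι) : typ (sumHom x) (Sum.inl i) = typ x.1 i :=
  typ_semiconj (c := fun _ => 1) Sum.inl_injective (fun _ => rfl)
    (fun _ => by rw [one_mul, mul_one]; rfl) i

theorem typ_sumHom_inr (x : Wr G ι × Wr G ι') (i : ι') : typ (sumHom x) (Sum.inr i) = typ x.2 i :=
  typ_semiconj (c := fun _ => 1) Sum.inr_injective (fun _ => rfl)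
    (fun _ => by rw [one_mul, mul_one]; rfl) i

theorem cnt_sumHom [Finite ι] [Finite ι'] (x : Wr G ι × Wr G ι') :
    cnt (sumHom x) = cnt x.1 + cnt x.2 := by
  funext T
  rw [Pi.add_apply, cnt, Nat.card_congr Equiv.subtypeSum, Nat.card_sum]
  simp only [typ_sumHom_inl, typ_sumHom_inr]
  rfl

/-- Reindexing of wreath products. -/
def congrIndex (e : ι ≃ ι') : Wr G ι ≃* Wr G ι' where
  toFun x := ⟨fun i => x.left (e.symm i), e.permCongr x.right⟩
  invFun x := ⟨fun i => x.left (e i), e.symm.permCongr x.right⟩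
  left_inv x := by
    refine SemidirectProduct.ext (funext fun i => ?_) (Equiv.ext fun i => ?_) <;> simp
  right_inv x := by
    refine SemidirectProduct.ext (funext fun i => ?_) (Equiv.ext fun i => ?_) <;> simp
  map_mul' x y := by
    refine SemidirectProduct.ext (funext fun i => ?_) (Equiv.ext fun i => ?_)
    · change x.left _ * y.left _ = x.left _ * y.left _
      refine congrArg (fun a => x.left (e.symm i) * y.left a) ?_
      change x.right⁻¹ (e.symm i) = e.symm ((e.permCongr x.right)⁻¹ i)
      rw [eq_comm, e.symm_apply_eq, Equiv.Perm.inv_eq_iff_eq]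
      simp
    · simp

theorem cnt_congrIndex (e : ι ≃ ι') (x : Wr G ι) : cnt (congrIndex e x) = cnt x := by
  funext T
  refine (Nat.card_congr (e.subtypeEquiv fun i => ?_)).symm
  have : typ (congrIndex e x) (e i) = typ x i := by
    refine typ_semiconj (c := fun _ => 1) e.injective (fun i => ?_) (fun i => ?_) i
    · change _ = e.permCongr x.right (e i)
      simp
    · change _ = x.left (e.symm (e.permCongr x.right (e i))) * 1
      simp
  rw [this]

theorem exists_typ_eq (j : ℕ) (hj : 0 < j) (γ : G) :
    ∃ x : Wr G (Fin j), ∀ i, typ x i = (j, ConjClasses.mk γ) := by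
  obtain ⟨n, rfl⟩ : ∃ n, j = n + 1 := ⟨j - 1, by omega⟩
  let x : Wr G (Fin (n + 1)) := ⟨Pi.mulSingle 0 γ, finRotate (n + 1)⟩
  have hpow : ∀ k, ∀ hk : k < n + 1, (x ^ k).right 0 = ⟨k, hk⟩ ∧ (x ^ k).left ⟨k, hk⟩ = 1 := by
    intro k
    induction k with
    | zero => intro hk; exact ⟨rfl, rfl⟩
    | succ k ih =>
      intro hk
      obtain ⟨h1, h2⟩ := ih (by omega)
      have h3 : (x ^ (k + 1)).right 0 = ⟨k + 1, hk⟩ := by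
        rw [pow_succ', SemidirectProduct.mul_right, Equiv.Perm.mul_apply, h1]
        exact finRotate_of_lt (by omega)
      refine ⟨h3, ?_⟩
      rw [← h3, pow_succ', mul_left_right, h1, h2, mul_one]
      change Pi.mulSingle (M := fun _ => G) 0 γ (finRotate (n + 1) _) = 1
      rw [finRotate_of_lt (by omega)]
      exact Pi.mulSingle_eq_of_ne (by simp [Fin.ext_iff]) _
  obtain ⟨h1, h2⟩ := hpow n (by omega)
  have h3 : (x ^ (n + 1)).right 0 = 0 := by
    rw [pow_succ', SemidirectProduct.mul_right, Equiv.Perm.mul_apply, h1]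
    exact finRotate_last'
  have h4 : (x ^ (n + 1)).left 0 = γ := by
    conv_lhs => rw [← h3]
    rw [pow_succ', mul_left_right, h1, h2, mul_one]
    change Pi.mulSingle (M := fun _ => G) 0 γ (finRotate (n + 1) _) = γ
    rw [finRotate_last']
    exact Pi.mulSingle_eq_same _ _
  have h5 : Function.minimalPeriod x.right 0 = n + 1 := by
    have hper : Function.IsPeriodicPt x.right (n + 1) 0 := by
      rw [Function.IsPeriodicPt, Function.IsFixedPt, Equiv.Perm.iterate_eq_pow, ← pow_right, h3]
    refine le_antisymm (hper.minimalPeriod_le (by omega)) (not_lt.1 fun hlt => ?_)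
    have h6 := (hpow _ hlt).1
    rw [right_pow_minimalPeriod, Fin.ext_iff] at h6
    exact (hper.minimalPeriod_pos (by omega)).ne h6
  refine ⟨x, fun i => ?_⟩
  have h7 : typ x i = typ x 0 := by
    conv_lhs => rw [show i = (x ^ i.1).right 0 from (hpow i.1 i.2).1.symm]
    exact typ_of_commute (by group) 0
  rw [h7, typ, h5, h4]

theorem exists_cnt_eq (f : ℕ × ConjClasses G →₀ ℕ) (hf : ∀ c, f (0, c) = 0) :
    ∃ (ι : Type) (_ : Finite ι) (x : Wr G ι), ∀ T, cnt x T = T.1 * f T := by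
  induction f using Finsupp.induction_linear with
  | zero => exact ⟨Empty, inferInstance, 1, fun T => by simp [cnt]⟩
  | add f g ihf ihg =>
    have h0 : ∀ c, f (0, c) = 0 ∧ g (0, c) = 0 := fun c => by
      have := hf c
      rw [Finsupp.add_apply] at this
      omega
    obtain ⟨ι₁, _, x, hx⟩ := ihf fun c => (h0 c).1
    obtain ⟨ι₂, _, y, hy⟩ := ihg fun c => (h0 c).2
    refine ⟨ι₁ ⊕ ι₂, inferInstance, sumHom (x, y), fun T => ?_⟩
    rw [cnt_sumHom, Pi.add_apply, hx, hy, Finsupp.add_apply, mul_add]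
  | single T a =>
    obtain ⟨j, c⟩ := T
    rcases Nat.eq_zero_or_pos j with rfl | hj
    · have ha : a = 0 := by simpa using hf c
      subst ha
      exact ⟨Empty, inferInstance, 1, fun T => by simp [cnt]⟩
    · clear hf
      obtain ⟨γ, rfl⟩ := ConjClasses.mk_surjective c
      obtain ⟨z, hz⟩ := exists_typ_eq j hj γ
      induction a with
      | zero => exact ⟨Empty, inferInstance, 1, fun T => by simp [cnt]⟩
      | succ a ih =>
        obtain ⟨ι₁, _, x, hx⟩ := ih
        refine ⟨ι₁ ⊕ Fin j, inferInstance, sumHom (x, z), fun T => ?_⟩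
        rw [cnt_sumHom, Pi.add_apply, hx, Finsupp.single_add, Finsupp.add_apply, mul_add]
        congr 1
        simp only [cnt, hz]
        by_cases hT : (j, ConjClasses.mk γ) = T
        · subst hT
          simp
        · simp [hT]

/-- The number of cycles of each type. -/
noncomputable def cyc [Finite ι] (x : Wr G ι) : ℕ × ConjClasses G →₀ ℕ :=
  Finsupp.ofSupportFinite (fun T => cnt x T / T.1) <| by
    refine (Set.finite_range (typ x)).subset fun T hT => ?_
    by_contra h
    refine hT ?_
    have : cnt x T = 0 := by
      rw [cnt, Finite.card_eq_zero_iff]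
      exact ⟨fun i => h ⟨i.1, i.2⟩⟩
    simp [this]

theorem mul_cyc [Finite ι] (x : Wr G ι) (T) : T.1 * cyc x T = cnt x T :=
  Nat.mul_div_cancel' (dvd_cnt x T)

theorem cyc_zero [Finite ι] (x : Wr G ι) (c) : cyc x (0, c) = 0 := Nat.div_zero _

theorem cyc_eq_of_cnt [Finite ι] {x : Wr G ι} {f : ℕ × ConjClasses G →₀ ℕ}
    (hf : ∀ c, f (0, c) = 0) (h : ∀ T, cnt x T = T.1 * f T) : cyc x = f := by
  ext ⟨j, c⟩
  rcases Nat.eq_zero_or_pos j with rfl | hj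
  · rw [hf, cyc_zero]
  · exact Nat.eq_of_mul_eq_mul_left hj ((mul_cyc x (j, c)).trans (h _))

theorem cyc_eq_iff [Finite ι] [Finite G] {x y : Wr G ι} : cyc x = cyc y ↔ IsConj x y := by
  constructor
  · intro h
    refine isConj_of_cnt_eq (funext fun T => ?_)
    rw [← mul_cyc, ← mul_cyc, h]
  · intro h
    exact cyc_eq_of_cnt (cyc_zero y) fun T => by rw [mul_cyc, cnt_conj h]

theorem wt_cyc [Finite ι] (x : Wr G ι) : wt (cyc x) = Nat.card ι := by
  classical
  have := Fintype.ofFinite ι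
  rw [wt, Finsupp.sum, Nat.card_eq_fintype_card, ← Finset.card_univ,
    Finset.card_eq_sum_card_fiberwise (f := typ x) (t := (cyc x).support)]
  · refine Finset.sum_congr rfl fun T _ => ?_
    rw [mul_cyc, cnt, Nat.card_eq_fintype_card, Fintype.card_subtype]
  · intro i _
    rw [Finset.mem_coe, Finsupp.mem_support_iff]
    intro h
    have h1 := mul_cyc x (typ x i)
    rw [h, mul_zero, cnt, eq_comm, Finite.card_eq_zero_iff] at h1
    exact h1.false ⟨i, rfl⟩

theorem exists_cyc_eq [Finite ι] (f : ℕ × ConjClasses G →₀ ℕ) (hf : ∀ c, f (0, c) = 0)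
    (hw : wt f = Nat.card ι) : ∃ x : Wr G ι, cyc x = f := by
  obtain ⟨ι', _, x, hx⟩ := exists_cnt_eq f hf
  have h := cyc_eq_of_cnt hf hx
  have hc : Nat.card ι' = Nat.card ι := by rw [← wt_cyc x, h, hw]
  refine ⟨congrIndex ((Finite.equivFinOfCardEq hc).trans (Finite.equivFin ι).symm) x, ?_⟩
  refine cyc_eq_of_cnt hf fun T => ?_
  rw [cnt_congrIndex, hx]

theorem cyc_sumHom [Finite ι] [Finite ι'] (x : Wr G ι × Wr G ι') :
    cyc (sumHom x) = cyc x.1 + cyc x.2 :=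
  cyc_eq_of_cnt (fun c => by simp [cyc_zero]) fun T => by
    rw [cnt_sumHom, Pi.add_apply, Finsupp.add_apply, mul_add, mul_cyc, mul_cyc]

theorem cyc_congrIndex [Finite ι] [Finite ι'] (e : ι ≃ ι') (x : Wr G ι) :
    cyc (congrIndex e x) = cyc x :=
  cyc_eq_of_cnt (cyc_zero x) fun T => by rw [cnt_congrIndex, mul_cyc]

end Wr

end WreathData

section Parts

variable {κ : Type}

theorem wt_add (f g : ℕ × κ →₀ ℕ) : wt (f + g) = wt f + wt g := by
  classical
  exact Finsupp.sum_add_index' (fun _ => mul_zero _) fun _ _ _ => mul_add _ _ _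

theorem wt_single (T : ℕ × κ) (a : ℕ) : wt (Finsupp.single T a) = T.1 * a :=
  Finsupp.sum_single_index (mul_zero _)

theorem wt_sum {α : Type} (s : Finset α) (f : α → ℕ × κ →₀ ℕ) :
    wt (∑ i ∈ s, f i) = ∑ i ∈ s, wt (f i) := by
  classical
  induction s using Finset.induction_on with
  | empty => rfl
  | insert a s ha ih => rw [Finset.sum_insert ha, Finset.sum_insert ha, wt_add, ih]

theorem mul_le_wt (f : ℕ × κ →₀ ℕ) (T : ℕ × κ) : T.1 * f T ≤ wt f := by
  by_cases hT : T ∈ f.support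
  · exact Finset.single_le_sum (f := fun T => T.1 * f T) (fun _ _ => Nat.zero_le _) hT
  · rw [Finsupp.notMem_support_iff.1 hT, mul_zero]
    exact Nat.zero_le _

theorem mem_box_of_wt [Fintype κ] {f : ℕ × κ →₀ ℕ} {N : ℕ} (hf : ∀ c, f (0, c) = 0)
    (hw : wt f = N) :
    f.support ⊆ Finset.Icc 1 N ×ˢ Finset.univ ∧ ∀ T, f T ∈ Finset.range (N + 1) := by
  have h : ∀ T, f T ≠ 0 → 1 ≤ T.1 ∧ T.1 ≤ N ∧ f T ≤ N := by
    rintro ⟨j, c⟩ hT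
    have hj : 0 < j := Nat.pos_of_ne_zero fun h => hT (h ▸ hf c)
    have h1 := hw ▸ mul_le_wt f (j, c)
    exact ⟨hj, (Nat.le_mul_of_pos_right _ (Nat.pos_of_ne_zero hT)).trans h1,
      (Nat.le_mul_of_pos_left _ hj).trans h1⟩
  refine ⟨fun T hT => ?_, fun T => ?_⟩
  · obtain ⟨h1, h2, -⟩ := h T (Finsupp.mem_support_iff.1 hT)
    exact Finset.mem_product.2 ⟨Finset.mem_Icc.2 ⟨h1, h2⟩, Finset.mem_univ _⟩
  · rw [Finset.mem_range, Nat.lt_succ_iff]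
    by_cases hT : f T = 0
    · rw [hT]; exact Nat.zero_le _
    · exact (h T hT).2.2

open Classical in
/-- The multisets of labelled parts of total size `N`. -/
noncomputable def parts (κ : Type) [Fintype κ] (N : ℕ) : Finset (ℕ × κ →₀ ℕ) :=
  ((Finset.Icc 1 N ×ˢ Finset.univ).finsupp fun _ => Finset.range (N + 1)).filter
    fun f => (∀ c, f (0, c) = 0) ∧ wt f = N

theorem mem_parts [Fintype κ] {f : ℕ × κ →₀ ℕ} {N : ℕ} :
    f ∈ parts κ N ↔ (∀ c, f (0, c) = 0) ∧ wt f = N := by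
  classical
  rw [parts, Finset.mem_filter, and_iff_right_iff_imp]
  rintro ⟨hf, hw⟩
  obtain ⟨h1, h2⟩ := mem_box_of_wt hf hw
  exact Finset.mem_finsupp_iff.2 ⟨h1, fun T _ => h2 T⟩

end Parts

section Centralizer

variable {G : Type} [Group G] {ι ι' : Type}

namespace Wr

theorem sumHom_injective : Function.Injective (sumHom : Wr G ι × Wr G ι' →* Wr G (ι ⊕ ι')) := by
  rintro ⟨x, x'⟩ ⟨y, y'⟩ h
  have hl := congrArg SemidirectProduct.left h
  have hr := congrArg SemidirectProduct.right h
  refine Prod.ext (SemidirectProduct.ext ?_ ?_) (SemidirectProduct.ext ?_ ?_)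
  · exact funext fun i => congrFun hl (Sum.inl i)
  · exact Equiv.ext fun i => Sum.inl_injective (Equiv.ext_iff.1 hr (Sum.inl i))
  · exact funext fun i => congrFun hl (Sum.inr i)
  · exact Equiv.ext fun i => Sum.inr_injective (Equiv.ext_iff.1 hr (Sum.inr i))

theorem exists_eq_sumHom_of_fix [Finite ι] [Finite ι'] {u : Wr G (ι ⊕ ι')}
    (h : ∀ i, act u (Sum.inl i, 1) = (Sum.inl i, 1)) : ∃ ρ : Wr G ι', u = sumHom (1, ρ) := by
  have h1 : ∀ i, u.right (Sum.inl i) = Sum.inl i := fun i => congrArg Prod.fst (h i)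
  have h2 : ∀ i, u.left (Sum.inl i) = 1 := fun i => by
    have := congrArg Prod.snd (h i)
    simpa [act, h1] using this
  obtain ⟨⟨σ, τ⟩, hστ⟩ := Equiv.Perm.mem_sumCongrHom_range_of_perm_mapsTo_inl (σ := u.right)
    (by rintro _ ⟨i, rfl⟩; exact ⟨i, (h1 i).symm⟩)
  refine ⟨⟨fun i => u.left (Sum.inr i), τ⟩, SemidirectProduct.ext (funext fun i => ?_)
    (Equiv.ext fun i => ?_)⟩
  · cases i with
    | inl i => exact h2 i
    | inr i => rfl
  · cases i with
    | inl i => exact h1 i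
    | inr i => rw [← hστ]; rfl

theorem exists_pow_right_of_cnt_eq [Finite ι] (x : Wr G ι) (i j : ι) (h : typ x i = typ x j)
    (hc : cnt x (typ x i) = (typ x i).1) : ∃ k : ℕ, (x ^ k).right i = j := by
  classical
  have := Fintype.ofFinite ι
  let s : Finset ι := (Finset.range (typ x i).1).image fun k => (x ^ k).right i
  have hs : s.card = (typ x i).1 := by
    rw [Finset.card_image_of_injOn, Finset.card_range]
    intro a ha b hb hab
    simp only [pow_right, ← Equiv.Perm.iterate_eq_pow] at hab
    exact (Function.iterate_injOn_Iio_minimalPeriod (f := x.right) (x := i))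
      (Finset.mem_range.1 ha) (Finset.mem_range.1 hb) hab
  have hsub : s ⊆ Finset.univ.filter fun k => typ x k = typ x i := by
    intro k hk
    obtain ⟨m, -, rfl⟩ := Finset.mem_image.1 hk
    exact (Finset.mem_filter_univ _).2 (typ_of_commute (by group) i)
  have heq := Finset.eq_of_subset_of_card_le hsub (by
    rw [hs, ← hc, cnt, Nat.card_eq_fintype_card, Fintype.card_subtype])
  have hj : j ∈ s := by rw [heq]; exact (Finset.mem_filter_univ _).2 h.symm
  obtain ⟨m, -, hm⟩ := Finset.mem_image.1 hj
  exact ⟨m, hm⟩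

theorem act_pow_of_commute {u z : Wr G ι} (h : u * z = z * u) {ω : ι × G} (hω : act u ω = ω)
    (k : ℕ) : act u (act (z ^ k) ω) = act (z ^ k) ω := by
  have hk : u * z ^ k = z ^ k * u := (Commute.pow_right (show Commute u z from h) k)
  rw [← act_mul, hk, act_mul, hω]

theorem act_fix_one {u : Wr G ι} {i : ι} {g : G} (h : act u (i, g) = (i, g)) :
    act u (i, 1) = (i, 1) := by
  have h1 : u.right i = i := congrArg Prod.fst h
  have h2 : u.left (u.right i) * g = g := congrArg Prod.snd h
  refine Prod.ext h1 ?_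
  change u.left (u.right i) * 1 = 1
  rw [mul_one]
  exact mul_eq_right.1 h2

theorem typ_act_of_commute {w z : Wr G ι} (h : w * z = z * w) (ω : ι × G) :
    typ z (act w ω).1 = typ z ω.1 := typ_of_commute h ω.1

theorem conjCount_sumHom_le [Finite ι] [Finite ι'] [Finite G]
    [Fintype (Wr G (ι ⊕ ι'))] [DecidableEq (Wr G (ι ⊕ ι'))] [Fintype (Wr G ι')]
    [DecidableEq (Wr G ι')] (A : Finset ℕ) (c : Wr G ι)
    (hc : cyc c = ∑ t ∈ A, Finsupp.single (t, (1 : ConjClasses G)) 1) (ρ : Wr G ι') :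
    conjCount (sumHom (c, ρ)) (sumHom (c, ρ)) ≤
      (∏ t ∈ A, Nat.card G * (t * (cyc ρ (t, 1) + 1))) * conjCount ρ ρ := by
  classical
  have := Fintype.ofFinite ι
  have := Fintype.ofFinite ι'
  have := Fintype.ofFinite G
  set z := sumHom (c, ρ) with hz
  have hct : ∀ t ∈ A, cyc c (t, 1) = 1 := by
    intro t ht
    rw [hc, Finsupp.finsetSum_apply]
    simp [Finsupp.single_apply, ht]
  have h0 : ∀ t ∈ A, 0 < t := by
    intro t ht
    rcases Nat.eq_zero_or_pos t with rfl | h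
    · have := hct 0 ht
      rw [cyc_zero] at this
      omega
    · exact h
  have hcnt : ∀ t ∈ A, cnt c (t, 1) = t := fun t ht => by
    rw [← mul_cyc, hct t ht, mul_one]
  have hI : ∀ t : A, ∃ i, typ c i = (t.1, 1) := by
    intro t
    have h1 : 0 < cnt c (t.1, 1) := by rw [hcnt _ t.2]; exact h0 _ t.2
    obtain ⟨⟨i, hi⟩⟩ := (Nat.card_pos_iff.1 h1).1
    exact ⟨i, hi⟩
  choose I hI using hI
  let F : Wr G (ι ⊕ ι') → A → (ι ⊕ ι') × G := fun w t => act w (Sum.inl (I t), 1)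
  let S : Finset (Wr G (ι ⊕ ι')) := Finset.univ.filter fun w => w * z * w⁻¹ = z
  have hS : ∀ w, w ∈ S ↔ w * z = z * w := fun w => by
    rw [Finset.mem_filter_univ, mul_inv_eq_iff_eq_mul]
  have hcover : ∀ i : ι, ∃ t : A, ∃ k : ℕ, (c ^ k).right (I t) = i := by
    intro i
    have h1 : cyc c (typ c i) ≠ 0 := by
      intro h
      have h1 := mul_cyc c (typ c i)
      rw [h, mul_zero, cnt, eq_comm, Finite.card_eq_zero_iff] at h1
      exact h1.false ⟨i, rfl⟩
    rw [hc, Finsupp.finsetSum_apply] at h1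
    obtain ⟨t, ht, h2⟩ := Finset.exists_ne_zero_of_sum_ne_zero h1
    have h3 : (t, 1) = typ c i := by
      by_contra h
      exact h2 (Finsupp.single_eq_of_ne (Ne.symm h))
    refine ⟨⟨t, ht⟩, exists_pow_right_of_cnt_eq c _ _ ((hI ⟨t, ht⟩).trans h3) ?_⟩
    rw [hI ⟨t, ht⟩]
    exact hcnt t ht
  have hfix : ∀ u, u * z = z * u → (∀ t, act u (Sum.inl (I t), 1) = (Sum.inl (I t), 1)) →
      ∃ ρ' : Wr G ι', u = sumHom (1, ρ') ∧ ρ' * ρ * ρ'⁻¹ = ρ := by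
    intro u hu h
    obtain ⟨ρ', rfl⟩ := exists_eq_sumHom_of_fix (u := u) fun i => by
      obtain ⟨t, k, rfl⟩ := hcover i
      have h1 := act_pow_of_commute hu (h t) k
      have h2 : (act (z ^ k) (Sum.inl (I t), 1)).1 = Sum.inl ((c ^ k).right (I t)) := by
        rw [hz, ← map_pow]
        rfl
      exact act_fix_one (g := (act (z ^ k) (Sum.inl (I t), 1)).2) (by rw [← h2]; exact h1)
    refine ⟨ρ', rfl, ?_⟩
    rw [hz, ← map_mul, ← map_mul] at hu
    have := congrArg Prod.snd (sumHom_injective hu)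
    rw [mul_inv_eq_iff_eq_mul]
    exact this
  have hfib : ∀ a ∈ S.image F, (S.filter fun w => F w = a).card ≤ conjCount ρ ρ := by
    intro a ha
    obtain ⟨w₀, hw₀, rfl⟩ := Finset.mem_image.1 ha
    refine (Finset.card_le_card (t := (Finset.univ.filter fun ρ' : Wr G ι' =>
      ρ' * ρ * ρ'⁻¹ = ρ).image fun ρ' => w₀ * sumHom (1, ρ')) fun w hw => ?_).trans
      Finset.card_image_le
    obtain ⟨hw1, hw2⟩ := Finset.mem_filter.1 hw
    rw [hS] at hw1 hw₀
    obtain ⟨ρ', h1, h2⟩ := hfix (w₀⁻¹ * w) (by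
      have e1 : Commute w z := hw1
      have e2 : Commute w₀ z := hw₀
      exact (e2.inv_left.mul_left e1)) fun t => by
        rw [act_mul, show act w (Sum.inl (I t), 1) = act w₀ (Sum.inl (I t), 1) from
          congrFun hw2 t, ← act_mul, inv_mul_cancel, act_one]
    exact Finset.mem_image.2 ⟨ρ', (Finset.mem_filter_univ _).2 h2, by rw [← h1]; group⟩
  have htgt : (S.image F).card ≤ ∏ t ∈ A, Nat.card G * (t * (cyc ρ (t, 1) + 1)) := by
    refine (Finset.card_le_card (t := Fintype.piFinset fun t : A =>
      Finset.univ.filter fun ω : (ι ⊕ ι') × G => typ z ω.1 = (t.1, 1)) ?_).trans ?_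
    · intro a ha
      obtain ⟨w, hw, rfl⟩ := Finset.mem_image.1 ha
      refine Fintype.mem_piFinset.2 fun t => (Finset.mem_filter_univ _).2 ?_
      rw [typ_act_of_commute ((hS w).1 hw), hz, typ_sumHom_inl, hI]
    · rw [Fintype.card_piFinset, ← Finset.prod_coe_sort A]
      refine Finset.prod_le_prod' fun t _ => le_of_eq ?_
      have h1 : cnt z (t.1, 1) = t * (cyc ρ (t.1, 1) + 1) := by
        rw [hz, cnt_sumHom, Pi.add_apply, hcnt _ t.2, ← mul_cyc]
        ring
      rw [← h1, mul_comm, cnt, ← Nat.card_prod, ← Fintype.card_subtype, ← Nat.card_eq_fintype_card]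
      exact Nat.card_congr
        { toFun := fun ω => (⟨ω.1.1, ω.2⟩, ω.1.2)
          invFun := fun ω => ⟨(ω.1.1, ω.2), ω.1.2⟩
          left_inv := fun _ => rfl
          right_inv := fun _ => rfl }
  calc conjCount z z = S.card := rfl
    _ ≤ conjCount ρ ρ * (S.image F).card := Finset.card_le_mul_card_image S _ hfib
    _ ≤ _ := by rw [mul_comm]; exact Nat.mul_le_mul_right _ htgt

theorem sum_conjCount_self_mul [Fintype ι] [Fintype G] [Fintype (Wr G ι)] [DecidableEq (Wr G ι)]
    [Fintype (ConjClasses G)] (φ : (ℕ × ConjClasses G →₀ ℕ) → ℕ) :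
    ∑ ρ : Wr G ι, φ (cyc ρ) * conjCount ρ ρ =
      (∑ f ∈ parts (ConjClasses G) (Nat.card ι), φ f) * Nat.card (Wr G ι) := by
  classical
  rw [← Finset.sum_fiberwise_of_maps_to (g := cyc) (t := parts (ConjClasses G) (Nat.card ι))
    (fun ρ _ => mem_parts.2 ⟨cyc_zero ρ, wt_cyc ρ⟩), Finset.sum_mul]
  refine Finset.sum_congr rfl fun f hf => ?_
  obtain ⟨hf0, hfw⟩ := mem_parts.1 hf
  obtain ⟨ρ₀, rfl⟩ := exists_cyc_eq (ι := ι) f hf0 hfw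
  have h1 : ∀ ρ ∈ Finset.univ.filter (fun ρ : Wr G ι => cyc ρ = cyc ρ₀),
      φ (cyc ρ) * conjCount ρ ρ = φ (cyc ρ₀) * conjCount ρ ρ₀ := by
    intro ρ hρ
    have hρ := (Finset.mem_filter_univ _).1 hρ
    obtain ⟨w, hw⟩ := isConj_iff.1 (cyc_eq_iff.1 hρ)
    rw [hρ, ← hw, conjCount_conj]
  rw [Finset.sum_congr rfl h1, ← Finset.mul_sum]
  congr 1
  rw [Finset.sum_subset (Finset.filter_subset _ Finset.univ)]
  · simp only [conjCount, Finset.card_filter]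
    rw [Finset.sum_comm]
    have : ∀ t : Wr G ι, ∑ ρ, (if t * ρ * t⁻¹ = ρ₀ then 1 else 0) = 1 := by
      intro t
      rw [Finset.sum_eq_single (t⁻¹ * ρ₀ * t)]
      · rw [if_pos (by group)]
      · intro ρ _ hne
        rw [if_neg fun h => hne (by rw [← h]; group)]
      · simp
    simp [this]
  · intro ρ _ hρ
    rw [Finset.mem_filter_univ] at hρ
    refine Finset.card_eq_zero.2 (Finset.filter_eq_empty_iff.2 fun t _ ht => hρ ?_)
    exact cyc_eq_iff.2 (isConj_iff.2 ⟨t, ht⟩)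

end Wr

end Centralizer

section Interface

variable {G : Type} [Group G] {ι ι' : Type}

theorem conjCount_mulEquiv {H H' : Type} [Group H] [Group H'] [Fintype H] [DecidableEq H]
    [Fintype H'] [DecidableEq H'] (e : H ≃* H') (x y : H) :
    conjCount (e x) (e y) = conjCount x y := by
  refine (Finset.card_equiv e.toEquiv fun t => ?_).symm
  rw [Finset.mem_filter_univ, Finset.mem_filter_univ]
  change _ ↔ e t * e x * (e t)⁻¹ = e y
  rw [← map_inv, ← map_mul, ← map_mul, e.injective.eq_iff]

namespace Wr

theorem powConj_one (k : ℕ) : powConj k (1 : ConjClasses G) = 1 := by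
  change ConjClasses.mk ((1 : G) ^ k) = ConjClasses.mk 1
  rw [one_pow]

/-- The index counts of a `P`-th power in terms of the cycle counts. -/
noncomputable def pushPow (P : ℕ) (f : ℕ × ConjClasses G →₀ ℕ) : ℕ × ConjClasses G →₀ ℕ :=
  f.sum fun T a => Finsupp.single (powTyp P T) (T.1 * a)

theorem pushPow_add (P : ℕ) (f g : ℕ × ConjClasses G →₀ ℕ) :
    pushPow P (f + g) = pushPow P f + pushPow P g := by
  classical
  exact Finsupp.sum_add_index' (fun T => by simp) fun T a b => by
    rw [mul_add, Finsupp.single_add]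

theorem pushPow_single (P : ℕ) (T) (a : ℕ) :
    pushPow P (Finsupp.single T a) = Finsupp.single (powTyp (G := G) P T) (T.1 * a) :=
  Finsupp.sum_single_index (by simp)

theorem pushPow_sum {α : Type} (P : ℕ) (s : Finset α) (f : α → ℕ × ConjClasses G →₀ ℕ) :
    pushPow P (∑ i ∈ s, f i) = ∑ i ∈ s, pushPow P (f i) := by
  classical
  induction s using Finset.induction_on with
  | empty => rfl
  | insert a s ha ih => rw [Finset.sum_insert ha, Finset.sum_insert ha, pushPow_add, ih]

theorem cnt_pow [Finite ι] (x : Wr G ι) (P : ℕ) : cnt (x ^ P) = pushPow P (cyc x) := by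
  classical
  have := Fintype.ofFinite ι
  funext T
  rw [pushPow, Finsupp.sum_apply, Finsupp.sum, cnt, Nat.card_eq_fintype_card, Fintype.card_subtype,
    Finset.card_eq_sum_card_fiberwise (f := typ x) (t := (cyc x).support)]
  · refine Finset.sum_congr rfl fun T' _ => ?_
    rw [Finset.filter_filter, Finsupp.single_apply]
    split_ifs with h
    · rw [mul_cyc, cnt, Nat.card_eq_fintype_card, Fintype.card_subtype]
      congr 1
      refine Finset.filter_congr fun i _ => ?_
      rw [typ_pow, and_iff_right_iff_imp]
      rintro rfl
      exact h
    · refine Finset.card_eq_zero.2 (Finset.filter_eq_empty_iff.2 fun i _ hi => h ?_)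
      rw [← hi.1, ← hi.2, typ_pow]
  · intro i _
    rw [Finset.mem_coe, Finsupp.mem_support_iff]
    intro h
    have h1 := mul_cyc x (typ x i)
    rw [h, mul_zero, cnt, eq_comm, Finite.card_eq_zero_iff] at h1
    exact h1.false ⟨i, rfl⟩

/-- If the data of `x` agree, after taking a power of `p`, with data containing one cycle of
each length in `A`, then few characters are non-divisible by `p` at `x`. -/
theorem card_not_dvd_le [Finite ι] [Finite G] [Fintype (ConjClasses G)] (hG : IsRationalGroup G)
    {p : ℕ} [Fact p.Prime] {e : ℕ} (x : Wr G ι) (A : Finset ℕ) (hA : 0 ∉ A)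
    (f : ℕ × ConjClasses G →₀ ℕ) (hf : ∀ c, f (0, c) = 0) (hw : wt f + ∑ t ∈ A, t = Nat.card ι)
    (hpush : pushPow (p ^ e) (cyc x) =
      pushPow (p ^ e) (f + ∑ t ∈ A, Finsupp.single (t, (1 : ConjClasses G)) 1)) :
    Nat.card {χ : IrrChar (Wr G ι) // ¬ ∃ m : ℤ, χ.1 x = (p : ℂ) * m} ≤
      ∑ h ∈ parts (ConjClasses G) (Nat.card ι - ∑ t ∈ A, t),
        ∏ t ∈ A, Nat.card G * (t * (h (t, 1) + 1)) := by
  classical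
  have := Fintype.ofFinite ι
  have := Fintype.ofFinite G
  have : ∀ ι : Type, [Finite ι] → Finite (Wr G ι) := fun ι _ =>
    Finite.of_equiv _ SemidirectProduct.equivProd.symm
  have hA0 : ∀ c, (∑ t ∈ A, Finsupp.single (t, (1 : ConjClasses G)) 1) (0, c) = 0 := by
    intro c
    rw [Finsupp.finsetSum_apply]
    refine Finset.sum_eq_zero fun t ht => Finsupp.single_eq_of_ne ?_
    rintro h
    have h5 : 0 = t := congrArg Prod.fst h
    exact hA (h5 ▸ ht)
  have hAw : wt (∑ t ∈ A, Finsupp.single (t, (1 : ConjClasses G)) 1) = ∑ t ∈ A, t := by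
    rw [wt_sum]
    simp [wt_single]
  obtain ⟨c, hc⟩ := exists_cyc_eq (ι := Fin (∑ t ∈ A, t)) _ hA0 (by rw [hAw, Nat.card_fin])
  obtain ⟨ρ₀, hρ₀⟩ := exists_cyc_eq (ι := Fin (wt f)) f hf (by rw [Nat.card_fin])
  have hcard : Nat.card (Fin (∑ t ∈ A, t) ⊕ Fin (wt f)) = Nat.card ι := by
    rw [Nat.card_sum, Nat.card_fin, Nat.card_fin, ← hw, add_comm]
  let E : Wr G (Fin (∑ t ∈ A, t) ⊕ Fin (wt f)) ≃* Wr G ι :=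
    congrIndex ((Finite.equivFinOfCardEq hcard).trans (Finite.equivFin ι).symm)
  let j : Wr G (Fin (wt f)) →* Wr G ι :=
    E.toMonoidHom.comp (sumHom.comp (MonoidHom.inr _ _))
  let c' : Wr G ι := E (sumHom (c, 1))
  have := Fintype.ofFinite (Wr G ι)
  have := Fintype.ofFinite (Wr G (Fin (wt f)))
  have := Fintype.ofFinite (Wr G (Fin (∑ t ∈ A, t) ⊕ Fin (wt f)))
  have hH : IsRationalGroup (Wr G ι) := isRationalGroup hG
  have hz : ∀ ρ, c' * j ρ = E (sumHom (c, ρ)) := fun ρ => by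
    change E (sumHom (c, 1)) * E (sumHom (1, ρ)) = _
    rw [← map_mul, ← map_mul, Prod.mk_mul_mk, one_mul, mul_one]
  have hz' : ∀ ρ, j ρ * c' = E (sumHom (c, ρ)) := fun ρ => by
    change E (sumHom (1, ρ)) * E (sumHom (c, 1)) = _
    rw [← map_mul, ← map_mul, Prod.mk_mul_mk, one_mul, mul_one]
  have h1 := card_irrChar_ne_zero_mul_card_le hH j c' fun ρ => (hz ρ).trans (hz' ρ).symm
  have h2 : ∑ ρ, conjCount (c' * j ρ) (c' * j ρ) ≤
      (∑ h ∈ parts (ConjClasses G) (wt f), ∏ t ∈ A, Nat.card G * (t * (h (t, 1) + 1))) *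
        Nat.card (Wr G (Fin (wt f))) := by
    have h3 := sum_conjCount_self_mul (ι := Fin (wt f)) (G := G)
      fun h => ∏ t ∈ A, Nat.card G * (t * (h (t, 1) + 1))
    rw [Nat.card_fin] at h3
    rw [← h3]
    refine Finset.sum_le_sum fun ρ _ => ?_
    rw [hz, conjCount_mulEquiv]
    exact conjCount_sumHom_le A c hc ρ
  have h3 := Nat.le_of_mul_le_mul_right (h1.trans h2) Nat.card_pos
  have h4 : Nat.card ι - ∑ t ∈ A, t = wt f := by omega
  rw [h4]
  refine le_trans ?_ h3
  have hy : IsConj (x ^ p ^ e) ((c' * j ρ₀) ^ p ^ e) := by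
    refine isConj_of_cnt_eq ?_
    rw [cnt_pow, cnt_pow, hpush, hz]
    change _ = ⇑(pushPow _ (cyc (congrIndex _ _)))
    rw [cyc_congrIndex, cyc_sumHom, hc, hρ₀, add_comm]
  refine Nat.card_le_card_of_injective (fun χ => ⟨χ.1, ρ₀, ?_⟩) ?_
  · intro h0
    refine χ.2 ?_
    obtain ⟨⟨_, V, hV, rfl⟩, _⟩ := χ
    obtain ⟨a, ha⟩ := hH.exists_int_eq V x
    obtain ⟨m, hm⟩ := dvd_character_sub_of_isConj_pow (b := 0) V hy ha (by simpa using h0)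
    refine ⟨m, ?_⟩
    change V.character x = _
    rw [sub_zero] at hm
    rw [ha, hm]
    push_cast
    rfl
  · intro a b h
    simpa only [Subtype.mk.injEq, Subtype.val_inj] using h

/-- Conjugacy classes correspond to multisets of labelled parts. -/
theorem exists_equiv_parts [Finite ι] [Finite G] [Fintype (ConjClasses G)] :
    ∃ E : ConjClasses (Wr G ι) ≃ parts (ConjClasses G) (Nat.card ι),
      ∀ x : Wr G ι, (E (ConjClasses.mk x)).1 = cyc x := by
  let F : ConjClasses (Wr G ι) → parts (ConjClasses G) (Nat.card ι) := fun c =>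
    Quotient.lift (s := IsConj.setoid (Wr G ι))
      (fun x : Wr G ι => (⟨cyc x, mem_parts.2 ⟨cyc_zero x, wt_cyc x⟩⟩ :
        parts (ConjClasses G) (Nat.card ι)))
      (fun _ _ h => Subtype.ext (cyc_eq_iff.2 h)) c
  have hF : ∀ x : Wr G ι, (F (ConjClasses.mk x)).1 = cyc x := fun _ => rfl
  refine ⟨Equiv.ofBijective F ⟨?_, ?_⟩, hF⟩
  · intro a b hab
    obtain ⟨x, rfl⟩ := ConjClasses.mk_surjective a
    obtain ⟨y, rfl⟩ := ConjClasses.mk_surjective b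
    have := congrArg Subtype.val hab
    rw [hF, hF] at this
    exact ConjClasses.mk_eq_mk_iff_isConj.2 (cyc_eq_iff.1 this)
  · rintro ⟨f, hf⟩
    obtain ⟨hf0, hfw⟩ := mem_parts.1 hf
    obtain ⟨x, hx⟩ := exists_cyc_eq (ι := ι) f hf0 hfw
    exact ⟨ConjClasses.mk x, Subtype.ext hx⟩

end Wr

end Interface

section Configurations

variable {G : Type} [Group G] {ι : Type}

namespace Wr

theorem powTyp_prime_pow {p : ℕ} (hp : p.Prime) {a e m : ℕ} (hm : ¬ p ∣ m) (h : a ≤ e) :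
    powTyp (G := G) (p ^ e) (p ^ a * m, 1) = (m, 1) := by
  have h1 : (p ^ a * m).gcd (p ^ e) = p ^ a := by
    obtain ⟨d, rfl⟩ := Nat.exists_eq_add_of_le h
    rw [pow_add, Nat.gcd_mul_left, Nat.Coprime.gcd_eq_one, mul_one]
    exact ((hp.coprime_iff_not_dvd.2 hm).pow_left d).symm
  rw [powTyp, powConj_one]
  refine Prod.ext ?_ rfl
  dsimp only
  rw [h1, Nat.mul_div_cancel_left _ (pow_pos hp.pos a)]

theorem powTyp_prime_pow_mul {p : ℕ} (hp : p.Prime) {i b m : ℕ} (hm : 0 < m) (hi : i ≤ b) {e : ℕ}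
    (he : b + m ≤ e) :
    powTyp (G := G) (p ^ e) (p ^ i * m, 1) = powTyp (p ^ e) (p ^ b * m, 1) := by
  obtain ⟨a, m', hm', rfl⟩ := Nat.exists_eq_pow_mul_and_not_dvd hm.ne' p hp.ne_one
  have ha : a ≤ p ^ a * m' :=
    (Nat.lt_pow_self hp.one_lt).le.trans (Nat.le_mul_of_pos_right _ (Nat.pos_of_ne_zero fun h =>
      hm' (h ▸ dvd_zero p)))
  rw [← mul_assoc, ← mul_assoc, ← pow_add, ← pow_add, powTyp_prime_pow hp hm' (by omega),
    powTyp_prime_pow hp hm' (by omega)]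

/-- If the data of `x` contain, for each `m` in `S`, parts `p ^ i * m` which add up to
`p ^ b * m`, then few characters are non-divisible by `p` at `x`. -/
theorem card_not_dvd_le_of_config [Finite ι] [Finite G] [Fintype (ConjClasses G)]
    (hG : IsRationalGroup G) {p : ℕ} (hp : p.Prime) (x : Wr G ι) (S : Finset ℕ) {b n : ℕ}
    (hn : n ≤ b) (hS : 0 ∉ S) (hinj : Set.InjOn (fun q : ℕ × ℕ => p ^ q.2 * q.1)
      (S ×ˢ Finset.range n : Finset (ℕ × ℕ)))
    (u : ℕ → ℕ → ℕ) (hu : ∀ m ∈ S, ∀ i < n, u m i ≤ cyc x (p ^ i * m, 1))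
    (hsum : ∀ m ∈ S, ∑ i ∈ Finset.range n, p ^ i * u m i = p ^ b) :
    Nat.card {χ : IrrChar (Wr G ι) // ¬ ∃ m : ℤ, χ.1 x = (p : ℂ) * m} ≤
      ∑ h ∈ parts (ConjClasses G) (Nat.card ι - ∑ m ∈ S, p ^ b * m),
        ∏ m ∈ S, Nat.card G * (p ^ b * m * (h (p ^ b * m, 1) + 1)) := by
  classical
  have : Fact p.Prime := ⟨hp⟩
  have hpos : ∀ m ∈ S, 0 < m := fun m hm => Nat.pos_of_ne_zero fun h => hS (h ▸ hm)
  set g : ℕ × ConjClasses G →₀ ℕ :=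
    ∑ q ∈ S ×ˢ Finset.range n, Finsupp.single (p ^ q.2 * q.1, 1) (u q.1 q.2) with hg
  have hle : g ≤ cyc x := by
    intro T
    rw [hg, Finsupp.finsetSum_apply]
    by_cases hT : ∃ q ∈ S ×ˢ Finset.range n, ((p ^ q.2 * q.1, 1) : ℕ × ConjClasses G) = T
    · obtain ⟨q, hq, rfl⟩ := hT
      rw [Finset.sum_eq_single q]
      · rw [Finsupp.single_eq_same]
        obtain ⟨h1, h2⟩ := Finset.mem_product.1 hq
        exact hu _ h1 _ (Finset.mem_range.1 h2)
      · intro q' hq' hne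
        refine Finsupp.single_eq_of_ne fun h => hne ?_
        exact hinj hq' hq (congrArg Prod.fst h).symm
      · exact fun h => absurd hq h
    · rw [Finset.sum_eq_zero]
      · exact Nat.zero_le _
      · intro q hq
        exact Finsupp.single_eq_of_ne fun h => hT ⟨q, hq, h.symm⟩
  have hfg : (cyc x - g) + g = cyc x := tsub_add_cancel_of_le hle
  have hAinj : Set.InjOn (fun m => p ^ b * m) (S : Set ℕ) := fun a _ c _ h =>
    Nat.eq_of_mul_eq_mul_left (pow_pos hp.pos b) h
  have hgw : wt g = ∑ m ∈ S, p ^ b * m := by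
    rw [hg, wt_sum, Finset.sum_product]
    refine Finset.sum_congr rfl fun m hm => ?_
    rw [← hsum m hm, Finset.sum_mul]
    refine Finset.sum_congr rfl fun i _ => ?_
    rw [wt_single]
    ring
  have key := card_not_dvd_le hG (p := p) (e := b + ∑ m ∈ S, m) x (S.image fun m => p ^ b * m)
    (by
      intro h
      obtain ⟨m, hm, h0⟩ := Finset.mem_image.1 h
      exact (Nat.mul_pos (pow_pos hp.pos b) (hpos m hm)).ne' h0)
    (cyc x - g) (fun c => by rw [Finsupp.tsub_apply, cyc_zero, Nat.zero_sub])
    (by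
      rw [Finset.sum_image hAinj, ← hgw, ← wt_add, hfg, wt_cyc])
    (by
      conv_lhs => rw [← hfg]
      rw [pushPow_add, pushPow_add]
      congr 1
      rw [hg, pushPow_sum, pushPow_sum, Finset.sum_image hAinj, Finset.sum_product]
      refine Finset.sum_congr rfl fun m hm => ?_
      have he : b + m ≤ b + ∑ m ∈ S, m :=
        Nat.add_le_add_left (Finset.single_le_sum (f := fun m => m) (fun _ _ => Nat.zero_le _) hm) b
      have hm2 : p ^ b * m = ∑ i ∈ Finset.range n, p ^ i * m * u m i := by
        rw [← hsum m hm, Finset.sum_mul]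
        exact Finset.sum_congr rfl fun i _ => by ring
      rw [pushPow_single, mul_one]
      dsimp only
      conv_rhs => rw [hm2, Finsupp.single_finsetSum, ← hm2]
      refine Finset.sum_congr rfl fun i hi => ?_
      rw [pushPow_single, powTyp_prime_pow_mul hp (hpos m hm)
        ((Finset.mem_range.1 hi).le.trans hn) he])
  rw [Finset.sum_image hAinj] at key
  refine key.trans (le_of_eq (Finset.sum_congr rfl fun h _ => ?_))
  rw [Finset.prod_image hAinj]

end Wr

end Configurations

section Recursion

variable {κ : Type} [Fintype κ]

theorem card_parts_sub_le {n v l : ℕ} (c : κ) (hv : 0 < v) (h : v * l ≤ n) :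
    (parts κ (n - v * l)).card ≤ ((parts κ n).filter fun f => l ≤ f (v, c)).card := by
  classical
  refine Finset.card_le_card_of_injOn (fun f => f + Finsupp.single (v, c) l) ?_ ?_
  · intro f hf
    obtain ⟨hf0, hfw⟩ := mem_parts.1 (Finset.mem_coe.1 hf)
    refine Finset.mem_coe.2 (Finset.mem_filter.2 ⟨mem_parts.2 ⟨fun d => ?_, ?_⟩, ?_⟩)
    · rw [Finsupp.add_apply, hf0, Finsupp.single_eq_of_ne, add_zero]
      intro h
      have h0 : 0 = v := congrArg Prod.fst h
      omega
    · rw [wt_add, wt_single, hfw]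
      dsimp only
      omega
    · simp
  · exact fun a _ b _ hab => add_right_cancel hab

theorem sum_card_parts_le (n V Λ : ℕ) :
    Fintype.card κ * ∑ l ∈ Finset.Icc 1 Λ, ∑ v ∈ Finset.Icc 1 V,
      (if v * l < n then v * (parts κ (n - v * l)).card else 0) ≤ n * (parts κ n).card := by
  classical
  have h1 : ∀ f ∈ parts κ n, ∑ c : κ, ∑ v ∈ Finset.Icc 1 V, v * f (v, c) ≤ n := by
    intro f hf
    obtain ⟨hf0, hfw⟩ := mem_parts.1 hf
    rw [← Finset.sum_product']
    conv_rhs => rw [← hfw, wt, Finsupp.sum]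
    let e : κ × ℕ ≃ ℕ × κ := Equiv.prodComm κ ℕ
    refine (Finset.sum_map _ e.toEmbedding fun T => T.1 * f T).symm.le.trans ?_
    refine Finset.sum_le_sum_of_ne_zero fun T _ hT => ?_
    rw [Finsupp.mem_support_iff]
    rintro h
    exact hT (by rw [h, mul_zero])
  calc Fintype.card κ * ∑ l ∈ Finset.Icc 1 Λ, ∑ v ∈ Finset.Icc 1 V,
      (if v * l < n then v * (parts κ (n - v * l)).card else 0)
      = ∑ c : κ, ∑ l ∈ Finset.Icc 1 Λ, ∑ v ∈ Finset.Icc 1 V,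
        (if v * l < n then v * (parts κ (n - v * l)).card else 0) := by
        rw [Finset.sum_const, Finset.card_univ, smul_eq_mul]
    _ ≤ ∑ c : κ, ∑ l ∈ Finset.Icc 1 Λ, ∑ v ∈ Finset.Icc 1 V,
        v * ((parts κ n).filter fun f => l ≤ f (v, c)).card := by
        refine Finset.sum_le_sum fun c _ => Finset.sum_le_sum fun l _ =>
          Finset.sum_le_sum fun v hv => ?_
        split_ifs with h
        · exact Nat.mul_le_mul_left _ (card_parts_sub_le c (Finset.mem_Icc.1 hv).1 h.le)
        · exact Nat.zero_le _
    _ = ∑ f ∈ parts κ n, ∑ c : κ, ∑ v ∈ Finset.Icc 1 V,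
        v * ((Finset.Icc 1 Λ).filter fun l => l ≤ f (v, c)).card := by
        rw [Finset.sum_comm (s := parts κ n)]
        refine Finset.sum_congr rfl fun c _ => ?_
        rw [Finset.sum_comm, Finset.sum_comm (s := parts κ n)]
        refine Finset.sum_congr rfl fun v _ => ?_
        rw [← Finset.mul_sum, ← Finset.mul_sum]
        simp only [Finset.card_filter]
        rw [Finset.sum_comm]
    _ ≤ ∑ f ∈ parts κ n, n := by
        refine Finset.sum_le_sum fun f hf => le_trans ?_ (h1 f hf)
        refine Finset.sum_le_sum fun c _ => Finset.sum_le_sum fun v _ => Nat.mul_le_mul_left _ ?_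
        calc _ ≤ (Finset.Icc 1 (f (v, c))).card := Finset.card_le_card fun l hl => by
              simp only [Finset.mem_filter, Finset.mem_Icc] at hl ⊢
              omega
          _ = _ := by simp
    _ = n * (parts κ n).card := by rw [Finset.sum_const, smul_eq_mul, mul_comm]

theorem card_parts_pos [Nonempty κ] (n : ℕ) : 0 < (parts κ n).card := by
  classical
  obtain ⟨c⟩ := ‹Nonempty κ›
  refine Finset.card_pos.2 ⟨Finsupp.single (1, c) n, mem_parts.2 ⟨fun d => ?_, ?_⟩⟩
  · exact Finsupp.single_eq_of_ne fun h => absurd (congrArg Prod.fst h) (by simp)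
  · rw [wt_single, one_mul]

end Recursion

section GeometricMoments

/-- The `i`-th moment of the geometric sequence with ratio `r`. -/
noncomputable def geomMoment (i : ℕ) (r : ℝ) : ℝ := ∑' v : ℕ, (v : ℝ) ^ i * r ^ v

theorem summable_geomMoment (i : ℕ) {r : ℝ} (h0 : 0 ≤ r) (h1 : r < 1) :
    Summable fun v : ℕ => (v : ℝ) ^ i * r ^ v :=
  summable_pow_mul_geometric_of_norm_lt_one i (by rwa [Real.norm_of_nonneg h0])

theorem geomMoment_le (i : ℕ) {r : ℝ} (h0 : 0 ≤ r) (h1 : r < 1) :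
    geomMoment i r ≤ i.factorial / (1 - r) ^ (i + 1) := by
  have hs := hasSum_choose_mul_geometric_of_norm_lt_one i
    (r := r) (by rwa [Real.norm_of_nonneg h0])
  have h2 := hs.mul_left (i.factorial : ℝ)
  rw [mul_one_div] at h2
  refine hasSum_le (fun v => ?_) (summable_geomMoment i h0 h1).hasSum h2
  rw [← mul_assoc]
  refine mul_le_mul_of_nonneg_right ?_ (pow_nonneg h0 v)
  have h3 := Nat.pow_succ_le_ascFactorial (v + 1) i
  rw [Nat.ascFactorial_eq_factorial_mul_choose] at h3
  calc (v : ℝ) ^ i ≤ ((v + 1 : ℕ) : ℝ) ^ i := by gcongr; exact v.le_succ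
    _ ≤ _ := by exact_mod_cast h3

theorem le_geomMoment_two {r : ℝ} (h0 : 0 ≤ r) (h1 : r < 1) :
    r / (1 - r) ^ 3 ≤ geomMoment 2 r := by
  have hs := (hasSum_choose_mul_geometric_of_norm_lt_one 2
    (r := r) (by rwa [Real.norm_of_nonneg h0])).mul_left r
  rw [mul_one_div] at hs
  have hsum := summable_geomMoment 2 h0 h1
  rw [geomMoment, hsum.tsum_eq_zero_add]
  have h3 := ((summable_nat_add_iff 1).2 hsum).hasSum
  refine (hasSum_le (fun v => ?_) hs h3).trans (by simp)
  have h4 : ((v + 2).choose 2 : ℝ) ≤ ((v + 1 : ℕ) : ℝ) ^ 2 := by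
    have : (v + 2).choose 2 ≤ (v + 1) ^ 2 := by
      rw [Nat.choose_two_right]
      refine Nat.div_le_of_le_mul ?_
      have : v + 2 - 1 = v + 1 := rfl
      rw [this]
      nlinarith
    exact_mod_cast this
  calc r * (((v + 2).choose 2 : ℝ) * r ^ v) = ((v + 2).choose 2 : ℝ) * r ^ (v + 1) := by ring
    _ ≤ _ := mul_le_mul_of_nonneg_right h4 (pow_nonneg h0 _)

theorem geomMoment_one {r : ℝ} (h0 : 0 ≤ r) (h1 : r < 1) :
    geomMoment 1 r = r / (1 - r) ^ 2 := by
  simp only [geomMoment, pow_one]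
  exact tsum_coe_mul_geometric_of_norm_lt_one (by rwa [Real.norm_of_nonneg h0])

theorem sinh_le_mul_cosh {h : ℝ} (h0 : 0 ≤ h) : Real.sinh h ≤ h * Real.cosh h := by
  have hd : ∀ x, HasDerivAt (fun x => x * Real.cosh x - Real.sinh x) (x * Real.sinh x) x := by
    intro x
    have := ((hasDerivAt_id x).mul (Real.hasDerivAt_cosh x)).sub (Real.hasDerivAt_sinh x)
    convert! this using 1
    simp
  have hm : MonotoneOn (fun x => x * Real.cosh x - Real.sinh x) (Set.Ici 0) := by
    refine monotoneOn_of_deriv_nonneg (convex_Ici 0)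
      (fun x _ => (hd x).continuousAt.continuousWithinAt)
      (fun x _ => (hd x).differentiableAt.differentiableWithinAt) fun x hx => ?_
    rw [interior_Ici] at hx
    rw [(hd x).deriv]
    exact mul_nonneg hx.le (Real.sinh_nonneg_iff.2 hx.le)
  have := hm (Set.mem_Ici.2 le_rfl) (Set.mem_Ici.2 h0) h0
  simp only [Real.sinh_zero, zero_mul, sub_zero] at this
  linarith

theorem le_geomMoment_one_exp {y : ℝ} (hy : 0 < y) :
    1 / y ^ 2 - 1 / 4 ≤ geomMoment 1 (Real.exp (-y)) := by
  have h1 : Real.exp (-y) < 1 := Real.exp_lt_one_iff.2 (by linarith)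
  rw [geomMoment_one (Real.exp_nonneg _) h1]
  set h := y / 2 with hh
  have hy2 : y = 2 * h := by rw [hh]; ring
  have hpos : 0 < h := by positivity
  have hs : Real.sinh h ^ 2 ≤ h ^ 2 * Real.exp (h ^ 2) := by
    have h2 := sinh_le_mul_cosh hpos.le
    have h3 := Real.cosh_le_exp_half_sq h
    have h4 : 0 ≤ Real.sinh h := Real.sinh_nonneg_iff.2 hpos.le
    calc Real.sinh h ^ 2 ≤ (h * Real.exp (h ^ 2 / 2)) ^ 2 := by
          gcongr
          exact h2.trans (mul_le_mul_of_nonneg_left h3 hpos.le)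
      _ = _ := by rw [mul_pow, ← Real.exp_nat_mul]; congr 2; push_cast; ring
  have he : Real.exp (-y) / (1 - Real.exp (-y)) ^ 2 = 1 / (4 * Real.sinh h ^ 2) := by
    have e1 : Real.exp (-y) = Real.exp (-h) ^ 2 := by
      rw [← Real.exp_nat_mul, hy2]; congr 1; push_cast; ring
    have e2 : 1 - Real.exp (-h) ^ 2 = Real.exp (-h) * (2 * Real.sinh h) := by
      rw [Real.sinh_eq]
      have : Real.exp (-h) * Real.exp h = 1 := by rw [← Real.exp_add]; simp
      linear_combination -this
    have := Real.exp_pos (-h)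
    have := Real.sinh_pos_iff.2 hpos
    rw [e1, e2]
    field_simp
    norm_num
  rw [he]
  have hsp := Real.sinh_pos_iff.2 hpos
  have h5 : (1 - h ^ 2) * Real.exp (h ^ 2) ≤ 1 := by
    have := Real.add_one_le_exp (-h ^ 2)
    calc _ ≤ Real.exp (-h ^ 2) * Real.exp (h ^ 2) :=
          mul_le_mul_of_nonneg_right (by linarith) (Real.exp_nonneg _)
      _ = 1 := by rw [← Real.exp_add]; simp
  have e3 : 1 / y ^ 2 - 1 / 4 = (1 - h ^ 2) / (4 * h ^ 2) := by
    rw [hy2]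
    field_simp
    try ring
  rw [e3, div_le_div_iff₀ (by positivity) (by positivity)]
  rcases le_total (1 - h ^ 2) 0 with h6 | h6
  · nlinarith [mul_nonneg (neg_nonneg.2 h6) (sq_nonneg (Real.sinh h)), sq_nonneg h]
  · nlinarith [mul_le_mul_of_nonneg_left hs h6,
      mul_le_mul_of_nonneg_right h5 (sq_nonneg h)]

theorem one_sub_exp_neg_ge {y : ℝ} (hy : 0 < y) : y / (1 + y) ≤ 1 - Real.exp (-y) := by
  have h := Real.add_one_le_exp y
  have h2 : Real.exp (-y) ≤ 1 / (1 + y) := by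
    rw [Real.exp_neg, one_div]
    exact inv_anti₀ (by linarith) (by linarith)
  have : y / (1 + y) = 1 - 1 / (1 + y) := by field_simp; ring
  linarith

theorem geomMoment_exp_le (i : ℕ) {y : ℝ} (hy : 0 < y) (hy2 : y ≤ 2) :
    geomMoment i (Real.exp (-y)) ≤ (i.factorial * 3 ^ (i + 1) : ℝ) / y ^ (i + 1) := by
  have h1 : Real.exp (-y) < 1 := Real.exp_lt_one_iff.2 (by linarith)
  refine (geomMoment_le i (Real.exp_nonneg _) h1).trans ?_
  have h2 := one_sub_exp_neg_ge hy
  have h3 : y / 3 ≤ 1 - Real.exp (-y) := by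
    refine le_trans ?_ h2
    gcongr
    linarith
  calc _ ≤ (i.factorial : ℝ) / (y / 3) ^ (i + 1) := by gcongr
    _ = _ := by rw [div_pow]; field_simp

theorem le_geomMoment_two_exp {x : ℝ} (hx : 0 < x) (hx1 : x ≤ 1) :
    Real.exp (-1) / x ^ 3 ≤ geomMoment 2 (Real.exp (-x)) := by
  have h1 : Real.exp (-x) < 1 := Real.exp_lt_one_iff.2 (by linarith)
  refine le_trans ?_ (le_geomMoment_two (Real.exp_nonneg _) h1)
  have h2 := Real.add_one_le_exp (-x)
  have h4 : 0 < 1 - Real.exp (-x) := by linarith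
  gcongr
  linarith

theorem sum_inv_sq_le (n : ℕ) : ∑ l ∈ Finset.Icc 1 n, 1 / (l : ℝ) ^ 2 ≤ 2 := by
  refine (sum_le_hasSum _ (fun _ _ => by positivity) hasSum_zeta_two).trans ?_
  nlinarith [Real.pi_lt_d2, Real.pi_pos]

theorem le_sum_inv_sq {n : ℕ} (hn : n ≠ 0) :
    Real.pi ^ 2 / 6 - 1 / n ≤ ∑ l ∈ Finset.Icc 1 n, 1 / (l : ℝ) ^ 2 := by
  rw [sub_le_iff_le_add]
  refine le_of_tendsto (hasSum_zeta_two.tendsto_sum_nat.comp (tendsto_add_atTop_nat 1)) ?_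
  filter_upwards [eventually_ge_atTop n] with m hm
  have h1 := sum_Ioc_inv_sq_le_sub (α := ℝ) hn hm
  have h2 : ∑ i ∈ Finset.range (m + 1), 1 / (i : ℝ) ^ 2 =
      ∑ l ∈ Finset.Icc 1 n, 1 / (l : ℝ) ^ 2 + ∑ l ∈ Finset.Ioc n m, 1 / (l : ℝ) ^ 2 := by
    rw [Finset.range_eq_Ico, Finset.sum_eq_sum_Ico_succ_bot (Nat.succ_pos m)]
    have e1 : Finset.Icc 1 n = Finset.Ico 1 (n + 1) := by
      ext; simp only [Finset.mem_Icc, Finset.mem_Ico]; omega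
    have e2 : Finset.Ioc n m = Finset.Ico (n + 1) (m + 1) := by
      ext; simp only [Finset.mem_Ico, Finset.mem_Ioc]; omega
    rw [e1, e2, Finset.sum_Ico_consecutive _ (by omega) (by omega)]
    simp
  simp only [Function.comp_apply, h2]
  simp only [one_div] at h1 ⊢
  have : (0 : ℝ) ≤ (m : ℝ)⁻¹ := by positivity
  linarith

end GeometricMoments

section Kernel

/-- A lower bound for the ratio of two values of the comparison function, with `c = β ^ 2`. -/
noncomputable def ratioKernel (A : ℕ) (c x j : ℝ) : ℝ :=
  Real.exp (-(j * x)) * (1 + A * (x ^ 2 / c) * j) * (1 - x ^ 3 / c * j ^ 2)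

theorem hasSum_ratioKernel (A : ℕ) (c : ℝ) {x : ℝ} (hx : 0 < x) {l : ℕ} (hl : 0 < l) :
    HasSum (fun v : ℕ => (v : ℝ) * ratioKernel A c x (v * l))
      (geomMoment 1 (Real.exp (-(l * x))) +
        A * (x ^ 2 / c) * l * geomMoment 2 (Real.exp (-(l * x))) -
        x ^ 3 / c * l ^ 2 * geomMoment 3 (Real.exp (-(l * x))) -
        A * (x ^ 5 / c ^ 2) * l ^ 3 * geomMoment 4 (Real.exp (-(l * x)))) := by
  have hl' : (0 : ℝ) < l := Nat.cast_pos.2 hl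
  have h1 : Real.exp (-(l * x)) < 1 := Real.exp_lt_one_iff.2 (by nlinarith)
  have hs := fun i => (summable_geomMoment i (Real.exp_nonneg (-(l * x))) h1).hasSum
  have := (((hs 1).add ((hs 2).mul_left (A * (x ^ 2 / c) * l))).sub
    ((hs 3).mul_left (x ^ 3 / c * l ^ 2))).sub ((hs 4).mul_left (A * (x ^ 5 / c ^ 2) * l ^ 3))
  convert! this using 1
  funext v
  have e : Real.exp (-(v * l * x)) = Real.exp (-(l * x)) ^ v := by
    rw [← Real.exp_nat_mul]; congr 1; ring
  rw [ratioKernel, e]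
  ring

theorem exists_le_sum_ratioKernel {c : ℝ} (hc : 0 < c) : ∃ A : ℕ, ∃ x₀ : ℝ, 0 < x₀ ∧
    ∀ x : ℝ, 0 < x → x ≤ x₀ → ∃ Λ : ℕ,
      Real.pi ^ 2 / 6 / x ^ 2 ≤
        ∑ l ∈ Finset.Icc 1 Λ, ∑' v : ℕ, (v : ℝ) * ratioKernel A c x (v * l) := by
  obtain ⟨A, hA⟩ := exists_nat_ge (9 * c + 5832)
  refine ⟨A, min 1 (c / (6 * 11664)), by positivity, fun x hx hx0 => ⟨⌈1 / x⌉₊, ?_⟩⟩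
  have hx1 : x ≤ 1 := hx0.trans (min_le_left _ _)
  have hx2 : x ≤ c / (6 * 11664) := hx0.trans (min_le_right _ _)
  set Λ := ⌈1 / x⌉₊ with hΛ
  have hΛ1 : 1 / x ≤ Λ := Nat.le_ceil _
  have hΛ2 : (Λ : ℝ) ≤ 1 / x + 1 := (Nat.ceil_lt_add_one (by positivity)).le
  have hΛ0 : 0 < Λ := Nat.ceil_pos.2 (by positivity)
  have hΛx : (Λ : ℝ) * x ≤ 2 := by
    calc (Λ : ℝ) * x ≤ (1 / x + 1) * x := by gcongr
      _ = 1 + x := by field_simp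
      _ ≤ 2 := by linarith
  have hlx : ∀ l ∈ Finset.Icc 1 Λ, 0 < (l : ℝ) * x ∧ (l : ℝ) * x ≤ 2 := by
    intro l hl
    obtain ⟨h1, h2⟩ := Finset.mem_Icc.1 hl
    have : (l : ℝ) ≤ Λ := Nat.cast_le.2 h2
    have : (0 : ℝ) < l := Nat.cast_pos.2 h1
    exact ⟨by positivity, (mul_le_mul_of_nonneg_right (by assumption) hx.le).trans hΛx⟩
  have hsum : ∑ l ∈ Finset.Icc 1 Λ, ∑' v : ℕ, (v : ℝ) * ratioKernel A c x (v * l) =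
      ∑ l ∈ Finset.Icc 1 Λ, geomMoment 1 (Real.exp (-(l * x))) +
      ∑ l ∈ Finset.Icc 1 Λ, A * (x ^ 2 / c) * l * geomMoment 2 (Real.exp (-(l * x))) -
      ∑ l ∈ Finset.Icc 1 Λ, x ^ 3 / c * l ^ 2 * geomMoment 3 (Real.exp (-(l * x))) -
      ∑ l ∈ Finset.Icc 1 Λ, A * (x ^ 5 / c ^ 2) * l ^ 3 * geomMoment 4 (Real.exp (-(l * x))) := by
    rw [← Finset.sum_add_distrib, ← Finset.sum_sub_distrib, ← Finset.sum_sub_distrib]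
    exact Finset.sum_congr rfl fun l hl =>
      (hasSum_ratioKernel A c hx (Finset.mem_Icc.1 hl).1).tsum_eq
  have h1 : Real.pi ^ 2 / 6 / x ^ 2 - 3 / 2 / x ≤
      ∑ l ∈ Finset.Icc 1 Λ, geomMoment 1 (Real.exp (-(l * x))) := by
    calc Real.pi ^ 2 / 6 / x ^ 2 - 3 / 2 / x
        ≤ (Real.pi ^ 2 / 6 - 1 / Λ) / x ^ 2 - Λ / 4 := by
          have e1 : 1 / (Λ : ℝ) ≤ x := by
            rw [one_div_le (by exact_mod_cast hΛ0) hx]; exact hΛ1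
          have e2 : 1 / (Λ : ℝ) / x ^ 2 ≤ 1 / x := by
            calc 1 / (Λ : ℝ) / x ^ 2 ≤ x / x ^ 2 := by gcongr
              _ = 1 / x := by field_simp
          have e3 : (Λ : ℝ) ≤ 2 / x := by rw [le_div_iff₀ hx]; exact hΛx
          rw [sub_div]
          have e4 : 3 / 2 / x = 1 / x + 2 / x / 4 := by field_simp; norm_num
          linarith
      _ ≤ (∑ l ∈ Finset.Icc 1 Λ, 1 / (l : ℝ) ^ 2) / x ^ 2 - Λ / 4 := by
          gcongr
          exact le_sum_inv_sq hΛ0.ne'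
      _ = ∑ l ∈ Finset.Icc 1 Λ, (1 / (l * x) ^ 2 - 1 / 4) := by
          rw [Finset.sum_sub_distrib, Finset.sum_div, Finset.sum_const, Nat.card_Icc]
          congr 1
          · exact Finset.sum_congr rfl fun l _ => by rw [mul_pow, div_div]
          · simp [div_eq_mul_inv]
      _ ≤ _ := Finset.sum_le_sum fun l hl => le_geomMoment_one_exp (hlx l hl).1
  have h2 : A / (3 * c * x) ≤
      ∑ l ∈ Finset.Icc 1 Λ, A * (x ^ 2 / c) * l * geomMoment 2 (Real.exp (-(l * x))) := by
    have hnn : ∀ l ∈ Finset.Icc 1 Λ,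
        0 ≤ A * (x ^ 2 / c) * l * geomMoment 2 (Real.exp (-(l * x))) := fun l _ =>
      mul_nonneg (by positivity) (tsum_nonneg fun v => by positivity)
    refine le_trans ?_ (Finset.single_le_sum hnn (Finset.mem_Icc.2 ⟨le_rfl, hΛ0⟩))
    have e1 := le_geomMoment_two_exp hx hx1
    have e2 : (1 : ℝ) / 3 ≤ Real.exp (-1) := by
      rw [Real.exp_neg, one_div]
      exact inv_anti₀ (Real.exp_pos _) (by linarith [Real.exp_one_lt_d9])
    have e3 : 1 / 3 / x ^ 3 ≤ geomMoment 2 (Real.exp (-x)) := le_trans (by gcongr) e1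
    rw [Nat.cast_one, one_mul, mul_one]
    calc A / (3 * c * x) = A * (x ^ 2 / c) * (1 / 3 / x ^ 3) := by field_simp
      _ ≤ _ := mul_le_mul_of_nonneg_left e3 (by positivity)
  have h3 : ∑ l ∈ Finset.Icc 1 Λ, x ^ 3 / c * l ^ 2 * geomMoment 3 (Real.exp (-(l * x))) ≤
      972 / (c * x) := by
    calc _ ≤ ∑ l ∈ Finset.Icc 1 Λ, 486 / (c * x) * (1 / (l : ℝ) ^ 2) := by
          refine Finset.sum_le_sum fun l hl => ?_
          have e := geomMoment_exp_le 3 (hlx l hl).1 (hlx l hl).2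
          have hl0 : (0 : ℝ) < l := Nat.cast_pos.2 (Finset.mem_Icc.1 hl).1
          refine (mul_le_mul_of_nonneg_left e (by positivity)).trans (le_of_eq ?_)
          simp only [Nat.factorial]
          field_simp
          ring
      _ ≤ 486 / (c * x) * 2 := by
          rw [← Finset.mul_sum]
          exact mul_le_mul_of_nonneg_left (sum_inv_sq_le Λ) (by positivity)
      _ = _ := by ring
  have h4 : ∑ l ∈ Finset.Icc 1 Λ, A * (x ^ 5 / c ^ 2) * l ^ 3 *
      geomMoment 4 (Real.exp (-(l * x))) ≤ 11664 * A / c ^ 2 := by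
    calc _ ≤ ∑ l ∈ Finset.Icc 1 Λ, 5832 * A / c ^ 2 * (1 / (l : ℝ) ^ 2) := by
          refine Finset.sum_le_sum fun l hl => ?_
          have e := geomMoment_exp_le 4 (hlx l hl).1 (hlx l hl).2
          have hl0 : (0 : ℝ) < l := Nat.cast_pos.2 (Finset.mem_Icc.1 hl).1
          refine (mul_le_mul_of_nonneg_left e (by positivity)).trans (le_of_eq ?_)
          simp only [Nat.factorial]
          field_simp
          ring
      _ ≤ 5832 * A / c ^ 2 * 2 := by
          rw [← Finset.mul_sum]
          exact mul_le_mul_of_nonneg_left (sum_inv_sq_le Λ) (by positivity)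
      _ = _ := by ring
  have h5 : 11664 * A / c ^ 2 ≤ A / (6 * c * x) := by
    rw [div_le_div_iff₀ (by positivity) (by positivity)]
    have e1 : x * (6 * 11664) ≤ c := by rwa [le_div_iff₀ (by norm_num)] at hx2
    have e2 : (0 : ℝ) ≤ A * c := by positivity
    nlinarith
  have h6 : 3 / 2 / x + 972 / (c * x) ≤ A / (6 * c * x) := by
    have : A / (6 * c * x) = A / 6 * (1 / (c * x)) := by field_simp
    rw [this]
    calc 3 / 2 / x + 972 / (c * x) = (9 * c + 5832) / 6 * (1 / (c * x)) := by field_simp; ring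
      _ ≤ _ := by gcongr
  have h7 : (A : ℝ) / (3 * c * x) = A / (6 * c * x) + A / (6 * c * x) := by field_simp; ring
  rw [hsum]
  linarith

end Kernel

section LowerBound

theorem ratioKernel_nonpos {A : ℕ} {c n j : ℝ} (hc : 1 ≤ c) (hn : 1 ≤ n) (hj : n ≤ j) :
    ratioKernel A c (√c / √n) j ≤ 0 := by
  have hc0 : 0 < c := by linarith
  have hn0 : 0 < n := by linarith
  have hx : (√c / √n) ^ 3 / c * n ^ 2 = √c * √n := by
    have h1 : √c ^ 2 = c := Real.sq_sqrt hc0.le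
    have h2 : √n ^ 2 = n := Real.sq_sqrt hn0.le
    have h3 : 0 < √c := Real.sqrt_pos.2 hc0
    have h4 : 0 < √n := Real.sqrt_pos.2 hn0
    generalize √c = a at *
    generalize √n = b at *
    subst h1 h2
    field_simp
  have h1 : 1 ≤ (√c / √n) ^ 3 / c * j ^ 2 := by
    calc (1 : ℝ) = 1 * 1 := (mul_one 1).symm
      _ ≤ √c * √n := by
        gcongr
        · exact Real.one_le_sqrt.2 hc
        · exact Real.one_le_sqrt.2 hn
      _ = (√c / √n) ^ 3 / c * n ^ 2 := hx.symm
      _ ≤ _ := by gcongr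
  have hj0 : 0 < j := by linarith
  exact mul_nonpos_of_nonneg_of_nonpos (by positivity) (by linarith)

theorem ratioKernel_mul_le {A : ℕ} {c n j : ℝ} (hc : 1 ≤ c) (hj : 0 ≤ j) (hjn : j < n) :
    ratioKernel A c (√c / √n) j * (Real.exp (2 * √c * √n) / n ^ A) ≤
      Real.exp (2 * √c * √(n - j)) / (n - j) ^ A := by
  have hc0 : 0 < c := by linarith
  have hn0 : 0 < n := by linarith
  obtain ⟨y, hy⟩ : ∃ y, y = j / n := ⟨_, rfl⟩
  have hjy : j = y * n := by rw [hy]; field_simp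
  have hy0 : 0 ≤ y := by rw [hy]; positivity
  have hy1 : y < 1 := by rw [hy, div_lt_one hn0]; exact hjn
  set b := √c with hb
  set s := √n with hs
  have hb2 : b ^ 2 = c := Real.sq_sqrt hc0.le
  have hs2 : s ^ 2 = n := Real.sq_sqrt hn0.le
  have hb0 : 0 < b := Real.sqrt_pos.2 hc0
  have hs0 : 0 < s := Real.sqrt_pos.2 hn0
  have hK : ratioKernel A c (b / s) j =
      Real.exp (-(b * s * y)) * (1 + A * y) * (1 - b * s * y ^ 2) := by
    rw [ratioKernel, hjy, ← hb2, ← hs2]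
    congr 1
    · congr 1
      · congr 1; field_simp
      · field_simp
    · field_simp
  have hsq : s * (1 - y / 2 - y ^ 2 / 2) ≤ √(n - j) := by
    refine Real.le_sqrt_of_sq_le ?_
    rw [hjy, mul_pow, hs2]
    have : (1 - y / 2 - y ^ 2 / 2) ^ 2 ≤ 1 - y := by
      have : (1 - y / 2 - y ^ 2 / 2) ^ 2 = (1 - y) * (1 - (3 * y ^ 2 / 4 + y ^ 3 / 4)) := by ring
      rw [this]
      exact mul_le_of_le_one_right (by linarith) (by linarith [pow_nonneg hy0 2, pow_nonneg hy0 3])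
    nlinarith
  have hnj : n - j = n * (1 - y) := by rw [hjy]; ring
  have h1y : 0 < 1 - y := by linarith
  have hA : (1 + A * y) * (1 - y) ^ A ≤ 1 := by
    have h1 := one_add_mul_le_pow (a := y) (by linarith) A
    calc (1 + A * y) * (1 - y) ^ A ≤ (1 + y) ^ A * (1 - y) ^ A := by gcongr
      _ = (1 - y ^ 2) ^ A := by rw [← mul_pow]; congr 1; ring
      _ ≤ 1 := pow_le_one₀ (by nlinarith) (by nlinarith)
  have hE : 1 - b * s * y ^ 2 ≤ Real.exp (-(b * s * y ^ 2)) := by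
    linarith [Real.add_one_le_exp (-(b * s * y ^ 2))]
  have hexp : Real.exp (2 * b * s) * Real.exp (-(b * s * y)) * Real.exp (-(b * s * y ^ 2)) ≤
      Real.exp (2 * b * √(n - j)) := by
    rw [← Real.exp_add, ← Real.exp_add, Real.exp_le_exp]
    nlinarith [mul_le_mul_of_nonneg_left hsq hb0.le]
  rw [hK, le_div_iff₀ (by rw [hnj]; positivity)]
  have e1 : Real.exp (-(b * s * y)) * (1 + A * y) * (1 - b * s * y ^ 2) *
      (Real.exp (2 * b * s) / n ^ A) * (n - j) ^ A =
      Real.exp (2 * b * s) * Real.exp (-(b * s * y)) * (1 - b * s * y ^ 2) *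
        ((1 + A * y) * (1 - y) ^ A) := by
    rw [hnj, mul_pow]
    field_simp
  rw [e1]
  refine le_trans ?_ hexp
  have e2 : Real.exp (2 * b * s) * Real.exp (-(b * s * y)) * (1 - b * s * y ^ 2) ≤
      Real.exp (2 * b * s) * Real.exp (-(b * s * y)) * Real.exp (-(b * s * y ^ 2)) := by gcongr
  calc _ ≤ Real.exp (2 * b * s) * Real.exp (-(b * s * y)) * Real.exp (-(b * s * y ^ 2)) *
        ((1 + A * y) * (1 - y) ^ A) := mul_le_mul_of_nonneg_right e2 (by positivity)
    _ ≤ _ := mul_le_of_le_one_right (by positivity) hA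

/-- The growth constant `β ^ 2` for `k` kinds of parts. -/
noncomputable def growthSq (k : ℕ) : ℝ := k * (Real.pi ^ 2 / 6)

theorem one_le_growthSq {k : ℕ} (hk : 0 < k) : 1 ≤ growthSq k := by
  have h1 : (1 : ℝ) ≤ k := by exact_mod_cast hk
  have h2 : 1 ≤ Real.pi ^ 2 / 6 := by nlinarith [Real.pi_gt_three]
  rw [growthSq]
  nlinarith

theorem exists_le_card_parts (κ : Type) [Fintype κ] [Nonempty κ] :
    ∃ (δ : ℝ) (A : ℕ), 0 < δ ∧ ∀ n : ℕ, 0 < n →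
      δ * (Real.exp (2 * √(growthSq (Fintype.card κ)) * √n) / (n : ℝ) ^ A) ≤
        (parts κ n).card := by
  set c := growthSq (Fintype.card κ) with hc
  have hc1 : 1 ≤ c := one_le_growthSq Fintype.card_pos
  have hc0 : 0 < c := by linarith
  obtain ⟨A, x₀, hx0, hA⟩ := exists_le_sum_ratioKernel hc0
  obtain ⟨n₀, hn₀⟩ := exists_nat_ge (c / x₀ ^ 2)
  refine ⟨Real.exp (-(2 * √c * √n₀)), A, Real.exp_pos _, fun n => ?_⟩
  set δ := Real.exp (-(2 * √c * √n₀)) with hδ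
  induction n using Nat.strong_induction_on with
  | _ n ih =>
  intro hn
  have hn1 : (1 : ℝ) ≤ n := by exact_mod_cast hn
  rcases lt_or_ge n n₀ with hlt | hge
  · have h1 : (1 : ℝ) ≤ (parts κ n).card := by exact_mod_cast card_parts_pos n
    refine le_trans ?_ h1
    calc δ * (Real.exp (2 * √c * √n) / (n : ℝ) ^ A) ≤ δ * Real.exp (2 * √c * √n) := by
          gcongr
          exact div_le_self (Real.exp_nonneg _) (one_le_pow₀ hn1)
      _ ≤ δ * Real.exp (2 * √c * √n₀) := by gcongr
      _ = 1 := by rw [hδ, ← Real.exp_add]; simp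
  · set x := √c / √n with hx
    have hsc : 0 < √c := Real.sqrt_pos.2 hc0
    have hsn : 0 < √(n : ℝ) := Real.sqrt_pos.2 (by linarith)
    have hxpos : 0 < x := by positivity
    have hx2 : x ^ 2 = c / n := by
      rw [hx, div_pow, Real.sq_sqrt hc0.le, Real.sq_sqrt (by linarith)]
    have hxx0 : x ≤ x₀ := by
      refine le_of_sq_le_sq ?_ hx0.le
      rw [hx2, div_le_iff₀ (by linarith)]
      rw [div_le_iff₀ (by positivity)] at hn₀
      have : (n₀ : ℝ) ≤ n := by exact_mod_cast hge
      nlinarith [sq_nonneg x₀]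
    obtain ⟨Λ, hΛ⟩ := hA x hxpos hxx0
    set φ := δ * (Real.exp (2 * √c * √n) / (n : ℝ) ^ A) with hφ
    have hφ0 : 0 ≤ φ := by positivity
    have hterm : ∀ l v : ℕ, 0 < l → 0 < v → (v : ℝ) * ratioKernel A c x (v * l) * φ ≤
        ((if v * l < n then v * (parts κ (n - v * l)).card else 0 : ℕ) : ℝ) := by
      intro l v hl hv
      split_ifs with h
      · have h1 := ih (n - v * l) (Nat.sub_lt hn (Nat.mul_pos hv hl)) (Nat.sub_pos_of_lt h)
        have h2 := ratioKernel_mul_le (A := A) (n := n) (j := v * l) hc1 (by positivity)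
          (by exact_mod_cast h)
        rw [Nat.cast_sub h.le, Nat.cast_mul] at h1
        rw [Nat.cast_mul, mul_assoc]
        refine mul_le_mul_of_nonneg_left ?_ (Nat.cast_nonneg v)
        refine le_trans ?_ h1
        rw [hφ, mul_left_comm]
        exact mul_le_mul_of_nonneg_left h2 (Real.exp_nonneg _)
      · have h1 := ratioKernel_nonpos (A := A) (n := n) (j := v * l) hc1 hn1
          (by exact_mod_cast not_lt.1 h)
        rw [Nat.cast_zero, mul_assoc]
        exact mul_nonpos_of_nonneg_of_nonpos (Nat.cast_nonneg v)
          (mul_nonpos_of_nonpos_of_nonneg h1 hφ0)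
    have hlim : Tendsto (fun V : ℕ => (Fintype.card κ : ℝ) * ((∑ l ∈ Finset.Icc 1 Λ,
        ∑ v ∈ Finset.range V, (v : ℝ) * ratioKernel A c x (v * l)) * φ)) atTop
        (nhds ((Fintype.card κ : ℝ) * ((∑ l ∈ Finset.Icc 1 Λ, ∑' v : ℕ,
          (v : ℝ) * ratioKernel A c x (v * l)) * φ))) := by
      refine ((tendsto_finsetSum _ fun l hl => ?_).mul_const φ).const_mul _
      exact (hasSum_ratioKernel A c hxpos
        (Finset.mem_Icc.1 hl).1).summable.hasSum.tendsto_sum_nat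
    have hbound : (Fintype.card κ : ℝ) * ((∑ l ∈ Finset.Icc 1 Λ, ∑' v : ℕ,
        (v : ℝ) * ratioKernel A c x (v * l)) * φ) ≤ n * (parts κ n).card := by
      refine le_of_tendsto (hlim.comp (tendsto_add_atTop_nat 1)) (Eventually.of_forall fun V => ?_)
      have h1 : (Fintype.card κ : ℝ) * ((∑ l ∈ Finset.Icc 1 Λ,
          ∑ v ∈ Finset.Icc 1 V, (v : ℝ) * ratioKernel A c x (v * l)) * φ) ≤
          ((n * (parts κ n).card : ℕ) : ℝ) := by
        refine le_trans ?_ (Nat.cast_le.2 (sum_card_parts_le (κ := κ) n V Λ))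
        rw [Nat.cast_mul, Nat.cast_sum, Finset.sum_mul]
        refine mul_le_mul_of_nonneg_left (Finset.sum_le_sum fun l hl => ?_) (Nat.cast_nonneg _)
        rw [Nat.cast_sum, Finset.sum_mul]
        exact Finset.sum_le_sum fun v hv =>
          hterm l v (Finset.mem_Icc.1 hl).1 (Finset.mem_Icc.1 hv).1
      rw [Nat.cast_mul] at h1
      refine le_trans (le_of_eq ?_) h1
      simp only [Function.comp_apply]
      congr 2
      refine Finset.sum_congr rfl fun l _ => ?_
      rw [Finset.range_eq_Ico, Finset.sum_eq_sum_Ico_succ_bot (Nat.succ_pos V)]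
      simp only [Nat.cast_zero, zero_mul, zero_add]
      rfl
    have hmain : (n : ℝ) * φ ≤ n * (parts κ n).card := by
      refine le_trans ?_ hbound
      have h1 : (n : ℝ) = Fintype.card κ * (Real.pi ^ 2 / 6 / x ^ 2) := by
        have hk : (0 : ℝ) < Fintype.card κ := by exact_mod_cast Fintype.card_pos (α := κ)
        rw [hx2, hc, growthSq]
        have := Real.pi_pos
        field_simp
      conv_lhs => rw [h1]
      rw [mul_assoc]
      gcongr
    exact le_of_mul_le_mul_left hmain (by linarith)

end LowerBound

section Boltzmann

theorem sum_pow_exp_le {y : ℝ} (hy : 0 < y) (N : ℕ) :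
    ∑ j ∈ Finset.Icc 1 N, Real.exp (-y) ^ j ≤ 1 / y := by
  set r := Real.exp (-y) with hr
  have h0 : 0 < r := Real.exp_pos _
  have h1 : r < 1 := Real.exp_lt_one_iff.2 (by linarith)
  have h2 : ∀ N, (∑ j ∈ Finset.Icc 1 N, r ^ j) * (1 - r) = r - r ^ (N + 1) := by
    intro N
    induction N with
    | zero => simp
    | succ N ih =>
      rw [Finset.sum_Icc_succ_top (by omega), add_mul, ih]
      ring
  have h3 : y * r ≤ 1 - r := by
    have := Real.add_one_le_exp y
    have h4 : (y + 1) * r ≤ Real.exp y * r := mul_le_mul_of_nonneg_right this h0.le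
    rw [hr, ← Real.exp_add, add_neg_cancel, Real.exp_zero, ← hr] at h4
    linarith
  rw [le_div_iff₀ hy]
  have h5 : 0 < 1 - r := by linarith
  refine le_of_mul_le_mul_right ?_ h5
  calc (∑ j ∈ Finset.Icc 1 N, r ^ j) * y * (1 - r)
      = (∑ j ∈ Finset.Icc 1 N, r ^ j) * (1 - r) * y := by ring
    _ ≤ r * y := by
        rw [h2]
        have := pow_pos h0 (N + 1)
        gcongr
        linarith
    _ ≤ _ := by linarith

theorem prod_inv_one_sub_pow_le {x : ℝ} (hx : 0 < x) (N : ℕ) :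
    ∏ j ∈ Finset.Icc 1 N, (1 - Real.exp (-x) ^ j)⁻¹ ≤ Real.exp (Real.pi ^ 2 / 6 / x) := by
  set q := Real.exp (-x) with hq
  have h0 : 0 < q := Real.exp_pos _
  have h1 : q < 1 := Real.exp_lt_one_iff.2 (by linarith)
  have hlt : ∀ j ∈ Finset.Icc 1 N, q ^ j < 1 := fun j hj =>
    pow_lt_one₀ h0.le h1 (by have := (Finset.mem_Icc.1 hj).1; omega)
  have hs : HasSum (fun n : ℕ => ∑ j ∈ Finset.Icc 1 N, (q ^ j) ^ (n + 1) / ((n : ℝ) + 1))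
      (∑ j ∈ Finset.Icc 1 N, -Real.log (1 - q ^ j)) :=
    hasSum_sum fun j hj => Real.hasSum_pow_div_log_of_abs_lt_one
      (by rw [abs_of_pos (pow_pos h0 j)]; exact hlt j hj)
  have hz : HasSum (fun n : ℕ => 1 / ((n + 1 : ℕ) : ℝ) ^ 2 / x) (Real.pi ^ 2 / 6 / x) := by
    have := (hasSum_nat_add_iff' 1).2 hasSum_zeta_two
    simp only [Finset.sum_range_one, Nat.cast_zero] at this
    norm_num only at this
    simpa using this.div_const x
  have hle := hasSum_le (fun n => ?_) hs hz
  · rw [← Real.log_le_iff_le_exp (Finset.prod_pos fun j hj => inv_pos.2 (by linarith [hlt j hj])),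
      Real.log_prod fun j hj => (inv_pos.2 (by linarith [hlt j hj])).ne']
    simpa only [Real.log_inv] using hle
  · have hn : (0 : ℝ) < (n : ℝ) + 1 := by positivity
    have h3 := sum_pow_exp_le (y := (n + 1) * x) (by positivity) N
    have h4 : ∀ j, Real.exp (-((n + 1) * x)) ^ j = (q ^ j) ^ (n + 1) := by
      intro j
      rw [hq, ← Real.exp_nat_mul, ← Real.exp_nat_mul, ← Real.exp_nat_mul]
      congr 1
      push_cast
      ring
    simp only [h4] at h3
    rw [← Finset.sum_div]
    push_cast
    calc _ ≤ 1 / (((n : ℝ) + 1) * x) / (n + 1) := by gcongr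
      _ = _ := by field_simp

variable {κ : Type} [Fintype κ]

/-- The truncated partition function of the Boltzmann weights `q ^ wt`. -/
noncomputable def boltzmann (κ : Type) [Fintype κ] (N : ℕ) (q : ℝ) : ℝ :=
  ∏ T ∈ Finset.Icc 1 N ×ˢ (Finset.univ : Finset κ), (1 - q ^ T.1)⁻¹

theorem boltzmann_nonneg {N : ℕ} {q : ℝ} (h0 : 0 ≤ q) (h1 : q < 1) : 0 ≤ boltzmann κ N q :=
  Finset.prod_nonneg fun _ _ => inv_nonneg.2 (sub_nonneg.2 (pow_le_one₀ h0 h1.le))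

theorem boltzmann_le {x : ℝ} (hx : 0 < x) (N : ℕ) :
    boltzmann κ N (Real.exp (-x)) ≤ Real.exp (growthSq (Fintype.card κ) / x) := by
  have h1 : Real.exp (-x) < 1 := Real.exp_lt_one_iff.2 (by linarith)
  rw [boltzmann, Finset.prod_product]
  simp only [Finset.prod_const, Finset.card_univ]
  rw [Finset.prod_pow]
  calc _ ≤ Real.exp (Real.pi ^ 2 / 6 / x) ^ Fintype.card κ := by
        refine pow_le_pow_left₀ (Finset.prod_nonneg fun j _ => ?_) (prod_inv_one_sub_pow_le hx N) _
        exact inv_nonneg.2 (sub_nonneg.2 (pow_le_one₀ (Real.exp_nonneg _) h1.le))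
    _ = _ := by rw [← Real.exp_nat_mul, growthSq]; congr 1; ring

/-- The saddle point for partitions of `N` into parts of `k` kinds. -/
noncomputable def saddle (k N : ℕ) : ℝ := √(growthSq k) / √N

theorem saddle_pos {k N : ℕ} (hk : 0 < k) (hN : 0 < N) : 0 < saddle k N :=
  div_pos (Real.sqrt_pos.2 (by linarith [one_le_growthSq hk])) (Real.sqrt_pos.2 (by positivity))

theorem exists_boltzmann_le (κ : Type) [Fintype κ] [Nonempty κ] :
    ∃ (C : ℝ) (A : ℕ), 0 < C ∧ ∀ N : ℕ, 0 < N →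
      boltzmann κ N (Real.exp (-saddle (Fintype.card κ) N)) ≤
        C * N ^ A * ((parts κ N).card * Real.exp (-saddle (Fintype.card κ) N) ^ N) := by
  obtain ⟨δ, A, hδ, h⟩ := exists_le_card_parts κ
  refine ⟨δ⁻¹, A, inv_pos.2 hδ, fun N hN => ?_⟩
  have hk : 0 < Fintype.card κ := Fintype.card_pos
  have hx := saddle_pos hk hN
  refine (boltzmann_le hx N).trans ?_
  have h1 := h N hN
  have hN' : (0 : ℝ) < N := by exact_mod_cast hN
  have hc : 0 < growthSq (Fintype.card κ) := by linarith [one_le_growthSq hk]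
  rw [saddle] at *
  generalize growthSq (Fintype.card κ) = c at *
  have e1 : c / (√c / √(N : ℝ)) = √c * √(N : ℝ) := by
    have h3 : 0 < √c := Real.sqrt_pos.2 hc
    have h4 : 0 < √(N : ℝ) := Real.sqrt_pos.2 hN'
    have h2 : √c ^ 2 = c := Real.sq_sqrt hc.le
    field_simp
    rw [h2]
  have e2 : Real.exp (-(√c / √(N : ℝ))) ^ N = Real.exp (-(√c * √(N : ℝ))) := by
    rw [← Real.exp_nat_mul]
    congr 1
    have h4 : 0 < √(N : ℝ) := Real.sqrt_pos.2 hN'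
    have h2 : √(N : ℝ) ^ 2 = N := Real.sq_sqrt hN'.le
    field_simp
    rw [h2]
  rw [e1, e2]
  calc Real.exp (√c * √N) = δ⁻¹ * N ^ A * (δ * (Real.exp (2 * √c * √N) / N ^ A) *
        Real.exp (-(√c * √N))) := by
        have : Real.exp (2 * √c * √N) = Real.exp (√c * √N) * Real.exp (√c * √N) := by
          rw [← Real.exp_add]; congr 1; ring
        rw [this, Real.exp_neg]
        field_simp
    _ ≤ _ := by gcongr

end Boltzmann

section BoltzmannSums

theorem sum_prod_le_prod_sum {α B V : Type} [DecidableEq B] (D : Finset α) (S : Finset B)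
    (t : B → Finset V) (r : α → B → V) (hr : ∀ a ∈ D, ∀ b ∈ S, r a b ∈ t b)
    (hinj : ∀ a ∈ D, ∀ a' ∈ D, (∀ b ∈ S, r a b = r a' b) → a = a') (w : B → V → ℝ)
    (hw : ∀ b v, 0 ≤ w b v) :
    ∑ a ∈ D, ∏ b ∈ S, w b (r a b) ≤ ∏ b ∈ S, ∑ v ∈ t b, w b v := by
  classical
  rw [Finset.prod_sum]
  let e : α → ∀ b ∈ S, V := fun a b _ => r a b
  have he : Set.InjOn e D := fun a ha a' ha' h =>
    hinj a ha a' ha' fun b hb => congrFun (congrFun h b) hb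
  calc ∑ a ∈ D, ∏ b ∈ S, w b (r a b) = ∑ a ∈ D, ∏ b ∈ S.attach, w b (e a b b.2) := by
        refine Finset.sum_congr rfl fun a _ => ?_
        rw [← Finset.prod_attach]
    _ = ∑ p ∈ D.image e, ∏ b ∈ S.attach, w b (p b b.2) := by
        rw [Finset.sum_image he]
    _ ≤ _ := by
        refine Finset.sum_le_sum_of_subset_of_nonneg ?_ fun _ _ _ =>
          Finset.prod_nonneg fun _ _ => hw _ _
        intro p hp
        obtain ⟨a, ha, rfl⟩ := Finset.mem_image.1 hp
        exact Finset.mem_pi.2 fun b hb => hr a ha b hb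

variable {κ : Type}

theorem sum_finsupp_prod_le [DecidableEq κ] (I : Finset (ℕ × κ)) (R : Finset ℕ)
    (D : Finset (ℕ × κ →₀ ℕ)) (hD : ∀ f ∈ D, f.support ⊆ I ∧ ∀ T, f T ∈ R)
    (w : ℕ × κ → ℕ → ℝ) (hw : ∀ T a, 0 ≤ w T a) :
    ∑ f ∈ D, ∏ T ∈ I, w T (f T) ≤ ∏ T ∈ I, ∑ a ∈ R, w T a := by
  refine sum_prod_le_prod_sum D I (fun _ => R) (fun f T => f T) (fun f hf T _ => (hD f hf).2 T)
    (fun f hf g hg h => Finsupp.ext fun T => ?_) w hw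
  by_cases hT : T ∈ I
  · exact h T hT
  · rw [Finsupp.notMem_support_iff.1 fun h => hT ((hD f hf).1 h),
      Finsupp.notMem_support_iff.1 fun h => hT ((hD g hg).1 h)]

theorem pow_wt_eq_prod {f : ℕ × κ →₀ ℕ} {I : Finset (ℕ × κ)} (hf : f.support ⊆ I) (q : ℝ) :
    q ^ wt f = ∏ T ∈ I, q ^ (T.1 * f T) := by
  rw [Finset.prod_pow_eq_pow_sum, wt, Finsupp.sum_of_support_subset f hf _ fun _ _ => mul_zero _]

theorem sum_pow_mul_le {q : ℝ} (h0 : 0 ≤ q) (h1 : q < 1) {t : ℕ} (ht : t ≠ 0) (R : Finset ℕ) :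
    ∑ a ∈ R, q ^ (t * a) ≤ (1 - q ^ t)⁻¹ := by
  have h2 := pow_lt_one₀ h0 h1 ht
  have h3 := hasSum_geometric_of_lt_one (pow_nonneg h0 t) h2
  simp only [pow_mul]
  exact sum_le_hasSum _ (fun _ _ => pow_nonneg (pow_nonneg h0 t) _) h3

theorem sum_pow_mul_succ_le {q : ℝ} (h0 : 0 ≤ q) (h1 : q < 1) {t : ℕ} (ht : t ≠ 0)
    (R : Finset ℕ) :
    ∑ a ∈ R, q ^ (t * a) * ((a : ℝ) + 1) ≤ (1 - q ^ t)⁻¹ * (1 - q ^ t)⁻¹ := by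
  have h2 := pow_lt_one₀ h0 h1 ht
  have h3 := hasSum_choose_mul_geometric_of_norm_lt_one 1
    (r := q ^ t) (by rwa [Real.norm_of_nonneg (pow_nonneg h0 t)])
  have h4 := sum_le_hasSum R (fun _ _ => by positivity) h3
  refine le_trans (le_of_eq (Finset.sum_congr rfl fun a _ => ?_)) (h4.trans (le_of_eq ?_))
  · rw [pow_mul, Nat.choose_one_right]
    push_cast
    ring
  · rw [one_div, ← mul_inv]
    ring

theorem sum_parts_prod_le [Fintype κ] {q : ℝ} (h0 : 0 < q) (h1 : q < 1) (N g : ℕ)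
    (A : Finset ℕ) (o : κ) (hA : ∀ t ∈ A, t ≠ 0) (hAN : ∑ t ∈ A, t ≤ N)
    (hq : ∀ t ∈ A, q ^ t ≤ 1 / 2) :
    (∑ h ∈ parts κ (N - ∑ t ∈ A, t), ∏ t ∈ A, (g * (t * ((h (t, o) : ℝ) + 1)))) * q ^ N ≤
      boltzmann κ N q * ∏ t ∈ A, 2 * g * t * q ^ t := by
  classical
  set I := Finset.Icc 1 N ×ˢ (Finset.univ : Finset κ) with hI
  have hAI : ∀ F : ℕ × κ → ℝ,
      ∏ t ∈ A, F (t, o) = ∏ T ∈ I, if T.1 ∈ A ∧ T.2 = o then F T else 1 := by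
    intro F
    rw [← Finset.prod_filter]
    refine Finset.prod_bij (fun t _ => (t, o)) (fun t ht => ?_)
      (fun _ _ _ _ h => congrArg Prod.fst h)
      (fun T hT => ?_) fun _ _ => rfl
    · have h2 := Finset.single_le_sum (f := fun t => t) (fun _ _ => Nat.zero_le _) ht
      simp only [hI, Finset.mem_filter, Finset.mem_product, Finset.mem_Icc, Finset.mem_univ,
        and_true]
      exact ⟨⟨Nat.one_le_iff_ne_zero.2 (hA t ht), h2.trans hAN⟩, ht⟩
    · obtain ⟨-, h2, h3⟩ := Finset.mem_filter.1 hT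
      exact ⟨T.1, h2, Prod.ext rfl h3.symm⟩
  set M := N - ∑ t ∈ A, t with hM
  have hD : ∀ f ∈ parts κ M, f.support ⊆ I ∧ ∀ T, f T ∈ Finset.range (N + 1) := by
    intro f hf
    obtain ⟨h2, h3⟩ := mem_parts.1 hf
    obtain ⟨h4, h5⟩ := mem_box_of_wt h2 h3
    have hMN : M ≤ N := Nat.sub_le _ _
    refine ⟨h4.trans (Finset.product_subset_product_left (Finset.Icc_subset_Icc_right hMN)),
      fun T => ?_⟩
    have := Finset.mem_range.1 (h5 T)
    exact Finset.mem_range.2 (by omega)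
  have key := sum_finsupp_prod_le I (Finset.range (N + 1)) (parts κ M) hD
    (fun T a => q ^ (T.1 * a) * if T.1 ∈ A ∧ T.2 = o then (a : ℝ) + 1 else 1)
    fun T a => by positivity
  have hlhs : ∑ f ∈ parts κ M, ∏ T ∈ I,
      (q ^ (T.1 * f T) * if T.1 ∈ A ∧ T.2 = o then (f T : ℝ) + 1 else 1) =
      (∑ f ∈ parts κ M, ∏ t ∈ A, ((f (t, o) : ℝ) + 1)) * q ^ M := by
    rw [Finset.sum_mul]
    refine Finset.sum_congr rfl fun f hf => ?_
    rw [Finset.prod_mul_distrib, ← pow_wt_eq_prod (hD f hf).1, (mem_parts.1 hf).2,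
      hAI fun T => (f T : ℝ) + 1, mul_comm]
  have hrhs : ∏ T ∈ I, ∑ a ∈ Finset.range (N + 1),
      (q ^ (T.1 * a) * if T.1 ∈ A ∧ T.2 = o then (a : ℝ) + 1 else 1) ≤
      boltzmann κ N q * ∏ t ∈ A, 2 := by
    rw [hAI fun _ => 2, boltzmann, ← Finset.prod_mul_distrib]
    refine Finset.prod_le_prod (fun T _ => Finset.sum_nonneg fun a _ => by positivity)
      fun T hT => ?_
    have hT0 : T.1 ≠ 0 := by
      have := (Finset.mem_Icc.1 (Finset.mem_product.1 hT).1).1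
      omega
    have hpos : 0 < 1 - q ^ T.1 := sub_pos.2 (pow_lt_one₀ h0.le h1 hT0)
    split_ifs with h
    · refine (sum_pow_mul_succ_le h0.le h1 hT0 _).trans ?_
      refine mul_le_mul_of_nonneg_left ?_ (inv_nonneg.2 hpos.le)
      have := hq _ h.1
      rw [inv_le_comm₀ hpos (by norm_num)]
      linarith
    · simpa using sum_pow_mul_le h0.le h1 hT0 (Finset.range (N + 1))
  rw [hlhs] at key
  have key2 := key.trans hrhs
  have e1 : q ^ N = q ^ M * ∏ t ∈ A, q ^ t := by
    rw [Finset.prod_pow_eq_pow_sum, ← pow_add, hM, Nat.sub_add_cancel hAN]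
  calc _ = ((∑ f ∈ parts κ M, ∏ t ∈ A, ((f (t, o) : ℝ) + 1)) * q ^ M) *
        ∏ t ∈ A, ((g : ℝ) * t * q ^ t) := by
        rw [e1, Finset.prod_mul_distrib (g := fun t => q ^ t), Finset.sum_mul, Finset.sum_mul,
          Finset.sum_mul]
        refine Finset.sum_congr rfl fun f _ => ?_
        rw [show ∏ t ∈ A, ((g : ℝ) * (t * ((f (t, o) : ℝ) + 1))) =
          (∏ t ∈ A, ((f (t, o) : ℝ) + 1)) * ∏ t ∈ A, ((g : ℝ) * t) by
            rw [← Finset.prod_mul_distrib]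
            exact Finset.prod_congr rfl fun t _ => by ring]
        ring
    _ ≤ (boltzmann κ N q * ∏ t ∈ A, 2) * ∏ t ∈ A, ((g : ℝ) * t * q ^ t) := by
        gcongr
    _ = _ := by
        rw [mul_assoc, ← Finset.prod_mul_distrib]
        congr 1
        exact Finset.prod_congr rfl fun t _ => by ring

end BoltzmannSums

section Blocks

variable {κ : Type}

/-- The multiplicities of the parts `m, p m, …, p ^ (n - 1) m` contain a sub-collection
of total size `p ^ b m`. -/
def Splits (p n b : ℕ) (o : κ) (m : ℕ) (h : ℕ × κ →₀ ℕ) : Prop :=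
  ∃ u : ℕ → ℕ, (∀ i < n, u i ≤ h (p ^ i * m, o)) ∧ ∑ i ∈ Finset.range n, p ^ i * u i = p ^ b

open Classical in
/-- The parts of label `o` and sizes `m, p m, …, p ^ (n - 1) m`. -/
noncomputable def block (p n : ℕ) (o : κ) (m : ℕ) : Finset (ℕ × κ) :=
  (Finset.range n).image fun i => (p ^ i * m, o)

theorem mem_block {p n : ℕ} {o : κ} {m : ℕ} {T : ℕ × κ} :
    T ∈ block p n o m ↔ ∃ i < n, (p ^ i * m, o) = T := by
  classical
  simp [block]

theorem splits_filter {p n b : ℕ} {o : κ} {m : ℕ} {h : ℕ × κ →₀ ℕ}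
    [DecidablePred fun T => T ∈ block p n o m] :
    Splits p n b o m (h.filter fun T => T ∈ block p n o m) ↔ Splits p n b o m h := by
  refine exists_congr fun u => and_congr_left' (forall₂_congr fun i hi => ?_)
  rw [Finsupp.filter_apply_pos _ _ (mem_block.2 ⟨i, hi, rfl⟩)]

theorem pow_mul_le_sum_splits {q : ℝ} (h0 : 0 < q) {p n b m R : ℕ} (hp : 2 ≤ p) (hm : 0 < m)
    (hb : 2 * (n + 1) ≤ b) (hR : p ^ b < R) (o : κ)
    [DecidablePred fun v : ℕ × κ →₀ ℕ => Splits p (n + 1) b o m v] :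
    ((p ^ (b - 2 * (n + 1))) ^ n : ℕ) * q ^ (p ^ b * m) ≤
      ∑ v ∈ ((block p (n + 1) o m).finsupp fun _ => Finset.range R).filter
        (fun v => Splits p (n + 1) b o m v), q ^ wt v := by
  classical
  set K := p ^ (b - 2 * (n + 1)) with hK
  let u : (ℕ →₀ ℕ) → ℕ → ℕ := fun v i => Nat.casesOn i
    (p ^ b - ∑ i ∈ Finset.range n, p ^ (i + 1) * v i) v
  let F : (ℕ →₀ ℕ) → ℕ × κ →₀ ℕ := fun v =>
    ∑ i ∈ Finset.range (n + 1), Finsupp.single (p ^ i * m, o) (u v i)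
  have hF : ∀ v, ∀ i < n + 1, F v (p ^ i * m, o) = u v i := by
    intro v i hi
    simp only [F, Finsupp.finsetSum_apply]
    rw [Finset.sum_eq_single i, Finsupp.single_eq_same]
    · intro j _ hji
      refine Finsupp.single_eq_of_ne fun h => hji ?_
      have h2 : p ^ i * m = p ^ j * m := congrArg Prod.fst h
      exact (Nat.pow_right_injective hp (Nat.eq_of_mul_eq_mul_right hm h2)).symm
    · exact fun h => absurd (Finset.mem_range.2 hi) h
  set U := (Finset.range n).finsupp fun _ => Finset.range K with hU
  have hsum : ∀ v ∈ U, ∑ i ∈ Finset.range (n + 1), p ^ i * u v i = p ^ b := by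
    intro v hv
    rw [Finset.sum_range_succ']
    simp only [u, pow_zero, one_mul]
    refine Nat.add_sub_cancel' ?_
    calc ∑ i ∈ Finset.range n, p ^ (i + 1) * v i ≤ ∑ i ∈ Finset.range n, p ^ (n + 1) * K := by
          refine Finset.sum_le_sum fun i hi => Nat.mul_le_mul (Nat.pow_le_pow_right (by omega) ?_)
            (Finset.mem_range.1 ((Finset.mem_finsupp_iff.1 hv).2 i hi)).le
          have := Finset.mem_range.1 hi
          omega
      _ = n * (p ^ (n + 1) * K) := by simp
      _ ≤ p ^ (n + 1) * (p ^ (n + 1) * K) := by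
          refine Nat.mul_le_mul_right _ ?_
          exact (n.lt_succ_self.trans (Nat.lt_pow_self hp)).le
      _ = p ^ b := by rw [hK, ← pow_add, ← pow_add]; congr 1; omega
  have hwt : ∀ v ∈ U, wt (F v) = p ^ b * m := by
    intro v hv
    simp only [F]
    rw [wt_sum, ← hsum v hv, Finset.sum_mul]
    refine Finset.sum_congr rfl fun i _ => ?_
    rw [wt_single]
    ring
  have hinj : Set.InjOn F U := by
    intro v hv w hw h
    ext i
    by_cases hi : i ∈ Finset.range n
    · have hi' : i + 1 < n + 1 := by have := Finset.mem_range.1 hi; omega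
      have h1 := hF v (i + 1) hi'
      rw [h, hF w (i + 1) hi'] at h1
      exact h1.symm
    · rw [Finsupp.notMem_support_iff.1 fun h => hi ((Finset.mem_finsupp_iff.1 hv).1 h),
        Finsupp.notMem_support_iff.1 fun h => hi ((Finset.mem_finsupp_iff.1 hw).1 h)]
  have hcard : (U.image F).card = K ^ n := by
    rw [Finset.card_image_of_injOn hinj, hU, Finset.card_finsupp]
    simp
  calc ((K ^ n : ℕ) : ℝ) * q ^ (p ^ b * m) = ∑ h ∈ U.image F, q ^ wt h := by
        rw [Finset.sum_image hinj, Finset.sum_congr rfl fun v hv => by rw [hwt v hv],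
          Finset.sum_const, nsmul_eq_mul, ← hcard, Finset.card_image_of_injOn hinj]
    _ ≤ _ := by
        refine Finset.sum_le_sum_of_subset_of_nonneg ?_ fun _ _ _ => by positivity
        intro h hh
        obtain ⟨v, hv, rfl⟩ := Finset.mem_image.1 hh
        refine Finset.mem_filter.2 ⟨Finset.mem_finsupp_iff.2 ⟨?_, ?_⟩, u v,
          fun i hi => (hF v i hi).ge, hsum v hv⟩
        · refine Finsupp.support_finsetSum.trans (Finset.biUnion_subset.2 fun i hi => ?_)
          refine Finsupp.support_single_subset.trans (Finset.singleton_subset_iff.2 ?_)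
          exact mem_block.2 ⟨i, Finset.mem_range.1 hi, rfl⟩
        · intro T hT
          obtain ⟨i, hi, rfl⟩ := mem_block.1 hT
          have h1 := mul_le_wt (F v) (p ^ i * m, o)
          rw [hwt v hv] at h1
          refine Finset.mem_range.2 (lt_of_le_of_lt ?_ hR)
          have h2 : 1 ≤ p ^ i := Nat.one_le_pow _ _ (by omega)
          refine Nat.le_of_mul_le_mul_right (le_trans ?_ h1) hm
          dsimp only
          nlinarith [Nat.zero_le (m * F v (p ^ i * m, o))]

theorem sum_not_splits_le {q : ℝ} (h0 : 0 < q) (h1 : q < 1) {p n b m R : ℕ} (hp : 2 ≤ p)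
    (hm : 0 < m) (hb : 2 * (n + 1) ≤ b) (hR : p ^ b < R) (o : κ)
    [DecidablePred fun v : ℕ × κ →₀ ℕ => Splits p (n + 1) b o m v] :
    ∑ v ∈ (block p (n + 1) o m).finsupp (fun _ => Finset.range R),
        (if Splits p (n + 1) b o m v then 0 else q ^ wt v) ≤
      (∏ T ∈ block p (n + 1) o m, (1 - q ^ T.1)⁻¹) *
        (1 - ((p ^ (b - 2 * (n + 1))) ^ n : ℕ) * q ^ (p ^ b * m) * (1 - q ^ m) ^ (n + 1)) := by
  classical
  set J := block p (n + 1) o m with hJ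
  have hJ0 : ∀ T ∈ J, m ≤ T.1 := by
    intro T hT
    obtain ⟨i, -, rfl⟩ := mem_block.1 hT
    exact Nat.le_mul_of_pos_left _ (pow_pos (by omega) i)
  have hall : ∑ v ∈ J.finsupp (fun _ => Finset.range R), q ^ wt v ≤ ∏ T ∈ J, (1 - q ^ T.1)⁻¹ := by
    have h2 := sum_finsupp_prod_le J (Finset.range (R + 1)) (J.finsupp fun _ => Finset.range R)
      (fun f hf => ⟨(Finset.mem_finsupp_iff.1 hf).1, fun T => by
        by_cases hT : T ∈ J
        · have := Finset.mem_range.1 ((Finset.mem_finsupp_iff.1 hf).2 T hT)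
          exact Finset.mem_range.2 (by omega)
        · rw [Finsupp.notMem_support_iff.1 fun h => hT ((Finset.mem_finsupp_iff.1 hf).1 h)]
          exact Finset.mem_range.2 (by omega)⟩)
      (fun T a => q ^ (T.1 * a)) fun T a => by positivity
    refine le_trans (le_of_eq (Finset.sum_congr rfl fun f hf =>
      pow_wt_eq_prod (Finset.mem_finsupp_iff.1 hf).1 q)) (h2.trans ?_)
    refine Finset.prod_le_prod (fun T _ => Finset.sum_nonneg fun a _ => by positivity)
      fun T hT => sum_pow_mul_le h0.le h1 (by have := hJ0 T hT; omega) _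
  have hsplit := pow_mul_le_sum_splits h0 hp hm hb hR o
  have hone : (∏ T ∈ J, (1 - q ^ T.1)⁻¹) * (1 - q ^ m) ^ (n + 1) ≤ 1 := by
    have hqm : q ^ m < 1 := pow_lt_one₀ h0.le h1 hm.ne'
    have hcard : J.card ≤ n + 1 := Finset.card_image_le.trans (by simp)
    have h2 : ∏ T ∈ J, (1 - q ^ T.1)⁻¹ ≤ ((1 - q ^ m)⁻¹) ^ (n + 1) := by
      calc _ ≤ ∏ T ∈ J, (1 - q ^ m)⁻¹ := by
            refine Finset.prod_le_prod (fun T hT => ?_) fun T hT => ?_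
            · exact inv_nonneg.2 (sub_nonneg.2 (pow_le_one₀ h0.le h1.le))
            · have := pow_le_pow_of_le_one h0.le h1.le (hJ0 T hT)
              exact inv_anti₀ (by linarith) (by linarith)
        _ = ((1 - q ^ m)⁻¹) ^ J.card := by simp
        _ ≤ _ := pow_le_pow_right₀ ((one_le_inv₀ (by linarith)).2
            (by linarith [pow_pos h0 m])) hcard
    have h3 : 0 < (1 - q ^ m) := by linarith
    calc _ ≤ ((1 - q ^ m)⁻¹) ^ (n + 1) * (1 - q ^ m) ^ (n + 1) := by gcongr
      _ = 1 := by rw [← mul_pow, inv_mul_cancel₀ h3.ne', one_pow]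
  have hdecomp : ∑ v ∈ J.finsupp (fun _ => Finset.range R),
      (if Splits p (n + 1) b o m v then 0 else q ^ wt v) =
      ∑ v ∈ J.finsupp (fun _ => Finset.range R), q ^ wt v -
      ∑ v ∈ (J.finsupp fun _ => Finset.range R).filter (fun v => Splits p (n + 1) b o m v),
        q ^ wt v := by
    rw [Finset.sum_filter, ← Finset.sum_sub_distrib]
    refine Finset.sum_congr rfl fun v _ => ?_
    split_ifs <;> simp
  rw [hdecomp]
  have h5 : 0 ≤ (((p ^ (b - 2 * (n + 1))) ^ n : ℕ) : ℝ) * q ^ (p ^ b * m) := by positivity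
  nlinarith [mul_le_mul_of_nonneg_left hone h5]

theorem sum_filter_eq_self {B α : Type} [DecidableEq α] (S : Finset B) (J : B → Finset α)
    (f : α →₀ ℕ) (hcover : ∀ T ∈ f.support, ∃ b ∈ S, T ∈ J b)
    (hdisj : ∀ b ∈ S, ∀ b' ∈ S, ∀ T, T ∈ J b → T ∈ J b' → b = b') :
    ∑ b ∈ S, f.filter (fun T => T ∈ J b) = f := by
  ext T
  rw [Finsupp.finsetSum_apply]
  by_cases hT : T ∈ f.support
  · obtain ⟨b, hb, hTb⟩ := hcover T hT
    rw [Finset.sum_eq_single b]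
    · exact Finsupp.filter_apply_pos _ _ hTb
    · intro b' hb' hne
      exact Finsupp.filter_apply_neg _ _ fun h => hne (hdisj _ hb' _ hb T h hTb)
    · exact fun h => absurd hb h
  · rw [Finsupp.notMem_support_iff.1 hT]
    refine Finset.sum_eq_zero fun b _ => ?_
    rw [Finsupp.filter_apply, Finsupp.notMem_support_iff.1 hT]
    exact ite_self 0

theorem card_not_splits_le [Fintype κ] {q : ℝ} (h0 : 0 < q) (h1 : q < 1) {p n b N : ℕ}
    (hp : 2 ≤ p) (hb : 2 * (n + 1) ≤ b) (hbN : p ^ b ≤ N) (o : κ) (M : Finset ℕ)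
    (hM : ∀ m ∈ M, 0 < m) (hMN : ∀ m ∈ M, p ^ n * m ≤ N)
    (hinj : Set.InjOn (fun z : ℕ × ℕ => p ^ z.2 * z.1)
      (M ×ˢ Finset.range (n + 1) : Finset (ℕ × ℕ)))
    [DecidablePred fun f : ℕ × κ →₀ ℕ => ∀ m ∈ M, ¬ Splits p (n + 1) b o m f] :
    (((parts κ N).filter fun f => ∀ m ∈ M, ¬ Splits p (n + 1) b o m f).card : ℝ) * q ^ N ≤
      boltzmann κ N q * ∏ m ∈ M,
        (1 - ((p ^ (b - 2 * (n + 1))) ^ n : ℕ) * q ^ (p ^ b * m) * (1 - q ^ m) ^ (n + 1)) := by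
  classical
  set I := Finset.Icc 1 N ×ˢ (Finset.univ : Finset κ) with hI
  set rest := I \ M.biUnion (block p (n + 1) o) with hrest
  have hblock : ∀ m ∈ M, block p (n + 1) o m ⊆ I := by
    intro m hm T hT
    obtain ⟨i, hi, rfl⟩ := mem_block.1 hT
    refine Finset.mem_product.2 ⟨Finset.mem_Icc.2 ⟨?_, ?_⟩, Finset.mem_univ _⟩
    · exact Nat.mul_pos (pow_pos (by omega) i) (hM m hm)
    · refine le_trans (Nat.mul_le_mul_right _ (Nat.pow_le_pow_right (by omega) ?_)) (hMN m hm)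
      omega
  have hbdisj : ∀ m ∈ M, ∀ m' ∈ M, ∀ T, T ∈ block p (n + 1) o m → T ∈ block p (n + 1) o m' →
      m = m' := by
    intro m hm m' hm' T hT hT'
    obtain ⟨i, hi, rfl⟩ := mem_block.1 hT
    obtain ⟨j, hj, h⟩ := mem_block.1 hT'
    have := hinj (x₁ := (m, i)) (x₂ := (m', j))
      (Finset.mem_product.2 ⟨hm, Finset.mem_range.2 hi⟩)
      (Finset.mem_product.2 ⟨hm', Finset.mem_range.2 hj⟩) (congrArg Prod.fst h).symm
    exact congrArg Prod.fst this
  let J : Option ℕ → Finset (ℕ × κ) := fun z => z.elim rest (block p (n + 1) o)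
  let S : Finset (Option ℕ) := Finset.insertNone M
  let w : Option ℕ → (ℕ × κ →₀ ℕ) → ℝ := fun z v =>
    z.elim (q ^ wt v) fun m => if Splits p (n + 1) b o m v then 0 else q ^ wt v
  have hw : ∀ z v, 0 ≤ w z v := by
    rintro (_ | m) v
    · exact pow_nonneg h0.le _
    · simp only [w, Option.elim]
      split_ifs
      · exact le_rfl
      · exact pow_nonneg h0.le _
  set D := (parts κ N).filter fun f => ∀ m ∈ M, ¬ Splits p (n + 1) b o m f with hD
  have hbox : ∀ f ∈ D, f.support ⊆ I ∧ ∀ T, f T ∈ Finset.range (N + 1) := by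
    intro f hf
    obtain ⟨h2, h3⟩ := mem_parts.1 (Finset.mem_filter.1 hf).1
    exact mem_box_of_wt h2 h3
  have hself : ∀ f ∈ D, ∑ z ∈ S, f.filter (fun T => T ∈ J z) = f := by
    intro f hf
    refine sum_filter_eq_self S J f (fun T hT => ?_) ?_
    · by_cases h : T ∈ M.biUnion (block p (n + 1) o)
      · obtain ⟨m, hm, hT⟩ := Finset.mem_biUnion.1 h
        exact ⟨some m, Finset.some_mem_insertNone.2 hm, hT⟩
      · exact ⟨none, Finset.none_mem_insertNone, Finset.mem_sdiff.2 ⟨(hbox f hf).1 hT, h⟩⟩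
    · rintro (_ | m) hm (_ | m') hm' T hT hT'
      · rfl
      · exact absurd (Finset.mem_biUnion.2 ⟨m', Finset.some_mem_insertNone.1 hm', hT'⟩)
          (Finset.mem_sdiff.1 hT).2
      · exact absurd (Finset.mem_biUnion.2 ⟨m, Finset.some_mem_insertNone.1 hm, hT⟩)
          (Finset.mem_sdiff.1 hT').2
      · exact congrArg some (hbdisj m (Finset.some_mem_insertNone.1 hm) m'
          (Finset.some_mem_insertNone.1 hm') T hT hT')
  have key := sum_prod_le_prod_sum D S (fun z => (J z).finsupp fun _ => Finset.range (N + 1))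
    (fun f z => f.filter fun T => T ∈ J z)
    (fun f hf z _ => Finset.mem_finsupp_iff.2 ⟨fun T hT => by
      rw [Finsupp.support_filter, Finset.mem_filter] at hT
      exact hT.2, fun T hT => by
      rw [Finsupp.filter_apply_pos _ _ hT]
      exact (hbox f hf).2 T⟩)
    (fun f hf g hg h => by
      rw [← hself f hf, ← hself g hg]
      exact Finset.sum_congr rfl h) w hw
  have hlhs : ∑ f ∈ D, ∏ z ∈ S, w z (f.filter fun T => T ∈ J z) = D.card * q ^ N := by
    rw [← nsmul_eq_mul, ← Finset.sum_const]
    refine Finset.sum_congr rfl fun f hf => ?_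
    obtain ⟨hf1, hf2⟩ := Finset.mem_filter.1 hf
    calc _ = ∏ z ∈ S, q ^ wt (f.filter fun T => T ∈ J z) := by
          refine Finset.prod_congr rfl fun z hz => ?_
          rcases z with _ | m
          · rfl
          · refine if_neg fun h => ?_
            exact hf2 m (Finset.some_mem_insertNone.1 hz) (splits_filter.1 h)
      _ = q ^ N := by
          rw [Finset.prod_pow_eq_pow_sum, ← wt_sum, hself f hf, (mem_parts.1 hf1).2]
  have hrest_le : ∑ v ∈ rest.finsupp (fun _ => Finset.range (N + 1)), q ^ wt v ≤
      ∏ T ∈ rest, (1 - q ^ T.1)⁻¹ := by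
    have h2 := sum_finsupp_prod_le rest (Finset.range (N + 1))
      (rest.finsupp fun _ => Finset.range (N + 1))
      (fun f hf => ⟨(Finset.mem_finsupp_iff.1 hf).1, fun T => by
        by_cases hT : T ∈ rest
        · exact (Finset.mem_finsupp_iff.1 hf).2 T hT
        · rw [Finsupp.notMem_support_iff.1 fun h => hT ((Finset.mem_finsupp_iff.1 hf).1 h)]
          exact Finset.mem_range.2 (by omega)⟩)
      (fun T a => q ^ (T.1 * a)) fun T a => by positivity
    refine le_trans (le_of_eq (Finset.sum_congr rfl fun f hf =>
      pow_wt_eq_prod (Finset.mem_finsupp_iff.1 hf).1 q)) (h2.trans ?_)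
    refine Finset.prod_le_prod (fun T _ => Finset.sum_nonneg fun a _ => by positivity)
      fun T hT => sum_pow_mul_le h0.le h1 ?_ _
    have := (Finset.mem_Icc.1 (Finset.mem_product.1 (Finset.mem_sdiff.1 hT).1).1).1
    omega
  rw [hlhs] at key
  refine key.trans ?_
  rw [Finset.prod_insertNone]
  calc _ ≤ (∏ T ∈ rest, (1 - q ^ T.1)⁻¹) * ∏ m ∈ M, ((∏ T ∈ block p (n + 1) o m, (1 - q ^ T.1)⁻¹) *
        (1 - ((p ^ (b - 2 * (n + 1))) ^ n : ℕ) * q ^ (p ^ b * m) * (1 - q ^ m) ^ (n + 1))) := by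
        refine mul_le_mul hrest_le (Finset.prod_le_prod (fun m _ => Finset.sum_nonneg
          fun v _ => hw (some m) v) fun m hm => ?_)
          (Finset.prod_nonneg fun m _ => Finset.sum_nonneg fun v _ => hw (some m) v)
          (Finset.prod_nonneg fun T _ => inv_nonneg.2 (sub_nonneg.2 (pow_le_one₀ h0.le h1.le)))
        exact sum_not_splits_le h0 h1 hp (hM m hm) hb (Nat.lt_succ_of_le hbN) o
    _ = _ := by
        rw [Finset.prod_mul_distrib, ← mul_assoc, ← Finset.prod_biUnion]
        · rw [boltzmann, hrest, Finset.prod_sdiff (Finset.biUnion_subset.2 hblock)]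
        · intro m hm m' hm' hne
          exact Finset.disjoint_left.2 fun T hT hT' => hne (hbdisj m hm m' hm' T hT hT')

end Blocks

section Parameters

theorem eventually_mul_log_sq_le_sqrt (D : ℝ) :
    ∀ᶠ N : ℕ in atTop, D * Real.log N ^ 2 ≤ √N := by
  have h := (Real.isLittleO_pow_log_id_atTop (n := 4)).bound
    (show (0 : ℝ) < 1 / (D ^ 2 + 1) by positivity)
  filter_upwards [tendsto_natCast_atTop_atTop.eventually h, eventually_gt_atTop 0] with N hN hN0
  have hN' : (0 : ℝ) < N := by exact_mod_cast hN0
  rw [Real.norm_of_nonneg (by positivity), id, Real.norm_of_nonneg hN'.le] at hN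
  refine Real.le_sqrt_of_sq_le ?_
  have h2 : (D ^ 2 + 1) * Real.log N ^ 4 ≤ N := by
    calc _ ≤ (D ^ 2 + 1) * (1 / (D ^ 2 + 1) * N) := by gcongr
      _ = N := by field_simp
  nlinarith [pow_nonneg (sq_nonneg (Real.log N)) 2]

set_option maxHeartbeats 2000000 in
theorem exists_window {k p : ℕ} (hk : 0 < k) (hp : 2 ≤ p) : ∃ c : ℝ, 0 < c ∧
    ∀ᶠ N : ℕ in atTop, ∃ b H M : ℕ, 14 ≤ b ∧ p ^ b ≤ N ∧ 0 < H ∧ 0 < M ∧ ⌊Real.log N⌋₊ * H ≤ M ∧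
      ∀ m, M ≤ m → m < M + ⌊Real.log N⌋₊ * H →
        p ^ 6 * m ≤ N ∧ ⌊Real.log N⌋₊ * (p ^ b * m) ≤ N ∧
        Real.exp (-saddle k N) ^ (p ^ b * m) ≤ 1 / 2 ∧
        2 * (p ^ b * m : ℕ) * Real.exp (-saddle k N) ^ (p ^ b * m) ≤ 8 / ⌊Real.log N⌋₊ ∧
        c * ⌊Real.log N⌋₊ ^ 2 ≤ H * (((p ^ (b - 14)) ^ 6 : ℕ) *
          Real.exp (-saddle k N) ^ (p ^ b * m) * (1 - Real.exp (-saddle k N) ^ m) ^ 7) := by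
  have hp0 : (0 : ℝ) < p := by positivity
  have hβ : 1 ≤ √(growthSq k) := Real.one_le_sqrt.2 (one_le_growthSq hk)
  refine ⟨(1 / (2 * p + 1)) ^ 7 * Real.exp (-1) / (4 * √(growthSq k) * p ^ 84),
    by positivity, ?_⟩
  have hlog : Tendsto (fun N : ℕ => Real.log N) atTop atTop :=
    Real.tendsto_log_atTop.comp tendsto_natCast_atTop_atTop
  filter_upwards [eventually_mul_log_sq_le_sqrt (4 + 2 * p * √(growthSq k)),
    hlog.eventually_ge_atTop ((p : ℝ) ^ 14), eventually_gt_atTop 0] with N hD hL hN0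
  have hN' : (0 : ℝ) < N := by exact_mod_cast hN0
  set L := Real.log N with hLdef
  set β := √(growthSq k) with hβdef
  set ℓ := ⌊L⌋₊ with hℓ
  have hs0 : 0 < √(N : ℝ) := Real.sqrt_pos.2 hN'
  have hs2 : √(N : ℝ) ^ 2 = N := Real.sq_sqrt hN'.le
  have hx : saddle k N = β / √N := rfl
  set x := saddle k N with hxdef
  have hx0 : 0 < x := saddle_pos hk hN0
  have hxs : x * √N = β := by rw [hx]; field_simp
  have hL0 : 0 ≤ L := le_trans (by positivity) hL
  have hℓp : p ^ 14 ≤ ℓ := Nat.le_floor (by exact_mod_cast hL)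
  have hℓ1 : 1 ≤ ℓ := (Nat.one_le_pow 14 p (by omega)).trans hℓp
  have hℓ1' : (1 : ℝ) ≤ ℓ := by exact_mod_cast hℓ1
  have hℓL : (ℓ : ℝ) ≤ L := Nat.floor_le hL0
  have hLℓ : L ≤ 2 * ℓ := by linarith [Nat.lt_floor_add_one L]
  have hD2 : 4 * (ℓ : ℝ) ^ 2 + 2 * p * β * (ℓ : ℝ) ^ 2 ≤ √N := by
    calc _ = (4 + 2 * p * β) * (ℓ : ℝ) ^ 2 := by ring
      _ ≤ (4 + 2 * p * β) * L ^ 2 := by gcongr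
      _ ≤ _ := hD
  have hD4 : 4 * (ℓ : ℝ) ^ 2 ≤ √N := le_trans (le_add_of_nonneg_right (by positivity)) hD2
  have hDp : 2 * p * β * (ℓ : ℝ) ^ 2 ≤ √N := le_trans (le_add_of_nonneg_left (by positivity)) hD2
  set b := Nat.log p ℓ + 1 with hb
  have hb14 : 14 ≤ b := by
    have := (Nat.le_log_iff_pow_le (by omega) (by omega)).2 hℓp
    omega
  obtain ⟨B, hB⟩ : ∃ B : ℝ, B = ((p ^ b : ℕ) : ℝ) := ⟨_, rfl⟩
  have hB1 : (ℓ : ℝ) ≤ B := by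
    rw [hB]
    exact_mod_cast (Nat.lt_pow_succ_log_self (by omega) ℓ).le
  have hB2 : B ≤ p * ℓ := by
    rw [hB]
    have := Nat.pow_log_le_self p (x := ℓ) (by omega)
    have h2 : p ^ b ≤ p * ℓ := by rw [hb, pow_succ, mul_comm]; exact Nat.mul_le_mul_left p this
    exact_mod_cast h2
  have hB0 : 0 < B := by linarith
  have hxB : x * B * ℓ ≤ 1 / 2 := by
    have h2 : x * B * ℓ ≤ x * (p * ℓ) * ℓ := by gcongr
    have h3 : x * (p * ℓ) * ℓ = p * β * (ℓ : ℝ) ^ 2 / √N := by rw [hx]; field_simp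
    have h4 : p * β * (ℓ : ℝ) ^ 2 / √N ≤ 1 / 2 := by
      rw [div_le_iff₀ hs0]; linarith
    linarith
  have hxB' : x * B ≤ 1 / 2 :=
    (le_mul_of_one_le_right (by positivity) hℓ1').trans hxB
  set u := L / 2 + 2 * Real.log ℓ with hu
  have hlogℓ : 0 ≤ Real.log ℓ := Real.log_nonneg hℓ1'
  have hlogℓ2 : Real.log ℓ ≤ ℓ := (Real.log_le_sub_one_of_pos (by linarith)).trans (by linarith)
  have hu1 : L / 2 ≤ u := by rw [hu]; linarith
  have hu2 : u ≤ 3 * ℓ := by rw [hu]; linarith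
  have hu3 : (1 : ℝ) / 2 ≤ u := by linarith
  have hexpu : Real.exp (-u) = 1 / (√N * (ℓ : ℝ) ^ 2) := by
    have h2 : √(N : ℝ) * (ℓ : ℝ) ^ 2 = Real.exp u := by
      rw [hu, Real.exp_add]
      congr 1
      · rw [← Real.log_sqrt hN'.le, Real.exp_log hs0]
      · rw [two_mul, Real.exp_add, Real.exp_log (by linarith), sq]
    rw [h2, Real.exp_neg, one_div]
  set M := ⌈u / (x * B)⌉₊ with hM
  set H := ⌊1 / (2 * x * B * ℓ)⌋₊ with hH
  have hM1 : u ≤ x * B * M := by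
    have := Nat.le_ceil (u / (x * B))
    rw [div_le_iff₀ (by positivity)] at this
    linarith
  have hM2 : x * B * M ≤ u + x * B := by
    have h2 := (Nat.ceil_lt_add_one (show 0 ≤ u / (x * B) by positivity)).le
    calc x * B * M ≤ x * B * (u / (x * B) + 1) := by gcongr
      _ = _ := by field_simp
  have hH1 : x * B * (ℓ * H) ≤ 1 / 2 := by
    have h2 := Nat.floor_le (show 0 ≤ 1 / (2 * x * B * ℓ) by positivity)
    calc x * B * (ℓ * H) ≤ x * B * (ℓ * (1 / (2 * x * B * ℓ))) := by gcongr
      _ = _ := by field_simp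
  have hH0 : 1 ≤ H := by
    refine Nat.le_floor ?_
    rw [Nat.cast_one, le_div_iff₀ (by positivity)]; linarith
  have hH2 : 1 / (4 * x * B * ℓ) ≤ H := by
    have h2 := (Nat.lt_floor_add_one (1 / (2 * x * B * ℓ))).le
    have h4' : (1 : ℝ) ≤ H := by exact_mod_cast hH0
    have h5 : 1 / (4 * x * B * ℓ) = 1 / (2 * x * B * ℓ) / 2 := by field_simp; norm_num
    rw [h5]
    linarith
  have hM0 : 0 < M := Nat.ceil_pos.2 (by positivity)
  have hHM : ℓ * H ≤ M := by
    have h2 : x * B * ((ℓ * H : ℕ) : ℝ) ≤ x * B * M := by push_cast; linarith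
    exact_mod_cast le_of_mul_le_mul_left h2 (by positivity)
  have hsN : (4 * (ℓ : ℝ) * √N) * ℓ ≤ N := by
    calc _ = (4 * (ℓ : ℝ) ^ 2) * √N := by ring
      _ ≤ √N * √N := by gcongr
      _ = N := by rw [← sq, hs2]
  refine ⟨b, H, M, hb14, ?_, hH0, hM0, hHM, fun m hm1 hm2 => ?_⟩
  · have h2 : B ≤ N := by
      calc B ≤ p * ℓ := hB2
        _ ≤ 2 * p * β * (ℓ : ℝ) ^ 2 := by
          have : (p : ℝ) * ℓ ≤ p * ℓ * (2 * β * ℓ) :=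
            le_mul_of_one_le_right (by positivity) (by nlinarith)
          linarith
        _ ≤ √N := hDp
        _ ≤ √N * √N := le_mul_of_one_le_left hs0.le (Real.one_le_sqrt.2 (by exact_mod_cast hN0))
        _ = N := by rw [← sq, hs2]
    rw [hB] at h2
    exact_mod_cast h2
  · have hm1' : (M : ℝ) ≤ m := by exact_mod_cast hm1
    have hm2' : (m : ℝ) ≤ M + ℓ * H := by exact_mod_cast hm2.le
    have hl : u ≤ x * (B * m) := by
      calc u ≤ x * B * M := hM1
        _ ≤ x * B * m := by gcongr
        _ = _ := by ring
    have hr : x * (B * m) ≤ u + 1 := by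
      calc x * (B * m) ≤ x * (B * (M + ℓ * H)) := by gcongr
        _ = x * B * M + x * B * (ℓ * H) := by ring
        _ ≤ _ := by linarith
    have ht : B * m ≤ 4 * ℓ * √N := by
      refine le_of_mul_le_mul_left ?_ hx0
      calc x * (B * m) ≤ 4 * ℓ * 1 := by linarith
        _ ≤ 4 * ℓ * β := by gcongr
        _ = x * (4 * ℓ * √N) := by rw [← hxs]; ring
    have hcast : ((p ^ b * m : ℕ) : ℝ) = B * m := by rw [Nat.cast_mul, hB]
    have hq : Real.exp (-x) ^ (p ^ b * m) = Real.exp (-(x * (B * m))) := by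
      rw [← Real.exp_nat_mul, hcast]; congr 1; ring
    have hqu : Real.exp (-(x * (B * m))) ≤ 1 / (√N * (ℓ : ℝ) ^ 2) := by
      rw [← hexpu, Real.exp_le_exp]; linarith
    have hql : Real.exp (-1) * (1 / (√N * (ℓ : ℝ) ^ 2)) ≤ Real.exp (-(x * (B * m))) := by
      rw [← hexpu, ← Real.exp_add, Real.exp_le_exp]; linarith
    refine ⟨?_, ?_, ?_, ?_, ?_⟩
    · have h2 : p ^ 6 * m ≤ ℓ * (p ^ b * m) := by
        calc p ^ 6 * m = 1 * (p ^ 6 * m) := (one_mul _).symm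
          _ ≤ _ := Nat.mul_le_mul hℓ1
            (Nat.mul_le_mul_right _ (Nat.pow_le_pow_right (by omega) (by omega)))
      have h3 : ((ℓ * (p ^ b * m) : ℕ) : ℝ) ≤ N := by
        rw [Nat.cast_mul, hcast]
        calc (ℓ : ℝ) * (B * m) ≤ ℓ * (4 * ℓ * √N) := by gcongr
          _ = 4 * ℓ * √N * ℓ := by ring
          _ ≤ N := hsN
      exact h2.trans (by exact_mod_cast h3)
    · have h3 : ((ℓ * (p ^ b * m) : ℕ) : ℝ) ≤ N := by
        rw [Nat.cast_mul, hcast]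
        calc (ℓ : ℝ) * (B * m) ≤ ℓ * (4 * ℓ * √N) := by gcongr
          _ = 4 * ℓ * √N * ℓ := by ring
          _ ≤ N := hsN
      exact_mod_cast h3
    · rw [hq]
      refine hqu.trans ?_
      have h2 : (2 : ℝ) * 1 ≤ √N * (ℓ : ℝ) ^ 2 :=
        mul_le_mul (by linarith [one_le_pow₀ hℓ1' (n := 2)]) (one_le_pow₀ hℓ1')
          zero_le_one hs0.le
      exact one_div_le_one_div_of_le two_pos (by linarith)
    · rw [hq, hcast]
      calc 2 * (B * m) * Real.exp (-(x * (B * m)))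
          ≤ 2 * (4 * ℓ * √N) * (1 / (√N * (ℓ : ℝ) ^ 2)) := by gcongr
        _ = 8 / ℓ := by field_simp; norm_num
    · rw [hq]
      have hη : 1 / (2 * (p : ℝ) + 1) ≤ 1 - Real.exp (-x) ^ m := by
        have h2 : Real.exp (-x) ^ m = Real.exp (-(x * m)) := by
          rw [← Real.exp_nat_mul]; congr 1; ring
        have h3 : 1 / (2 * (p : ℝ)) ≤ x * m := by
          refine le_of_mul_le_mul_left ?_ hB0
          calc B * (1 / (2 * p)) ≤ p * ℓ * (1 / (2 * p)) := by gcongr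
            _ = ℓ / 2 := by field_simp
            _ ≤ u := by linarith
            _ ≤ x * (B * m) := hl
            _ = _ := by ring
        have h4 := one_sub_exp_neg_ge (show 0 < 1 / (2 * (p : ℝ)) by positivity)
        have h5 : Real.exp (-(x * m)) ≤ Real.exp (-(1 / (2 * (p : ℝ)))) :=
          Real.exp_le_exp.2 (by linarith)
        have h6 : 1 / (2 * (p : ℝ)) / (1 + 1 / (2 * p)) = 1 / (2 * p + 1) := by field_simp
        rw [h2]
        linarith
      have hK : (((p ^ (b - 14)) ^ 6 : ℕ) : ℝ) = B ^ 6 / p ^ 84 := by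
        rw [eq_div_iff (by positivity), hB]
        have h2 : (p ^ (b - 14)) ^ 6 * p ^ 84 = (p ^ b) ^ 6 := by
          rw [← pow_mul, ← pow_mul, ← pow_add]; congr 1; omega
        exact_mod_cast h2
      rw [hK]
      calc (1 / (2 * (p : ℝ) + 1)) ^ 7 * Real.exp (-1) / (4 * β * p ^ 84) * (ℓ : ℝ) ^ 2
          = (1 / (2 * (p : ℝ) + 1)) ^ 7 * Real.exp (-1) / (4 * β * p ^ 84 * ℓ ^ 3)
            * (ℓ : ℝ) ^ 5 := by field_simp
        _ ≤ (1 / (2 * (p : ℝ) + 1)) ^ 7 * Real.exp (-1) / (4 * β * p ^ 84 * ℓ ^ 3)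
            * B ^ 5 := by gcongr
        _ = 1 / (4 * x * B * ℓ) * (B ^ 6 / p ^ 84 * (Real.exp (-1) * (1 / (√N * (ℓ : ℝ) ^ 2))) *
            (1 / (2 * (p : ℝ) + 1)) ^ 7) := by rw [← hxs]; field_simp
        _ ≤ _ := by gcongr

end Parameters

section Limits

theorem eventually_floor_log_bounds {c C ε : ℝ} (hc : 0 < c) (hC : 0 < C) (hε : 0 < ε) (A g : ℕ) :
    ∀ᶠ N : ℕ in atTop, 1 ≤ ⌊Real.log N⌋₊ ∧
      ⌊Real.log N⌋₊ * (C * N ^ A * Real.exp (-(c * ⌊Real.log N⌋₊ ^ 2))) ≤ ε ∧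
      C * N ^ A * (g * (8 / ⌊Real.log N⌋₊)) ^ ⌊Real.log N⌋₊ ≤ ε := by
  have hℓ : Tendsto (fun N : ℕ => ⌊Real.log N⌋₊) atTop atTop :=
    tendsto_nat_floor_atTop.comp (Real.tendsto_log_atTop.comp tendsto_natCast_atTop_atTop)
  have hℓR : Tendsto (fun N : ℕ => ((⌊Real.log N⌋₊ : ℕ) : ℝ)) atTop atTop :=
    tendsto_natCast_atTop_atTop.comp hℓ
  have hexp : Tendsto (fun N : ℕ => C * Real.exp A * Real.exp (-((⌊Real.log N⌋₊ : ℕ) : ℝ)))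
      atTop (nhds 0) := by
    simpa using (Real.tendsto_exp_neg_atTop_nhds_zero.comp hℓR).const_mul (C * Real.exp A)
  filter_upwards [hℓ.eventually_ge_atTop 1, hexp.eventually_le_const hε,
    hℓR.eventually_ge_atTop ((A + 2) / c), hℓR.eventually_ge_atTop (g * 8 * Real.exp (A + 1)),
    eventually_gt_atTop 0] with N h1 hε' hA hg hN
  have hN' : (0 : ℝ) < N := by exact_mod_cast hN
  have hNℓ := Nat.lt_floor_add_one (Real.log N)
  obtain ⟨l, hl⟩ : ∃ l : ℕ, l = ⌊Real.log N⌋₊ := ⟨_, rfl⟩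
  rw [← hl] at h1 hε' hA hg hNℓ ⊢
  have hl0 : (0 : ℝ) < l := by exact_mod_cast h1
  have hNA : (N : ℝ) ^ A ≤ Real.exp A * Real.exp (A * l) := by
    calc (N : ℝ) ^ A = Real.exp (Real.log N) ^ A := by rw [Real.exp_log hN']
      _ ≤ Real.exp (l + 1) ^ A := by gcongr
      _ = _ := by rw [← Real.exp_nat_mul, ← Real.exp_add]; congr 1; ring
  refine ⟨h1, le_trans ?_ hε', le_trans ?_ hε'⟩
  · have h2 : (l : ℝ) ≤ Real.exp l := by linarith [Real.add_one_le_exp (l : ℝ)]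
    have h3 : (A + 2 : ℝ) ≤ c * l := by rw [div_le_iff₀ hc] at hA; linarith
    calc (l : ℝ) * (C * N ^ A * Real.exp (-(c * l ^ 2)))
        ≤ Real.exp l * (C * (Real.exp A * Real.exp (A * l)) * Real.exp (-(c * l ^ 2))) := by
          gcongr
      _ = C * Real.exp A * Real.exp (l + A * l + -(c * l ^ 2)) := by
          rw [Real.exp_add, Real.exp_add]; ring
      _ ≤ _ := by
          gcongr
          nlinarith
  · have h2 : (g : ℝ) * (8 / l) ≤ Real.exp (-(A + 1)) := by
      rw [Real.exp_neg, ← mul_div_assoc, div_le_iff₀ hl0, ← div_eq_inv_mul,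
        le_div_iff₀ (Real.exp_pos _)]
      exact hg
    calc C * (N : ℝ) ^ A * (g * (8 / l)) ^ l
        ≤ C * (Real.exp A * Real.exp (A * l)) * Real.exp (-(A + 1)) ^ l := by gcongr
      _ = _ := by
          rw [← Real.exp_nat_mul, mul_assoc C, mul_assoc (Real.exp A), ← Real.exp_add, mul_assoc C]
          congr 3; ring

end Limits

section Combine

theorem injOn_pow_mul_of_window {p : ℕ} (hp : 2 ≤ p) {M : ℕ} {S : Finset ℕ}
    (hS : ∀ m ∈ S, M ≤ m ∧ m < 2 * M) (n : ℕ) :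
    Set.InjOn (fun z : ℕ × ℕ => p ^ z.2 * z.1) (S ×ˢ Finset.range n : Finset (ℕ × ℕ)) := by
  have key : ∀ m m' i j : ℕ, m < 2 * M → M ≤ m' → p ^ i * m = p ^ j * m' → j ≤ i := by
    intro m m' i j hm hm' h
    by_contra! hij
    obtain ⟨d, rfl⟩ := Nat.exists_eq_add_of_lt hij
    have h2 : m = p * (p ^ d * m') := by
      refine Nat.eq_of_mul_eq_mul_left (show 0 < p ^ i by positivity) ?_
      rw [h]; ring
    have h3 : M ≤ p ^ d * m' := hm'.trans (Nat.le_mul_of_pos_left _ (by positivity))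
    have h4 := Nat.mul_le_mul hp h3
    omega
  rintro ⟨m, i⟩ h ⟨m', j⟩ h' e
  simp only [Finset.coe_product, Set.mem_prod, Finset.mem_coe] at h h' e
  obtain rfl : i = j := le_antisymm
    (key _ _ _ _ (hS _ h'.1).2 (hS _ h.1).1 e.symm) (key _ _ _ _ (hS _ h.1).2 (hS _ h'.1).1 e)
  rw [Nat.eq_of_mul_eq_mul_left (by positivity) e]

theorem prod_one_sub_le_exp {T : Finset ℕ} {π : ℕ → ℝ} {E : ℝ} {H : ℕ} (hH : 0 < H)
    (hT : T.card = H) (hπ : ∀ m ∈ T, π m ≤ 1) (hE : ∀ m ∈ T, E ≤ H * π m) :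
    ∏ m ∈ T, (1 - π m) ≤ Real.exp (-E) := by
  have hH' : (0 : ℝ) < H := by exact_mod_cast hH
  calc ∏ m ∈ T, (1 - π m) ≤ ∏ _m ∈ T, Real.exp (-(E / H)) := by
        refine Finset.prod_le_prod (fun m hm => sub_nonneg.2 (hπ m hm)) fun m hm => ?_
        have h1 : E / H ≤ π m := by rw [div_le_iff₀ hH']; linarith [hE m hm]
        linarith [Real.add_one_le_exp (-(E / H))]
    _ = Real.exp (-E) := by
        rw [Finset.prod_const, hT, ← Real.exp_nat_mul]
        congr 1; field_simp

theorem boltzmann_pos {κ : Type} [Fintype κ] {N : ℕ} {q : ℝ} (h0 : 0 ≤ q) (h1 : q < 1) :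
    0 < boltzmann κ N q := by
  refine Finset.prod_pos fun T hT => inv_pos.2 (sub_pos.2 (pow_lt_one₀ h0 h1 ?_))
  have := (Finset.mem_Icc.1 (Finset.mem_product.1 hT).1).1
  omega

theorem card_not_splits_group_le {κ : Type} [Fintype κ] {q : ℝ} (h0 : 0 < q) (h1 : q < 1)
    {p b N H : ℕ} (hp : 2 ≤ p) (hb : 14 ≤ b) (hbN : p ^ b ≤ N) (o : κ) {T : Finset ℕ}
    {M : ℕ} (hM0 : 0 < M) (hTM : ∀ m ∈ T, M ≤ m ∧ m < 2 * M) (hMN : ∀ m ∈ T, p ^ 6 * m ≤ N)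
    (hH : 0 < H) (hT : T.card = H) {E : ℝ}
    (hE : ∀ m ∈ T, E ≤ H * (((p ^ (b - 14)) ^ 6 : ℕ) * q ^ (p ^ b * m) * (1 - q ^ m) ^ 7))
    [DecidablePred fun f : ℕ × κ →₀ ℕ => ∀ m ∈ T, ¬ Splits p 7 b o m f] :
    (((parts κ N).filter fun f => ∀ m ∈ T, ¬ Splits p 7 b o m f).card : ℝ) * q ^ N ≤
      boltzmann κ N q * Real.exp (-E) := by
  classical
  have hpos : ∀ m ∈ T, 0 < m := fun m hm => hM0.trans_le (hTM m hm).1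
  have hB := boltzmann_pos (κ := κ) (N := N) h0.le h1
  refine (card_not_splits_le h0 h1 (n := 6) hp hb hbN o T hpos hMN
    (injOn_pow_mul_of_window hp hTM 7)).trans
    (mul_le_mul_of_nonneg_left (prod_one_sub_le_exp hH hT (fun m hm => ?_) hE) hB.le)
  have hsub : ∀ m' ∈ ({m} : Finset ℕ), m' ∈ T := fun m' h => by
    rw [Finset.mem_singleton.1 h]; exact hm
  have h2 := card_not_splits_le (κ := κ) h0 h1 (n := 6) hp hb hbN o {m}
    (fun m' h => hpos m' (hsub m' h)) (fun m' h => hMN m' (hsub m' h))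
    (injOn_pow_mul_of_window hp (fun m' h => hTM m' (hsub m' h)) 7)
  rw [Finset.prod_singleton] at h2
  have h3 := nonneg_of_mul_nonneg_right (le_trans (by positivity) h2) hB
  linarith

theorem sum_parts_image_le {κ : Type} [Fintype κ] {q : ℝ} (h0 : 0 < q) (h1 : q < 1)
    {P N l : ℕ} (hP : 0 < P) (hl : 0 < l) (g : ℕ) (o : κ) {S : Finset ℕ} (hS : S.card = l)
    (hS0 : ∀ m ∈ S, 0 < m) (hSN : ∀ m ∈ S, l * (P * m) ≤ N)
    (hq : ∀ m ∈ S, q ^ (P * m) ≤ 1 / 2) {a : ℝ}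
    (ha : ∀ m ∈ S, 2 * (P * m : ℕ) * q ^ (P * m) ≤ a) :
    (∑ h ∈ parts κ (N - ∑ m ∈ S, P * m),
      ∏ m ∈ S, ((g * (P * m * (h (P * m, o) + 1)) : ℕ) : ℝ)) * q ^ N ≤
      boltzmann κ N q * (g * a) ^ l := by
  have hinj : ∀ m ∈ S, ∀ m' ∈ S, P * m = P * m' → m = m' := fun m _ m' _ e =>
    Nat.eq_of_mul_eq_mul_left hP e
  have h := sum_parts_prod_le h0 h1 N g (S.image (P * ·)) o
    (fun t ht => by
      obtain ⟨m, hm, rfl⟩ := Finset.mem_image.1 ht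
      exact (Nat.mul_pos hP (hS0 m hm)).ne')
    (by
      rw [Finset.sum_image hinj]
      refine Nat.le_of_mul_le_mul_left ?_ hl
      rw [Finset.mul_sum]
      exact (Finset.sum_le_card_nsmul S _ N hSN).trans_eq (by rw [hS, smul_eq_mul]))
    (fun t ht => by
      obtain ⟨m, hm, rfl⟩ := Finset.mem_image.1 ht
      exact hq m hm)
  rw [Finset.sum_image hinj, Finset.prod_image hinj] at h
  simp only [Finset.prod_image hinj] at h
  push_cast at h ⊢
  refine h.trans (mul_le_mul_of_nonneg_left ?_ (boltzmann_nonneg h0.le h1))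
  rw [← hS, ← Finset.prod_const]
  refine Finset.prod_le_prod (fun m _ => by positivity) fun m hm => ?_
  have h2 := ha m hm
  push_cast at h2
  calc 2 * (g : ℝ) * (P * m) * q ^ (P * m) = g * (2 * (P * m) * q ^ (P * m)) := by ring
    _ ≤ g * a := by gcongr

end Combine

section Typical

theorem exists_sparse_complement (κ : Type) [Fintype κ] [Nonempty κ] (o : κ) {p : ℕ} (hp : 2 ≤ p)
    (g : ℕ) {ε : ℝ} (hε : 0 < ε) : ∀ᶠ N : ℕ in atTop, ∃ B : Finset (ℕ × κ →₀ ℕ),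
      (B.card : ℝ) ≤ ε * (parts κ N).card ∧ ∀ f ∈ parts κ N, f ∉ B →
        ∃ (S : Finset ℕ) (b : ℕ) (u : ℕ → ℕ → ℕ), 7 ≤ b ∧ 0 ∉ S ∧
          Set.InjOn (fun z : ℕ × ℕ => p ^ z.2 * z.1) (S ×ˢ Finset.range 7 : Finset (ℕ × ℕ)) ∧
          (∀ m ∈ S, ∀ i < 7, u m i ≤ f (p ^ i * m, o)) ∧
          (∀ m ∈ S, ∑ i ∈ Finset.range 7, p ^ i * u m i = p ^ b) ∧
          ∑ h ∈ parts κ (N - ∑ m ∈ S, p ^ b * m),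
            ∏ m ∈ S, ((g * (p ^ b * m * (h (p ^ b * m, o) + 1)) : ℕ) : ℝ) ≤
              ε * (parts κ N).card := by
  classical
  obtain ⟨C, A, hC, hboltz⟩ := exists_boltzmann_le κ
  obtain ⟨c, hc, hwin⟩ := exists_window (k := Fintype.card κ) (p := p) Fintype.card_pos hp
  filter_upwards [hwin, eventually_floor_log_bounds hc hC hε A g, eventually_gt_atTop 0] with
    N ⟨b, H, M, hb, hbN, hH, hM, hlHM, hw⟩ ⟨hl, hbad, hgood⟩ hN
  generalize ⌊Real.log N⌋₊ = l at *
  have hx := saddle_pos (k := Fintype.card κ) Fintype.card_pos hN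
  have hB := hboltz N hN
  obtain ⟨q, hq⟩ : ∃ q, q = Real.exp (-saddle (Fintype.card κ) N) := ⟨_, rfl⟩
  rw [← hq] at hB hw
  have h0 : 0 < q := hq ▸ Real.exp_pos _
  have h1 : q < 1 := by rw [hq, Real.exp_lt_one_iff]; linarith
  have hqN : 0 < q ^ N := by positivity
  have scale : ∀ {X Y : ℝ}, 0 ≤ Y → X * q ^ N ≤ boltzmann κ N q * Y →
      X ≤ C * N ^ A * Y * (parts κ N).card := by
    intro X Y hY h
    refine le_of_mul_le_mul_right (h.trans ?_) hqN
    calc boltzmann κ N q * Y ≤ C * N ^ A * ((parts κ N).card * q ^ N) * Y := by gcongr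
      _ = _ := by ring
  let T : ℕ → Finset ℕ := fun j => Finset.Ico (M + j * H) (M + (j + 1) * H)
  have hTw : ∀ j < l, ∀ m ∈ T j, M ≤ m ∧ m < M + l * H := by
    intro j hj m hm
    rw [Finset.mem_Ico] at hm
    have := Nat.mul_le_mul_right H (show j + 1 ≤ l from hj)
    omega
  have hTcard : ∀ j, (T j).card = H := by
    intro j
    rw [Nat.card_Ico, add_mul]
    omega
  let Bad : ℕ → Finset (ℕ × κ →₀ ℕ) := fun j =>
    (parts κ N).filter fun f => ∀ m ∈ T j, ¬ Splits p 7 b o m f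
  refine ⟨(Finset.range l).biUnion Bad, ?_, fun f hf hfB => ?_⟩
  · have hj : ∀ j ∈ Finset.range l, ((Bad j).card : ℝ) ≤
        C * N ^ A * Real.exp (-(c * l ^ 2)) * (parts κ N).card := by
      intro j hj
      rw [Finset.mem_range] at hj
      refine scale (Real.exp_pos _).le (card_not_splits_group_le h0 h1 hp hb hbN o hM
        (fun m hm => ?_) (fun m hm => ?_) hH (hTcard j) (fun m hm => ?_))
      · have := hTw j hj m hm
        omega
      · exact (hw m (hTw j hj m hm).1 (hTw j hj m hm).2).1
      · exact (hw m (hTw j hj m hm).1 (hTw j hj m hm).2).2.2.2.2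
    calc (((Finset.range l).biUnion Bad).card : ℝ) ≤ ∑ j ∈ Finset.range l, ((Bad j).card : ℝ) := by
          exact_mod_cast Finset.card_biUnion_le
      _ ≤ l * (C * N ^ A * Real.exp (-(c * l ^ 2)) * (parts κ N).card) := by
          simpa using Finset.sum_le_card_nsmul _ _ _ hj
      _ ≤ ε * (parts κ N).card := by
          rw [← mul_assoc]; gcongr
  · have hex : ∀ j, ∃ m, j < l → m ∈ T j ∧ Splits p 7 b o m f := by
      intro j
      by_cases hj : j < l
      · by_contra! h
        refine hfB (Finset.mem_biUnion.2 ⟨j, Finset.mem_range.2 hj,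
          Finset.mem_filter.2 ⟨hf, fun m hm hs => ?_⟩⟩)
        exact (h m).2 hm hs
      · exact ⟨0, fun h => absurd h hj⟩
    choose s hs using hex
    have hsinj : Set.InjOn s (Finset.range l) := by
      have key : ∀ i j, i < j → j < l → s i < s j := by
        intro i j hij hj
        have h2 := (Finset.mem_Ico.1 (hs i (hij.trans hj)).1).2
        have h3 := (Finset.mem_Ico.1 (hs j hj).1).1
        have := Nat.mul_le_mul_right H (show i + 1 ≤ j from hij)
        omega
      intro i hi j hj e
      simp only [Finset.coe_range, Set.mem_Iio] at hi hj
      rcases lt_trichotomy i j with h | h | h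
      · exact absurd e (key i j h hj).ne
      · exact h
      · exact absurd e (key j i h hi).ne'
    let S := (Finset.range l).image s
    have hS : ∀ m ∈ S, (M ≤ m ∧ m < M + l * H) ∧ Splits p 7 b o m f := by
      intro m hm
      obtain ⟨j, hj, rfl⟩ := Finset.mem_image.1 hm
      rw [Finset.mem_range] at hj
      exact ⟨hTw j hj _ (hs j hj).1, (hs j hj).2⟩
    have hSpos : ∀ m ∈ S, 0 < m := fun m hm => hM.trans_le (hS m hm).1.1
    have hu : ∀ m, ∃ u : ℕ → ℕ, m ∈ S → (∀ i < 7, u i ≤ f (p ^ i * m, o)) ∧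
        ∑ i ∈ Finset.range 7, p ^ i * u i = p ^ b := by
      intro m
      by_cases hm : m ∈ S
      · obtain ⟨u, h⟩ := (hS m hm).2
        exact ⟨u, fun _ => h⟩
      · exact ⟨0, fun h => absurd h hm⟩
    choose u hu using hu
    refine ⟨S, b, u, by omega, fun h => (hSpos 0 h).ne' rfl,
      injOn_pow_mul_of_window hp (M := M) (fun m hm => ?_) 7,
      fun m hm => (hu m hm).1, fun m hm => (hu m hm).2, ?_⟩
    · have := (hS m hm).1
      omega
    · have hw' := fun m (hm : m ∈ S) => hw m (hS m hm).1.1 (hS m hm).1.2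
      refine (scale (Y := (g * (8 / l)) ^ l) (by positivity)
        (sum_parts_image_le h0 h1 (by positivity) hl g o
        (by rw [Finset.card_image_of_injOn hsinj, Finset.card_range]) hSpos
        (fun m hm => (hw' m hm).2.1) (fun m hm => (hw' m hm).2.2.1)
        (fun m hm => (hw' m hm).2.2.2.1))).trans ?_
      gcongr

end Typical

section Proportion

theorem card_mul_card_sub_le {X Y : Type} [Finite X] [Finite Y] (D : X → Y → Prop) (B : Finset Y)
    {t : ℝ} (ht : 0 ≤ t) (h : ∀ y ∉ B, (Nat.card {x // ¬ D x y} : ℝ) ≤ t) :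
    (Nat.card X : ℝ) * Nat.card Y - (B.card * Nat.card X + Nat.card Y * t) ≤
      Nat.card {e : X × Y // D e.1 e.2} := by
  classical
  have := Fintype.ofFinite X
  have := Fintype.ofFinite Y
  have h1 : ((Nat.card {e : X × Y // D e.1 e.2} + Nat.card {e : X × Y // ¬ D e.1 e.2} : ℕ) : ℝ) =
      Nat.card X * Nat.card Y := by
    rw [← Nat.cast_mul, ← Nat.card_prod]
    simp only [Nat.card_eq_fintype_card, Fintype.card_subtype]
    rw [Finset.card_filter_add_card_filter_not, Finset.card_univ]
  let e : {e : X × Y // ¬ D e.1 e.2} ≃ Σ y : Y, {x // ¬ D x y} :=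
    { toFun := fun z => ⟨z.1.2, z.1.1, z.2⟩
      invFun := fun z => ⟨(z.2.1, z.1), z.2.2⟩
      left_inv := fun _ => rfl
      right_inv := fun _ => rfl }
  have h2 : (Nat.card {e : X × Y // ¬ D e.1 e.2} : ℝ) ≤
      B.card * Nat.card X + Nat.card Y * t := by
    rw [Nat.card_congr e, Nat.card_sigma, Nat.cast_sum]
    calc ∑ y : Y, (Nat.card {x // ¬ D x y} : ℝ)
        ≤ ∑ y : Y, ((if y ∈ B then (Nat.card X : ℝ) else 0) + t) := by
          refine Finset.sum_le_sum fun y _ => ?_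
          split_ifs with hy
          · have : (Nat.card {x // ¬ D x y} : ℝ) ≤ Nat.card X := by
              exact_mod_cast Nat.card_le_card_of_injective _ Subtype.val_injective
            linarith
          · linarith [h y hy]
      _ = _ := by
          rw [Finset.sum_add_distrib, ← Finset.sum_filter, Finset.filter_univ_mem]
          simp
  push_cast at h1
  linarith

theorem entryDivisible_mk {H : Type} [Group H] {p : ℕ} {χ : IrrChar H} {x : H} :
    EntryDivisible p χ (ConjClasses.mk x) ↔ ∃ m : ℤ, χ.1 x = (p : ℂ) * m := by
  refine ⟨?_, fun h => ⟨x, ConjClasses.mem_carrier_mk, h⟩⟩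
  rintro ⟨g, hg, m, hm⟩
  refine ⟨m, ?_⟩
  rw [← hm]
  exact irrChar_eq_of_isConj χ
    (ConjClasses.mk_eq_mk_iff_isConj.1 (ConjClasses.mem_carrier_iff_mk_eq.1 hg)).symm

instance finite_wreathProduct (G : Type) [Group G] [Finite G] (N : ℕ) :
    Finite (WreathProduct G N) :=
  Finite.of_equiv ((Fin N → G) × Equiv.Perm (Fin N)) SemidirectProduct.equivProd.symm

theorem eventually_card_entryDivisible {G : Type} [Group G] [Finite G] (hG : IsRationalGroup G)
    {p : ℕ} (hp : p.Prime) {ε : ℝ} (hε : 0 < ε) : ∀ᶠ N : ℕ in atTop,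
      (1 - 2 * ε) * ((Nat.card (IrrChar (WreathProduct G N)) : ℝ) *
        Nat.card (ConjClasses (WreathProduct G N))) ≤
      Nat.card {e : IrrChar (WreathProduct G N) × ConjClasses (WreathProduct G N) //
        EntryDivisible p e.1 e.2} := by
  classical
  have := Fintype.ofFinite (ConjClasses G)
  filter_upwards [exists_sparse_complement (ConjClasses G) 1 hp.two_le (Nat.card G) hε] with
    N ⟨B, hB, hf⟩
  obtain ⟨E, hE⟩ : ∃ E : ConjClasses (WreathProduct G N) ≃ parts (ConjClasses G) N,
      ∀ x, (E (ConjClasses.mk x)).1 = Wr.cyc x := by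
    have key : ∀ n, Nat.card (Fin N) = n → ∃ E : ConjClasses (WreathProduct G N) ≃
        parts (ConjClasses G) n, ∀ x, (E (ConjClasses.mk x)).1 = Wr.cyc x := by
      rintro _ rfl
      exact Wr.exists_equiv_parts
    exact key N (Nat.card_fin N)
  have hcard : Nat.card (ConjClasses (WreathProduct G N)) = (parts (ConjClasses G) N).card := by
    rw [Nat.card_congr E, Nat.card_eq_fintype_card, Fintype.card_coe]
  have := Fintype.ofFinite (ConjClasses (WreathProduct G N))
  let B' : Finset (ConjClasses (WreathProduct G N)) := Finset.univ.filter fun c => (E c).1 ∈ B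
  have hB' : B'.card ≤ B.card := Finset.card_le_card_of_injOn (fun c => (E c).1)
    (fun c hc => (Finset.mem_filter.1 hc).2)
    (Subtype.val_injective.comp E.injective).injOn
  have h := card_mul_card_sub_le
    (fun (χ : IrrChar (WreathProduct G N)) c => EntryDivisible p χ c) B'
    (t := ε * (parts (ConjClasses G) N).card) (by positivity) (fun c hc => by
      obtain ⟨x, rfl⟩ := ConjClasses.mk_surjective c
      have hx : (E (ConjClasses.mk x)).1 ∉ B := fun h =>
        hc (Finset.mem_filter.2 ⟨Finset.mem_univ _, h⟩)
      obtain ⟨S, b, u, hb, hS, hinj, hu, hsum, hle⟩ := hf _ (E (ConjClasses.mk x)).2 hx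
      rw [hE] at hu
      have h1 := Wr.card_not_dvd_le_of_config hG hp x S hb hS hinj u hu hsum
      rw [Nat.card_fin] at h1
      refine le_trans ?_ hle
      simp only [entryDivisible_mk]
      exact_mod_cast h1)
  rw [card_irrChar, hcard] at *
  have hB2 : (B'.card : ℝ) ≤ ε * (parts (ConjClasses G) N).card :=
    le_trans (by exact_mod_cast hB') hB
  refine le_trans ?_ h
  have := mul_le_mul_of_nonneg_right hB2 (Nat.cast_nonneg (α := ℝ) (parts (ConjClasses G) N).card)
  linarith

end Proportion

/-- If `G` is a finite group with integer-valued character table and `p`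
is a prime, then the proportion of entries of the character table of `G ≀ S_N` divisible by
`p` tends to `1` as `N → ∞`:  here `z(N)` counts the pairs (irreducible character,
conjugacy class) of `G ≀ S_N` whose entry is divisible by `p` and `c(N)` the total number
of entries, and `z(N)/c(N) → 1`. -/
theorem wreath_character_table_mostly_divisible (G : Type) [Group G] [Finite G]
    (hint : ∀ V : FDRep ℂ G, Simple V → ∀ g : G, ∃ n : ℤ, V.character g = n)
    (p : ℕ) (hp : p.Prime) :
    Tendsto
      (fun N : ℕ =>
        (Nat.card { e : IrrChar (WreathProduct G N) × ConjClasses (WreathProduct G N) //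
            EntryDivisible p e.1 e.2 } : ℝ) /
          ((Nat.card (IrrChar (WreathProduct G N)) : ℝ) *
            (Nat.card (ConjClasses (WreathProduct G N)) : ℝ)))
      atTop (nhds 1) := by
  rw [tendsto_order]
  refine ⟨fun a ha => ?_, fun a ha => Eventually.of_forall fun N => ?_⟩
  · filter_upwards [eventually_card_entryDivisible (isRationalGroup_of_integral hint) hp
      (show 0 < (1 - a) / 4 by linarith)] with N hN
    have hc : (0 : ℝ) < Nat.card (ConjClasses (WreathProduct G N)) := by
      exact_mod_cast Nat.card_pos
    have hI : (0 : ℝ) < Nat.card (IrrChar (WreathProduct G N)) := by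
      rwa [card_irrChar]
    rw [lt_div_iff₀ (by positivity)]
    refine lt_of_lt_of_le ?_ hN
    gcongr
    linarith
  · refine lt_of_le_of_lt (div_le_one_of_le₀ ?_ (by positivity)) ha
    rw [← Nat.cast_mul, ← Nat.card_prod]
    exact_mod_cast Nat.card_le_card_of_injective (Subtype.val (p := fun e :
      IrrChar (WreathProduct G N) × ConjClasses (WreathProduct G N) => EntryDivisible p e.1 e.2))
      Subtype.val_injective
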